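/- There exist infinitely many pairwise non-equivalent pairs (Ω, u), where Ω ⊂ ℝ² is a ring-shaped bounded domain with smooth boundary and u solves Δu = −2 in Ω with u = 0 on ∂Ω, such that |∇u| is locally constant on ∂Ω (i.e., constant on each of the two connected components of ∂Ω) and (Ω, u) is not equivalent to any ring-shaped model solution (Ω_R, u_R); in particular Ω is not rotationally symmetric. -/

import Mathlib

open Set MeasureTheory Filter
open scoped RealInnerProductSpace ENNReal Topology

noncomputable section

/-- The Euclidean plane. -/
abbrev E2 : Type := EuclideanSpace ℝ (Fin 2)

/-- The Laplacian of `u : ℝ² → ℝ` at `x`. -/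
def lap (u : E2 → ℝ) (x : E2) : ℝ :=
  ∑ i : Fin 2, iteratedFDeriv ℝ 2 u x
    ![EuclideanSpace.single i (1:ℝ), EuclideanSpace.single i (1:ℝ)]

/-- `Ω` has smooth boundary: near each boundary point there is a smooth defining function
with nonvanishing differential. -/
def SmoothBoundary (Ω : Set E2) : Prop :=
  ∀ x ∈ frontier Ω, ∃ (U : Set E2) (f : E2 → ℝ), IsOpen U ∧ x ∈ U ∧
    ContDiff ℝ (⊤ : ℕ∞) f ∧ (∀ y ∈ U, fderiv ℝ f y ≠ 0) ∧
    (Ω ∩ U = {y | y ∈ U ∧ f y < 0}) ∧ (frontier Ω ∩ U = {y | y ∈ U ∧ f y = 0})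

/-- A solution `(Ω, u)` of the Serrin-type Dirichlet problem `Δu = -2` in `Ω`, `u = 0` on `∂Ω`,
on an open bounded connected domain with smooth boundary, `u` smooth up to the boundary. -/
structure IsSerrinSolution (Ω : Set E2) (u : E2 → ℝ) : Prop where
  isOpen : IsOpen Ω
  bounded : Bornology.IsBounded Ω
  connected : IsConnected Ω
  smoothBoundary : SmoothBoundary Ω
  smooth : ContDiffOn ℝ (⊤ : ℕ∞) u (closure Ω)
  pde : ∀ x ∈ Ω, lap u x = -2
  bdry : ∀ x ∈ frontier Ω, u x = 0

/-- `u_max`, the maximum of `u` on the closure of `Ω`. -/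
def umax (Ω : Set E2) (u : E2 → ℝ) : ℝ := sSup (u '' closure Ω)

/-- `MAX(u) = {p ∈ Ω : u p = u_max}`. -/
def MAXset (Ω : Set E2) (u : E2 → ℝ) : Set E2 := {p | p ∈ Ω ∧ u p = umax Ω u}

/-- `N` is a connected component of `S`. -/
def IsCompOf (N S : Set E2) : Prop := ∃ p ∈ S, N = connectedComponentIn S p

/-- The normalised wall shear stress computed over a set `S` (e.g. a boundary component):
`sup_S |∇u| / √(2 u_max)`. -/
def nwssOn (Ω : Set E2) (u : E2 → ℝ) (S : Set E2) : ℝ :=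
  sSup ((fun x => ‖gradient u x‖) '' S) / Real.sqrt (2 * umax Ω u)

/-- The normalised wall shear stress of a region `N ⊆ Ω ∖ MAX(u)`: the NWSS over
`∂Ω ∩ closure N`. -/
def nwssRegion (Ω : Set E2) (u : E2 → ℝ) (N : Set E2) : ℝ :=
  nwssOn Ω u (frontier Ω ∩ closure N)

/-- `r_i(R)`: the smallest positive zero of `ρ ↦ 1 - ρ² + 2 R² log ρ`. -/
def innerRadius (R : ℝ) : ℝ :=
  sInf {ρ : ℝ | 0 < ρ ∧ 1 - ρ^2 + 2*R^2*Real.log ρ = 0}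

/-- The ring-shaped model domain `Ω_R = {r_i(R) < |x| < 1}`. -/
def modelDomain (R : ℝ) : Set E2 := {x : E2 | innerRadius R < ‖x‖ ∧ ‖x‖ < 1}

/-- The ring-shaped model solution `u_R(x) = (1 - |x|²)/2 + R² log |x|`. -/
def modelU (R : ℝ) (x : E2) : ℝ := (1 - ‖x‖^2)/2 + R^2 * Real.log ‖x‖

/-- `(u_R)_max = (1 - R²)/2 + R² log R`. -/
def modelUmax (R : ℝ) : ℝ := (1 - R^2)/2 + R^2 * Real.log R

/-- The outer NWSS function `τ̄_o`. -/
def tauOut (R : ℝ) : ℝ :=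
  if R = 0 then 1 else (1 - R^2)/Real.sqrt (1 - R^2 + 2*R^2*Real.log R)

/-- The inner NWSS function `τ̄_i`. -/
def tauIn (R : ℝ) : ℝ :=
  if R = 1 then Real.sqrt 2
  else (R^2 - (innerRadius R)^2)/(innerRadius R * Real.sqrt (1 - R^2 + 2*R^2*Real.log R))

/-- `(Ω', u')` is obtained from `(Ω, u)` by the translation-dilation `x ↦ x₀ + λ x`,
`u ↦ λ² u(·/λ)`. -/
def EquivPair (Ω : Set E2) (u : E2 → ℝ) (Ω' : Set E2) (u' : E2 → ℝ) : Prop :=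
  ∃ (lam : ℝ) (x₀ : E2), 0 < lam ∧ Ω' = (fun x => x₀ + lam • x) '' Ω ∧
    ∀ x ∈ Ω, u' (x₀ + lam • x) = lam^2 * u x

/-- `(Ω, u)` is, up to a translation and a dilation, Serrin's solution
`(B(0,1), (1 - |x|²)/2)`. -/
def IsSerrinModel (Ω : Set E2) (u : E2 → ℝ) : Prop :=
  ∃ (x₀ : E2) (lam : ℝ), 0 < lam ∧ Ω = Metric.ball x₀ lam ∧
    ∀ x ∈ Ω, u x = (lam^2 - ‖x - x₀‖^2)/2

/-- `Ω` is ring-shaped, with `A` the unbounded connected component of `ℝ² ∖ closure Ω`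
and `B` the other (bounded) one; the outer boundary component is `Γ_o = ∂Ω ∩ closure A`
and the inner one is `Γ_i = ∂Ω ∩ closure B`. -/
def RingShapedWith (Ω A B : Set E2) : Prop :=
  A ≠ B ∧ ¬ Bornology.IsBounded A ∧
  ∀ C : Set E2, (∃ p ∈ (closure Ω)ᶜ, C = connectedComponentIn (closure Ω)ᶜ p) ↔ (C = A ∨ C = B)

/-- `S` is a smooth simple closed curve in the plane (admitting a smooth, unit-speed,
periodic, injective-on-a-period parametrization). -/
def IsSmoothSimpleClosedCurve (S : Set E2) : Prop :=
  ∃ (γ : ℝ → E2) (L : ℝ), 0 < L ∧ ContDiff ℝ (⊤ : ℕ∞) γ ∧ (∀ t, ‖deriv γ t‖ = 1) ∧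
    (∀ t, γ (t + L) = γ t) ∧ InjOn γ (Ico 0 L) ∧ S = range γ

/-- The outward unit normal `-∇u/|∇u|` of `Ω` along `∂Ω` (where `u = 0` and `u > 0` inside). -/
def outNormal (u : E2 → ℝ) (x : E2) : E2 := -(‖gradient u x‖)⁻¹ • gradient u x

section

set_option maxSynthPendingDepth 3

/-- The space of summable two-sided real sequences. -/
abbrev L1 : Type := lp (fun _ : ℤ => ℝ) 1

/-- The unit sequence supported at `n`. -/
def dl (n : ℤ) : L1 := lp.single 1 n (1 : ℝ)

theorem norm_dl (n : ℤ) : ‖dl n‖ = 1 := by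
  simp [dl, lp.norm_single]

theorem dl_apply (n k : ℤ) : (dl n : ℤ → ℝ) k = if k = n then 1 else 0 := by
  simp [dl, lp.single_apply, Pi.single_apply]

theorem L1.hasSum_dl (a : L1) : HasSum (fun n => a n • dl n) a := by
  have h := lp.hasSum_single (p := 1) (by simp) a
  convert h using 2 with n
  ext k
  simp [dl, lp.single_apply, Pi.single_apply]

theorem L1.hasSum_norm (a : L1) : HasSum (fun n => |a n|) ‖a‖ := by
  have h := lp.hasSum_norm (p := 1) (by simp) a
  simpa using h

section

variable {E : Type} [NormedAddCommGroup E] [NormedSpace ℝ E]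

theorem hasSum_clm (A : L1 →L[ℝ] E) (a : L1) : HasSum (fun n => a n • A (dl n)) (A a) := by
  simpa using A.hasSum a.hasSum_dl

theorem clm_ext {A B : L1 →L[ℝ] E} (h : ∀ n, A (dl n) = B (dl n)) : A = B := by
  ext1 a
  have h1 := hasSum_clm A a
  simp only [h] at h1
  exact h1.unique (hasSum_clm B a)

theorem norm_clm_le {A : L1 →L[ℝ] E} {C : ℝ} (hC : 0 ≤ C) (h : ∀ n, ‖A (dl n)‖ ≤ C) :
    ‖A‖ ≤ C := by
  refine A.opNorm_le_bound hC fun a => ?_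
  have h1 := (a.hasSum_norm.mul_left C)
  refine (hasSum_clm A a).norm_le_of_bounded h1 fun n => ?_
  rw [norm_smul, Real.norm_eq_abs, mul_comm]
  exact mul_le_mul_of_nonneg_right (h n) (abs_nonneg _)

/-- Every bounded family of vectors extends to a bounded operator on `L1`. -/
theorem exists_clm [CompleteSpace E] (e : ℤ → E) (C : ℝ) (h : ∀ n, ‖e n‖ ≤ C) :
    ∃ A : L1 →L[ℝ] E, ∀ n, A (dl n) = e n := by
  have hs : ∀ a : L1, Summable fun n => a n • e n := fun a => by
    refine Summable.of_norm_bounded (a.hasSum_norm.summable.mul_left C) fun n => ?_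
    rw [norm_smul, Real.norm_eq_abs, mul_comm]
    exact mul_le_mul_of_nonneg_right (h n) (abs_nonneg _)
  let A : L1 →ₗ[ℝ] E :=
    { toFun := fun a => ∑' n, a n • e n
      map_add' := fun a b => by
        rw [← (hs a).tsum_add (hs b)]
        simp [add_smul]
      map_smul' := fun r a => by
        simp only [lp.coeFn_smul, Pi.smul_apply, smul_eq_mul, RingHom.id_apply, mul_smul]
        exact (hs a).tsum_const_smul r }
  refine ⟨A.mkContinuous C fun a => ?_, fun n => ?_⟩
  · refine (hs a).hasSum.norm_le_of_bounded (a.hasSum_norm.mul_left C) fun n => ?_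
    rw [norm_smul, Real.norm_eq_abs, mul_comm]
    exact mul_le_mul_of_nonneg_right (h n) (abs_nonneg _)
  · change ∑' k, (dl n : ℤ → ℝ) k • e k = e n
    rw [tsum_eq_single n (fun k hk => by simp [dl_apply, hk])]
    simp [dl_apply]

/-- An operator on `L1` preserving the planes spanned by `dl n, dl (-n)` is invertible when its
`2 × 2` blocks have determinants bounded away from zero. -/
theorem isInvertible_of_blocks (A : L1 →L[ℝ] L1) (p q : ℤ → ℝ) (C d : ℝ) (hd : 0 < d)
    (hp : ∀ n, |p n| ≤ C) (hq : ∀ n, |q n| ≤ C)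
    (hA : ∀ n, A (dl n) = p n • dl n + q n • dl (-n))
    (hdet : ∀ n, d ≤ |p n * p (-n) - q n * q (-n)|) : A.IsInvertible := by
  set D : ℤ → ℝ := fun n => p n * p (-n) - q n * q (-n) with hD
  have hD0 : ∀ n, D n ≠ 0 := fun n h0 => by
    have := hdet n
    rw [show p n * p (-n) - q n * q (-n) = 0 from h0, abs_zero] at this
    linarith
  have hDs : ∀ n, D (-n) = D n := fun n => by simp [hD]; ring
  have hC : 0 ≤ C := (abs_nonneg _).trans (hp 0)
  have hdiv : ∀ (x : ℝ) n, |x| ≤ C → |x / D n| ≤ C / d := fun x n hx => by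
    rw [abs_div]
    exact div_le_div₀ hC hx hd (hdet n)
  obtain ⟨B, hB⟩ := exists_clm (fun n => (p (-n) / D n) • dl n - (q n / D n) • dl (-n))
    (C / d + C / d) (fun n => by
      refine (norm_sub_le _ _).trans (add_le_add ?_ ?_)
      · rw [norm_smul, norm_dl, mul_one]; exact hdiv _ _ (hp _)
      · rw [norm_smul, norm_dl, mul_one]; exact hdiv _ _ (hq _))
  have h1 : A ∘L B = ContinuousLinearMap.id ℝ L1 := clm_ext fun n => by
    have e1 : p (-n) / D n * p n - q n / D n * q (-n) = 1 := by
      field_simp [hD0 n]; simp [hD]; ring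
    have e2 : p (-n) / D n * q n - q n / D n * p (-n) = 0 := by ring
    have : A (B (dl n)) = (p (-n) / D n * p n - q n / D n * q (-n)) • dl n
        + (p (-n) / D n * q n - q n / D n * p (-n)) • dl (-n) := by
      rw [hB, map_sub, map_smul, map_smul, hA, hA, neg_neg]; module
    simpa [e1, e2] using this
  have h2 : B ∘L A = ContinuousLinearMap.id ℝ L1 := clm_ext fun n => by
    have e1 : p n * (p (-n) / D n) - q n * (q (-n) / D n) = 1 := by
      field_simp [hD0 n]; simp [hD]
    have e2 : q n * (p n / D n) - p n * (q n / D n) = 0 := by ring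
    have : B (A (dl n)) = (p n * (p (-n) / D n) - q n * (q (-n) / D n)) • dl n
        + (q n * (p n / D n) - p n * (q n / D n)) • dl (-n) := by
      rw [hA, map_add, map_smul, map_smul, hB, hB, neg_neg, hDs]; module
    simpa [e1, e2] using this
  exact ContinuousLinearMap.IsInvertible.of_inverse h1 h2

/-- A family of operators on `L1` is Lipschitz as soon as it is on the unit sequences. -/
theorem continuous_clm_family {A : ℝ → L1 →L[ℝ] E} {C : ℝ} (hC : 0 ≤ C)
    (h : ∀ s t n, ‖A s (dl n) - A t (dl n)‖ ≤ C * |s - t|) : ∀ s t, ‖A s - A t‖ ≤ C * |s - t| :=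
  fun s t => norm_clm_le (by positivity) fun n => h s t n

theorem continuous_of_norm_sub_le {F : Type} [NormedAddCommGroup F] {A : ℝ → F} {C : ℝ} (h : ∀ s t, ‖A s - A t‖ ≤ C * |s - t|) :
    Continuous A := by
  have : LipschitzWith C.toNNReal A := LipschitzWith.of_dist_le_mul fun s t => by
    rw [dist_eq_norm, Real.dist_eq]
    exact (h s t).trans (mul_le_mul_of_nonneg_right (Real.le_coe_toNNReal C) (abs_nonneg _))
  exact this.continuous

end

theorem exists_clm_family {E : Type} [NormedAddCommGroup E] [NormedSpace ℝ E] [CompleteSpace E]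
    {C K : ℝ} (hC : 0 ≤ C) (hK : 0 ≤ K) (e : ℝ → ℤ → E) (h : ∀ t n, ‖e t n‖ ≤ C)
    (hL : ∀ s t n, ‖e s n - e t n‖ ≤ K * |s - t|) :
    ∃ A : ℝ → L1 →L[ℝ] E, (∀ t n, A t (dl n) = e t n) ∧ (∀ t, ‖A t‖ ≤ C) ∧
      ∀ s t, ‖A s - A t‖ ≤ K * |s - t| := by
  choose A hA using fun t => exists_clm (e t) C (h t)
  refine ⟨A, hA, fun t => norm_clm_le hC fun n => by rw [hA]; exact h t n,
    continuous_clm_family hK fun s t n => ?_⟩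
  rw [hA, hA]
  exact hL s t n

theorem exists_bilin_family {E : Type} [NormedAddCommGroup E] [NormedSpace ℝ E] [CompleteSpace E]
    {C K : ℝ} (hC : 0 ≤ C) (hK : 0 ≤ K) (e : ℝ → ℤ → ℤ → E) (h : ∀ t n m, ‖e t n m‖ ≤ C)
    (hL : ∀ s t n m, ‖e s n m - e t n m‖ ≤ K * |s - t|) :
    ∃ A : ℝ → L1 →L[ℝ] L1 →L[ℝ] E, (∀ t n m, A t (dl n) (dl m) = e t n m) ∧
      (∀ t, ‖A t‖ ≤ C) ∧ ∀ s t, ‖A s - A t‖ ≤ K * |s - t| := by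
  choose B hB1 hB2 hB3 using fun n : ℤ => exists_clm_family hC hK (fun t m => e t n m)
    (fun t m => h t n m) (fun s t m => hL s t n m)
  obtain ⟨A, hA1, hA2, hA3⟩ := exists_clm_family hC hK (fun t n => B n t)
    (fun t n => hB2 n t) (fun s t n => hB3 n s t)
  exact ⟨A, fun t n m => by rw [hA1, hB1], hA2, hA3⟩

theorem exists_trilin_family {E : Type} [NormedAddCommGroup E] [NormedSpace ℝ E] [CompleteSpace E]
    {C K : ℝ} (hC : 0 ≤ C) (hK : 0 ≤ K) (e : ℝ → ℤ → ℤ → ℤ → E)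
    (h : ∀ t n m l, ‖e t n m l‖ ≤ C)
    (hL : ∀ s t n m l, ‖e s n m l - e t n m l‖ ≤ K * |s - t|) :
    ∃ A : ℝ → L1 →L[ℝ] L1 →L[ℝ] L1 →L[ℝ] E,
      (∀ t n m l, A t (dl n) (dl m) (dl l) = e t n m l) ∧
      ∀ s t, ‖A s - A t‖ ≤ K * |s - t| := by
  choose B hB1 hB2 hB3 using fun n : ℤ => exists_bilin_family hC hK (fun t m => e t n m)
    (fun t m => h t n m) (fun s t m => hL s t n m)
  obtain ⟨A, hA1, hA2, hA3⟩ := exists_clm_family hC hK (fun t n => B n t)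
    (fun t n => hB2 n t) (fun s t n => hB3 n s t)
  exact ⟨A, fun t n m l => by rw [hA1, hB1], hA3⟩

/-- Truncation of the real line to `[1, 2]`. -/
def cl (t : ℝ) : ℝ := max 1 (min 2 t)

theorem cl_mem (t : ℝ) : cl t ∈ Icc (1 : ℝ) 2 :=
  ⟨le_max_left _ _, max_le (by norm_num) (min_le_left _ _)⟩

theorem cl_of_mem {t : ℝ} (h : t ∈ Icc (1 : ℝ) 2) : cl t = t := by
  rw [cl, min_eq_right h.2, max_eq_right h.1]

theorem abs_cl_sub_le (s t : ℝ) : |cl s - cl t| ≤ |s - t| := by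
  unfold cl
  have h1 := abs_max_sub_max_le_abs (min 2 s) (min 2 t) 1
  have h2 := abs_min_sub_min_le_max 2 s 2 t
  rw [max_comm 1, max_comm 1]
  refine h1.trans (h2.trans ?_)
  simp

theorem exp_mul_le {p e t : ℝ} (he : 0 ≤ e) (hp : p ≤ 1 + e) (ht : t ∈ Icc (1 : ℝ) 2) :
    Real.exp (p * t) * Real.exp (-8 * e) ≤ Real.exp 2 := by
  rw [← Real.exp_add, Real.exp_le_exp]
  nlinarith [ht.1, ht.2, mul_nonneg he (by linarith [ht.1] : (0:ℝ) ≤ t),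
    mul_nonneg (by linarith : 0 ≤ 1 + e - p) (by linarith [ht.1] : (0:ℝ) ≤ t)]

theorem abs_mul_exp_mul_le {p e t : ℝ} (he : 0 ≤ e) (hp : p ≤ 1 + e) (ht : t ∈ Icc (1 : ℝ) 2) :
    |p| * Real.exp (p * t) * Real.exp (-8 * e) ≤ Real.exp 2 := by
  rw [mul_assoc, ← Real.exp_add]
  rcases le_total p 0 with h | h
  · have h1 : |p| ≤ Real.exp (-p) := by
      rw [abs_of_nonpos h]; linarith [Real.add_one_le_exp (-p)]
    refine (mul_le_mul_of_nonneg_right h1 (Real.exp_pos _).le).trans ?_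
    rw [← Real.exp_add, Real.exp_le_exp]
    nlinarith [ht.1, ht.2]
  · have h1 : |p| ≤ Real.exp e := by
      rw [abs_of_nonneg h]; linarith [Real.add_one_le_exp e]
    refine (mul_le_mul_of_nonneg_right h1 (Real.exp_pos _).le).trans ?_
    rw [← Real.exp_add, Real.exp_le_exp]
    nlinarith [ht.1, ht.2]

theorem abs_exp_sub_exp_le {p e s t : ℝ} (he : 0 ≤ e) (hp : p ≤ 1 + e)
    (hs : s ∈ Icc (1 : ℝ) 2) (ht : t ∈ Icc (1 : ℝ) 2) :
    |Real.exp (p * s) - Real.exp (p * t)| * Real.exp (-8 * e) ≤ Real.exp 2 * |s - t| := by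
  have hd : ∀ x, HasDerivAt (fun x => Real.exp (p * x) * Real.exp (-8 * e))
      (Real.exp (p * x) * (p * 1) * Real.exp (-8 * e)) x := fun x =>
    (((hasDerivAt_id x).const_mul p).exp).mul_const _
  have := (convex_Icc (1 : ℝ) 2).norm_image_sub_le_of_norm_hasDerivWithin_le
    (C := Real.exp 2) (fun x _ => (hd x).hasDerivWithinAt) (fun x hx => by
      have := abs_mul_exp_mul_le he hp hx
      rw [Real.norm_eq_abs, abs_mul, abs_mul, Real.abs_exp, Real.abs_exp, mul_one]
      linarith [this]) ht hs
  rw [← sub_mul, Real.norm_eq_abs, abs_mul, Real.abs_exp, Real.norm_eq_abs] at this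
  exact this

/-- The excess `|i| + |j| + |l| - |j + l - i|`. -/
def exc (i j l : ℤ) : ℝ := (|i| + |j| + |l| - |j + l - i| : ℤ)

theorem exc_nonneg (i j l : ℤ) : 0 ≤ exc i j l := by
  have : (0 : ℤ) ≤ |i| + |j| + |l| - |j + l - i| := by
    have h1 := abs_sub (j + l) i
    have h2 := abs_add_le j l
    omega
  unfold exc
  exact_mod_cast this

theorem exponent_le (i j l : ℤ) :
    ((2 * (j + l) + 1 - 2 * |j + l - i| : ℤ) : ℝ) ≤ 1 + exc i j l ∧
    ((-(2 * (j + l) + 1) - 2 * |j + l - i| : ℤ) : ℝ) ≤ 1 + exc i j l := by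
  have h : (2 * (j + l) + 1 - 2 * |j + l - i| ≤ 1 + (|i| + |j| + |l| - |j + l - i|)) ∧
    (-(2 * (j + l) + 1) - 2 * |j + l - i| ≤ 1 + (|i| + |j| + |l| - |j + l - i|)) := by
    grind
  unfold exc
  exact ⟨by exact_mod_cast h.1, by exact_mod_cast h.2⟩

/-- The kernel of the trilinear term. -/
def kap (t : ℝ) (i j l : ℤ) : ℝ :=
  (Real.exp ((2 * (j + l) + 1 - 2 * |j + l - i| : ℤ) * t) -
    Real.exp ((-(2 * (j + l) + 1) - 2 * |j + l - i| : ℤ) * t)) * Real.exp (-8 * exc i j l) /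
    (2 * (j + l) + 1 : ℤ)

theorem one_le_abs_odd (m : ℤ) : (1 : ℝ) ≤ |((2 * m + 1 : ℤ) : ℝ)| := by
  have : (1 : ℤ) ≤ |2 * m + 1| := by grind
  exact_mod_cast this

theorem abs_div_odd_le {x C : ℝ} (m : ℤ) (h : |x| ≤ C) : |x / (2 * m + 1 : ℤ)| ≤ C := by
  rw [abs_div]
  exact (div_le_self (abs_nonneg _) (one_le_abs_odd m)).trans h

theorem abs_kap_le {t : ℝ} (ht : t ∈ Icc (1 : ℝ) 2) (i j l : ℤ) :
    |kap t i j l| ≤ 2 * Real.exp 2 := by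
  refine abs_div_odd_le _ ?_
  have h1 := exp_mul_le (exc_nonneg i j l) (exponent_le i j l).1 ht
  have h2 := exp_mul_le (exc_nonneg i j l) (exponent_le i j l).2 ht
  rw [sub_mul, abs_le]
  constructor <;> linarith [mul_pos (Real.exp_pos
    ((2 * (j + l) + 1 - 2 * |j + l - i| : ℤ) * t)) (Real.exp_pos (-8 * exc i j l)),
    mul_pos (Real.exp_pos
    ((-(2 * (j + l) + 1) - 2 * |j + l - i| : ℤ) * t)) (Real.exp_pos (-8 * exc i j l)),
    Real.exp_pos 2]

theorem abs_kap_sub_le {s t : ℝ} (hs : s ∈ Icc (1 : ℝ) 2) (ht : t ∈ Icc (1 : ℝ) 2) (i j l : ℤ) :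
    |kap s i j l - kap t i j l| ≤ 2 * Real.exp 2 * |s - t| := by
  unfold kap
  rw [← sub_div]
  refine abs_div_odd_le _ ?_
  have h1 := abs_exp_sub_exp_le (exc_nonneg i j l) (exponent_le i j l).1 hs ht
  have h2 := abs_exp_sub_exp_le (exc_nonneg i j l) (exponent_le i j l).2 hs ht
  rw [← sub_mul, abs_mul, Real.abs_exp]
  refine (mul_le_mul_of_nonneg_right (?_ : _ ≤
    |Real.exp ((2 * (j + l) + 1 - 2 * |j + l - i| : ℤ) * s) -
      Real.exp ((2 * (j + l) + 1 - 2 * |j + l - i| : ℤ) * t)| +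
    |Real.exp ((-(2 * (j + l) + 1) - 2 * |j + l - i| : ℤ) * s) -
      Real.exp ((-(2 * (j + l) + 1) - 2 * |j + l - i| : ℤ) * t)|) (Real.exp_pos _).le).trans ?_
  · rw [sub_sub_sub_comm]
    exact abs_sub _ _
  · rw [add_mul]; linarith

theorem exists_TT : ∃ A : ℝ → L1 →L[ℝ] L1 →L[ℝ] L1 →L[ℝ] L1,
    (∀ t i j l, A t (dl i) (dl j) (dl l) = kap (cl t) i j l • dl (j + l - i)) ∧
      ∀ s t, ‖A s - A t‖ ≤ 2 * Real.exp 2 * |s - t| := by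
  refine exists_trilin_family (C := 2 * Real.exp 2) (by positivity) (by positivity) _
    (fun t n m l => ?_) (fun s t n m l => ?_)
  · rw [norm_smul, norm_dl, mul_one]
    exact abs_kap_le (cl_mem t) _ _ _
  · rw [← sub_smul, norm_smul, norm_dl, mul_one]
    exact (abs_kap_sub_le (cl_mem s) (cl_mem t) _ _ _).trans
      (mul_le_mul_of_nonneg_left (abs_cl_sub_le s t) (by positivity))

/-- The trilinear map of the free boundary equation. -/
def TT : ℝ → L1 →L[ℝ] L1 →L[ℝ] L1 →L[ℝ] L1 := exists_TT.choose

theorem TT_dl {t : ℝ} (ht : t ∈ Icc (1 : ℝ) 2) (i j l : ℤ) :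
    TT t (dl i) (dl j) (dl l) = kap t i j l • dl (j + l - i) := by
  have := exists_TT.choose_spec.1 t i j l
  rwa [cl_of_mem ht] at this

theorem continuous_TT : Continuous TT := continuous_of_norm_sub_le exists_TT.choose_spec.2

theorem exists_DD (e : ℤ) (he : |e| ≤ 1) : ∃ A : ℝ → L1 →L[ℝ] L1,
    (∀ t n, A t (dl n) = Real.exp ((2 * e * n - 2 * |n| : ℤ) * cl t) • dl n) ∧
      ∀ s t, ‖A s - A t‖ ≤ Real.exp 2 * |s - t| := by
  have hp : ∀ n : ℤ, ((2 * e * n - 2 * |n| : ℤ) : ℝ) ≤ 1 + 0 := fun n => by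
    have h1 : e * n ≤ |n| := by
      refine (le_abs_self _).trans ?_
      rw [abs_mul]
      exact mul_le_of_le_one_left (abs_nonneg _) he
    have : (2 * e * n - 2 * |n| : ℤ) ≤ 1 := by linarith
    rw [add_zero]
    exact_mod_cast this
  suffices h : _ from (exists_clm_family (C := Real.exp 2) (K := Real.exp 2) (by positivity)
    (by positivity) (fun t n => Real.exp ((2 * e * n - 2 * |n| : ℤ) * cl t) • dl n)
    h (fun s t n => ?_)).imp fun A hA => ⟨hA.1, hA.2.2⟩
  · rw [← sub_smul, norm_smul, norm_dl, mul_one, Real.norm_eq_abs]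
    have := abs_exp_sub_exp_le le_rfl (hp n) (cl_mem s) (cl_mem t)
    simp only [mul_zero, Real.exp_zero, mul_one] at this
    exact this.trans (mul_le_mul_of_nonneg_left (abs_cl_sub_le s t) (by positivity))
  · intro t n
    rw [norm_smul, norm_dl, mul_one, Real.norm_eq_abs, Real.abs_exp]
    simpa using exp_mul_le le_rfl (hp n) (cl_mem t)

/-- The diagonal operators `D⁺`. -/
def DP : ℝ → L1 →L[ℝ] L1 := (exists_DD 1 (by norm_num)).choose

/-- The diagonal operators `D⁻`. -/
def DM : ℝ → L1 →L[ℝ] L1 := (exists_DD (-1) (by norm_num)).choose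

theorem DP_dl {t : ℝ} (ht : t ∈ Icc (1 : ℝ) 2) (n : ℤ) :
    DP t (dl n) = Real.exp ((2 * n - 2 * |n| : ℤ) * t) • dl n := by
  have : DP t (dl n) = _ := (exists_DD 1 (by norm_num)).choose_spec.1 t n
  rw [cl_of_mem ht] at this
  simpa only [mul_one] using this

theorem DM_dl {t : ℝ} (ht : t ∈ Icc (1 : ℝ) 2) (n : ℤ) :
    DM t (dl n) = Real.exp ((-2 * n - 2 * |n| : ℤ) * t) • dl n := by
  have : DM t (dl n) = _ := (exists_DD (-1) (by norm_num)).choose_spec.1 t n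
  rw [cl_of_mem ht] at this
  simpa only [mul_neg, mul_one] using this

theorem continuous_DP : Continuous DP :=
  continuous_of_norm_sub_le (exists_DD 1 (by norm_num)).choose_spec.2

theorem continuous_DM : Continuous DM :=
  continuous_of_norm_sub_le (exists_DD (-1) (by norm_num)).choose_spec.2

theorem exists_co (n : ℤ) : ∃ A : L1 →L[ℝ] ℝ, ∀ k, A (dl k) = if k = n then 1 else 0 :=
  exists_clm _ 1 fun k => by split_ifs <;> simp

/-- The coordinate functionals of `L1`. -/
def co (n : ℤ) : L1 →L[ℝ] ℝ := (exists_co n).choose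

theorem co_dl (n k : ℤ) : co n (dl k) = if k = n then 1 else 0 := (exists_co n).choose_spec k

/-- The projection annihilating the coordinates `0` and `1`. -/
def Pr : L1 →L[ℝ] L1 :=
  ContinuousLinearMap.id ℝ L1 - (co 0).smulRight (dl 0) - (co 1).smulRight (dl 1)

theorem Pr_apply (v : L1) : Pr v = v - co 0 v • dl 0 - co 1 v • dl 1 := rfl

theorem Pr_dl_zero : Pr (dl 0) = 0 := by simp [Pr_apply, co_dl]

theorem Pr_dl_one : Pr (dl 1) = 0 := by simp [Pr_apply, co_dl]

theorem Pr_dl {n : ℤ} (h0 : n ≠ 0) (h1 : n ≠ 1) : Pr (dl n) = dl n := by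
  simp [Pr_apply, co_dl, h0, h1]

/-- The space of parameters of the blown-up free boundary equation. -/
abbrev Par : Type :=
  ℝ × (L1 →L[ℝ] L1 →L[ℝ] L1 →L[ℝ] L1) × (L1 →L[ℝ] L1) × (L1 →L[ℝ] L1) × ℝ

/-- The perturbation direction encoded by the unknown. -/
def eta (v : L1) : L1 := dl 1 + Pr v

/-- The blown-up free boundary equation. -/
def GG (x : Par × L1) : L1 :=
  (x.1.2.1 (eta x.2) (dl 0) (dl 0) + x.1.2.1 (dl 0) (eta x.2) (dl 0) +
    x.1.2.1 (dl 0) (dl 0) (eta x.2)) +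
  x.1.1 • (x.1.2.1 (eta x.2) (eta x.2) (dl 0) + x.1.2.1 (eta x.2) (dl 0) (eta x.2) +
    x.1.2.1 (dl 0) (eta x.2) (eta x.2)) +
  x.1.1 ^ 2 • x.1.2.1 (eta x.2) (eta x.2) (eta x.2) -
  (x.1.2.2.2.2 + co 1 x.2) • x.1.2.2.1 (eta x.2) -
  (x.1.2.2.2.2 - co 1 x.2 + x.1.1 * co 0 x.2) • x.1.2.2.2.1 (eta x.2) - co 0 x.2 • dl 0

theorem contDiff_eta : ContDiff ℝ 1 eta := contDiff_const.add Pr.contDiff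

theorem contDiff_GG : ContDiff ℝ 1 GG := by
  have he : ContDiff ℝ 1 fun x : Par × L1 => eta x.2 := contDiff_eta.comp contDiff_snd
  have hT : ContDiff ℝ 1 fun x : Par × L1 => x.1.2.1 := by fun_prop
  have h0 : ContDiff ℝ 1 fun _ : Par × L1 => dl 0 := contDiff_const
  have tri : ∀ {f g h : Par × L1 → L1}, ContDiff ℝ 1 f → ContDiff ℝ 1 g → ContDiff ℝ 1 h →
      ContDiff ℝ 1 fun x : Par × L1 => x.1.2.1 (f x) (g x) (h x) := fun hf hg hh =>
    ((hT.clm_apply hf).clm_apply hg).clm_apply hh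
  have hc : ∀ n, ContDiff ℝ 1 fun x : Par × L1 => co n x.2 := fun n =>
    (co n).contDiff.comp contDiff_snd
  have hP : ContDiff ℝ 1 fun x : Par × L1 => x.1.2.2.1 (eta x.2) :=
    ContDiff.clm_apply (by fun_prop) he
  have hM : ContDiff ℝ 1 fun x : Par × L1 => x.1.2.2.2.1 (eta x.2) :=
    ContDiff.clm_apply (by fun_prop) he
  have hE : ContDiff ℝ 1 fun x : Par × L1 => x.1.1 := by fun_prop
  have hS : ContDiff ℝ 1 fun x : Par × L1 => x.1.2.2.2.2 := by fun_prop
  exact (((((((tri he h0 h0).add (tri h0 he h0)).add (tri h0 h0 he)).add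
    (hE.smul (((tri he he h0).add (tri he h0 he)).add (tri h0 he he)))).add
    ((hE.pow 2).smul (tri he he he))).sub ((hS.add (hc 1)).smul hP)).sub
    (((hS.sub (hc 1)).add (hE.mul (hc 0))).smul hM)).sub ((hc 0).smul h0)

/-- The linearisation of the blown-up equation at `ε = 0`. -/
def linG (T : L1 →L[ℝ] L1 →L[ℝ] L1 →L[ℝ] L1) (P M : L1 →L[ℝ] L1) (S : ℝ) (v₀ v : L1) : L1 :=
  T (Pr v) (dl 0) (dl 0) + T (dl 0) (Pr v) (dl 0) + T (dl 0) (dl 0) (Pr v) -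
    (S + co 1 v₀) • P (Pr v) - co 1 v • P (eta v₀) - (S - co 1 v₀) • M (Pr v) +
    co 1 v • M (eta v₀) - co 0 v • dl 0

theorem hasDerivAt_quadratic {E : Type} [NormedAddCommGroup E] [NormedSpace ℝ E] (a b c : E) :
    HasDerivAt (fun r : ℝ => a + r • b + r ^ 2 • c) b 0 := by
  have := (((hasDerivAt_id (0 : ℝ)).smul_const b).const_add a).add
    ((hasDerivAt_pow 2 (0 : ℝ)).smul_const c)
  exact this.congr_deriv (by simp)

theorem fderiv_GG_inr (T : L1 →L[ℝ] L1 →L[ℝ] L1 →L[ℝ] L1) (P M : L1 →L[ℝ] L1) (S : ℝ)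
    (v₀ v : L1) : (fderiv ℝ GG ((0, T, P, M, S), v₀) ∘L .inr ℝ Par L1) v = linG T P M S v₀ v := by
  have h1 : HasFDerivAt GG (fderiv ℝ GG ((0, T, P, M, S), v₀)) ((0, T, P, M, S), v₀) :=
    (contDiff_GG.differentiable one_ne_zero _).hasFDerivAt
  refine (h1.hasLineDerivAt ((0 : Par), v)).unique ?_
  have key : ∀ r : ℝ, GG (((0, T, P, M, S), v₀) + r • ((0 : Par), v)) =
      GG ((0, T, P, M, S), v₀) + r • linG T P M S v₀ v +
        r ^ 2 • (co 1 v • M (Pr v) - co 1 v • P (Pr v)) := fun r => by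
    have e1 : (((0, T, P, M, S), v₀) + r • ((0 : Par), v) : Par × L1) =
        ((0, T, P, M, S), v₀ + r • v) := by
      rw [Prod.smul_mk, smul_zero, Prod.mk_add_mk, add_zero]
    have e2 : eta (v₀ + r • v) = eta v₀ + r • Pr v := by
      rw [eta, eta, map_add, map_smul, add_assoc]
    rw [e1]
    simp only [GG, linG, e2, map_add, map_smul, _root_.add_apply,
      _root_.smul_apply, smul_eq_mul]
    module
  exact (hasDerivAt_quadratic _ _ _).congr_of_eventuallyEq (Eventually.of_forall key)

/-- The diagonal coefficients of the linearisation. -/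
def lam (t b : ℝ) (n : ℤ) : ℝ :=
  kap t 0 n 0 + kap t 0 0 n - (Real.sinh t + b) * Real.exp ((2 * n - 2 * |n| : ℤ) * t) -
    (Real.sinh t - b) * Real.exp ((-2 * n - 2 * |n| : ℤ) * t)

/-- The off-diagonal coefficients of the linearisation. -/
def mu (t : ℝ) (n : ℤ) : ℝ := kap t n 0 0

/-- The parameter point of the blown-up equation. -/
def par (x : ℝ × ℝ) : Par := (x.1, TT x.2, DP x.2, DM x.2, Real.sinh x.2)

theorem continuous_par : Continuous par := by
  have h1 := continuous_TT
  have h2 := continuous_DP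
  have h3 := continuous_DM
  unfold par
  fun_prop

theorem linG_dl {t : ℝ} (ht : t ∈ Icc (1 : ℝ) 2) (b y : ℝ) (n : ℤ) :
    linG (TT t) (DP t) (DM t) (Real.sinh t) (b • dl 1 + y • dl (-1)) (dl n) =
      (if n = 0 then -1 else if n = 1 then -(1 - Real.exp (-4 * t)) else lam t b n) • dl n +
      (if n = 0 then 0 else if n = 1 then (1 - Real.exp (-4 * t)) * y else mu t n) • dl (-n) := by
  have hb : co 1 (b • dl 1 + y • dl (-1)) = b := by simp [co_dl]
  have he : eta (b • dl 1 + y • dl (-1)) = dl 1 + y • dl (-1) := by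
    rw [eta, map_add, map_smul, map_smul, Pr_dl_one, Pr_dl (by norm_num) (by norm_num), smul_zero,
      zero_add]
  unfold linG
  rw [hb, he]
  by_cases h0 : n = 0
  · subst h0
    simp [Pr_dl_zero, co_dl]
  by_cases h1 : n = 1
  · subst h1
    simp only [Pr_dl_one, co_dl, map_zero, _root_.zero_apply, smul_zero, map_add,
      map_smul, DP_dl ht, DM_dl ht]
    norm_num
    module
  · simp only [Pr_dl h0 h1, co_dl, h0, h1, if_false, TT_dl ht, DP_dl ht, DM_dl ht]
    simp only [lam, mu, zero_smul, add_zero, zero_add, sub_zero, zero_sub]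
    module

theorem GG_par_zero {t : ℝ} (ht : t ∈ Icc (1 : ℝ) 2) (b y : ℝ) :
    GG (par (0, t), b • dl 1 + y • dl (-1)) =
      (lam t b 1 + y * mu t (-1)) • dl 1 + (mu t 1 + y * lam t b (-1)) • dl (-1) := by
  have hb : co 1 (b • dl 1 + y • dl (-1)) = b := by simp [co_dl]
  have hb0 : co 0 (b • dl 1 + y • dl (-1)) = 0 := by simp [co_dl]
  have he : eta (b • dl 1 + y • dl (-1)) = dl 1 + y • dl (-1) := by
    rw [eta, map_add, map_smul, map_smul, Pr_dl_one, Pr_dl (by norm_num) (by norm_num), smul_zero,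
      zero_add]
  simp only [GG, par, hb, hb0, he, map_add, map_smul, _root_.add_apply,
    _root_.smul_apply, TT_dl ht, DP_dl ht, DM_dl ht]
  simp only [lam, mu, zero_smul, add_zero, zero_add, sub_zero, zero_sub, neg_neg, zero_mul,
    zero_pow two_ne_zero]
  module

theorem co_GG_par_zero {t : ℝ} (ht : t ∈ Icc (1 : ℝ) 2) (v : L1) :
    co 1 (GG (par (0, t), v)) = lam t (co 1 v) 1 + co (-1) v * mu t (-1) ∧
    co (-1) (GG (par (0, t), v)) = mu t 1 + co (-1) v * lam t (co 1 v) (-1) := by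
  have h1 : ∀ n w, co n (TT t w (dl 0) (dl 0)) = kap t (-n) 0 0 * co (-n) w := fun n w => by
    have : co n ∘L ((TT t).flip (dl 0)).flip (dl 0) = kap t (-n) 0 0 • co (-n) :=
      clm_ext fun k => by
        have : -k = n ↔ k = -n := by omega
        by_cases h : k = -n <;> simp [TT_dl ht, co_dl, this, h]
    simpa using congrArg (fun A => A w) this
  have h2 : ∀ n w, co n (TT t (dl 0) w (dl 0)) = kap t 0 n 0 * co n w := fun n w => by
    have : co n ∘L (TT t (dl 0)).flip (dl 0) = kap t 0 n 0 • co n :=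
      clm_ext fun k => by
        by_cases h : k = n <;> simp [TT_dl ht, co_dl, h]
    simpa using congrArg (fun A => A w) this
  have h3 : ∀ n w, co n (TT t (dl 0) (dl 0) w) = kap t 0 0 n * co n w := fun n w => by
    have : co n ∘L (TT t (dl 0) (dl 0)) = kap t 0 0 n • co n :=
      clm_ext fun k => by
        by_cases h : k = n <;> simp [TT_dl ht, co_dl, h]
    simpa using congrArg (fun A => A w) this
  have h4 : ∀ n w, co n (DP t w) = Real.exp ((2 * n - 2 * |n| : ℤ) * t) * co n w :=
    fun n w => by
      have : co n ∘L DP t = Real.exp ((2 * n - 2 * |n| : ℤ) * t) • co n :=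
        clm_ext fun k => by
          by_cases h : k = n <;> simp [DP_dl ht, co_dl, h]
      simpa using congrArg (fun A => A w) this
  have h5 : ∀ n w, co n (DM t w) = Real.exp ((-2 * n - 2 * |n| : ℤ) * t) * co n w :=
    fun n w => by
      have : co n ∘L DM t = Real.exp ((-2 * n - 2 * |n| : ℤ) * t) • co n :=
        clm_ext fun k => by
          by_cases h : k = n <;> simp [DM_dl ht, co_dl, h]
      simpa using congrArg (fun A => A w) this
  have e1 : co 1 (eta v) = 1 := by simp [eta, Pr_apply, co_dl]
  have e2 : co (-1) (eta v) = co (-1) v := by simp [eta, Pr_apply, co_dl]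
  simp only [GG, par, map_add, map_sub, map_smul, h1, h2, h3, h4, h5, neg_neg, e1, e2, co_dl,
    smul_eq_mul, lam, mu]
  constructor
  · norm_num
    ring
  · norm_num
    ring

theorem exists_lower_bound {g : ℕ → ℝ} {L : ℝ} (h : Tendsto g atTop (𝓝 L)) (hL : L ≠ 0)
    (h0 : ∀ n, 2 ≤ n → g n ≠ 0) : ∃ d > 0, ∀ n, 2 ≤ n → d ≤ |g n| := by
  have h1 : Tendsto (fun n => |g (n + 2)|⁻¹) atTop (𝓝 |L|⁻¹) :=
    ((tendsto_add_atTop_iff_nat 2).2 h).abs.inv₀ (abs_ne_zero.2 hL)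
  obtain ⟨B, hB⟩ := h1.bddAbove_range
  have hB1 : ∀ n, 2 ≤ n → |g n|⁻¹ ≤ B := fun n hn => by
    obtain ⟨k, rfl⟩ := Nat.exists_eq_add_of_le' hn
    exact hB ⟨k, rfl⟩
  have hB0 : 0 < B := lt_of_lt_of_le (inv_pos.2 (abs_pos.2 (h0 2 le_rfl))) (hB1 2 le_rfl)
  exact ⟨B⁻¹, inv_pos.2 hB0, fun n hn =>
    (inv_le_comm₀ hB0 (abs_pos.2 (h0 n hn))).2 (hB1 n hn)⟩

theorem kap_zero_mid (t : ℝ) (n : ℤ) : kap t 0 n 0 =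
    (Real.exp ((2 * n + 1 - 2 * |n| : ℤ) * t) - Real.exp ((-(2 * n + 1) - 2 * |n| : ℤ) * t)) /
      (2 * n + 1 : ℤ) := by
  simp [kap, exc]

theorem kap_zero_right (t : ℝ) (n : ℤ) : kap t 0 0 n = kap t 0 n 0 := by
  simp [kap, exc]

theorem mu_eq (t : ℝ) (n : ℤ) : mu t n = Real.exp (-(2 * |n| : ℤ) * t) * (2 * Real.sinh t) := by
  have h1 : Real.exp ((1 - 2 * |n| : ℤ) * t) = Real.exp (-(2 * |n| : ℤ) * t) * Real.exp t := by
    rw [← Real.exp_add]; push_cast; ring_nf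
  have h2 : Real.exp ((-1 - 2 * |n| : ℤ) * t) = Real.exp (-(2 * |n| : ℤ) * t) * Real.exp (-t) := by
    rw [← Real.exp_add]; push_cast; ring_nf
  have h3 : kap t n 0 0 =
      Real.exp ((1 - 2 * |n| : ℤ) * t) - Real.exp ((-1 - 2 * |n| : ℤ) * t) := by
    simp [kap, exc]
  rw [mu, h3, h1, h2, Real.sinh_eq]
  ring

theorem mu_neg (t : ℝ) (n : ℤ) : mu t (-n) = mu t n := by
  rw [mu_eq, mu_eq, abs_neg]

theorem abs_kap_zero_mid_le {t : ℝ} (ht : 0 ≤ t) (n : ℤ) :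
    |kap t 0 n 0| ≤ Real.exp t / |((2 * n + 1 : ℤ) : ℝ)| := by
  rw [kap_zero_mid, abs_div]
  refine div_le_div_of_nonneg_right ?_ (abs_nonneg _)
  have h1 : ((2 * n + 1 - 2 * |n| : ℤ) : ℝ) ≤ 1 := by
    exact_mod_cast (by grind : (2 * n + 1 - 2 * |n| : ℤ) ≤ 1)
  have h2 : ((-(2 * n + 1) - 2 * |n| : ℤ) : ℝ) ≤ 1 := by
    exact_mod_cast (by grind : (-(2 * n + 1) - 2 * |n| : ℤ) ≤ 1)
  have h3 : Real.exp ((2 * n + 1 - 2 * |n| : ℤ) * t) ≤ Real.exp t :=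
    Real.exp_le_exp.2 (by nlinarith)
  have h4 : Real.exp ((-(2 * n + 1) - 2 * |n| : ℤ) * t) ≤ Real.exp t :=
    Real.exp_le_exp.2 (by nlinarith)
  rw [abs_le]
  constructor <;> linarith [Real.exp_pos ((2 * n + 1 - 2 * |n| : ℤ) * t),
    Real.exp_pos ((-(2 * n + 1) - 2 * |n| : ℤ) * t)]

theorem tendsto_kap_zero_mid {t : ℝ} (ht : 0 ≤ t) {f : ℕ → ℤ} (hf : ∀ n, |f n| = n) :
    Tendsto (fun n => kap t 0 (f n) 0) atTop (𝓝 0) := by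
  have h1 : Tendsto (fun n : ℕ => Real.exp t / n) atTop (𝓝 0) :=
    tendsto_const_div_atTop_nhds_zero_nat _
  refine squeeze_zero_norm' ?_ h1
  filter_upwards [eventually_ge_atTop 1] with n hn
  refine (abs_kap_zero_mid_le ht _).trans ?_
  have h2 : (n : ℤ) ≤ |2 * f n + 1| := by
    have := hf n
    grind
  have h3 : (n : ℝ) ≤ |((2 * f n + 1 : ℤ) : ℝ)| := by exact_mod_cast h2
  exact div_le_div_of_nonneg_left (Real.exp_pos _).le (by exact_mod_cast hn) h3

theorem tendsto_exp_neg_mul {t : ℝ} (ht : 0 < t) {k : ℝ} (hk : 0 < k) :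
    Tendsto (fun n : ℕ => Real.exp (-(k * n) * t)) atTop (𝓝 0) := by
  refine Real.tendsto_exp_atBot.comp ?_
  have : Tendsto (fun n : ℕ => -((k * t) * (n : ℝ))) atTop atBot :=
    tendsto_neg_atTop_atBot.comp (tendsto_natCast_atTop_atTop.const_mul_atTop (by positivity))
  refine this.congr fun n => by ring

theorem lam_natCast (t b : ℝ) (n : ℕ) : lam t b n = 2 * kap t 0 n 0 - (Real.sinh t + b) -
    (Real.sinh t - b) * Real.exp (-(4 * n) * t) := by
  rw [lam, kap_zero_right]
  have h1 : (2 * (n : ℤ) - 2 * |(n : ℤ)|) = 0 := by simp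
  have h2 : (-2 * (n : ℤ) - 2 * |(n : ℤ)|) = -(4 * n) := by simp; ring
  rw [h1, h2]
  push_cast
  simp
  ring

theorem lam_neg_natCast (t b : ℝ) (n : ℕ) : lam t b (-n) = 2 * kap t 0 (-n) 0 -
    (Real.sinh t + b) * Real.exp (-(4 * n) * t) - (Real.sinh t - b) := by
  rw [lam, kap_zero_right]
  have h1 : (2 * -(n : ℤ) - 2 * |-(n : ℤ)|) = -(4 * n) := by simp; ring
  have h2 : (-2 * -(n : ℤ) - 2 * |-(n : ℤ)|) = 0 := by simp
  rw [h1, h2]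
  push_cast
  simp
  ring

theorem tendsto_det {t : ℝ} (ht : 0 < t) (b : ℝ) :
    Tendsto (fun n : ℕ => lam t b n * lam t b (-n) - mu t n * mu t (-n)) atTop
      (𝓝 ((Real.sinh t + b) * (Real.sinh t - b))) := by
  have h1 := (tendsto_kap_zero_mid ht.le (f := fun n : ℕ => (n : ℤ)) (by simp)).const_mul 2
  have h2 := (tendsto_kap_zero_mid ht.le (f := fun n : ℕ => -(n : ℤ)) (by simp)).const_mul 2
  have h3 := tendsto_exp_neg_mul ht (k := 4) (by norm_num)
  have h4 : Tendsto (fun n : ℕ => mu t n) atTop (𝓝 0) := by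
    have := (tendsto_exp_neg_mul ht (k := 2) (by norm_num)).mul_const (2 * Real.sinh t)
    rw [zero_mul] at this
    refine this.congr fun n => by rw [mu_eq]; push_cast; simp
  simp only [lam_natCast, lam_neg_natCast, mu_neg]
  have := (((h1.sub_const (Real.sinh t + b)).sub (h3.const_mul (Real.sinh t - b))).mul
    ((h2.sub (h3.const_mul (Real.sinh t + b))).sub_const (Real.sinh t - b))).sub (h4.mul h4)
  convert this using 2
  ring

theorem abs_lam_le {t : ℝ} (ht : t ∈ Icc (1 : ℝ) 2) (b : ℝ) (n : ℤ) :
    |lam t b n| ≤ 4 * Real.exp 2 + |Real.sinh t + b| + |Real.sinh t - b| := by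
  have h1 := abs_kap_le ht 0 n 0
  have h2 := abs_kap_le ht 0 0 n
  have key : ∀ (m : ℤ) (z : ℝ), m ≤ 0 → |z * Real.exp (m * t)| ≤ |z| := fun m z hm => by
    rw [abs_mul, Real.abs_exp]
    refine mul_le_of_le_one_right (abs_nonneg _) (Real.exp_le_one_iff.2 ?_)
    exact mul_nonpos_of_nonpos_of_nonneg (by exact_mod_cast hm) (by linarith [ht.1])
  have h3 := key (2 * n - 2 * |n|) (Real.sinh t + b) (by grind)
  have h4 := key (-2 * n - 2 * |n|) (Real.sinh t - b) (by grind)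
  unfold lam
  have a1 := abs_sub (kap t 0 n 0 + kap t 0 0 n -
    (Real.sinh t + b) * Real.exp ((2 * n - 2 * |n| : ℤ) * t))
    ((Real.sinh t - b) * Real.exp ((-2 * n - 2 * |n| : ℤ) * t))
  have a2 := abs_sub (kap t 0 n 0 + kap t 0 0 n)
    ((Real.sinh t + b) * Real.exp ((2 * n - 2 * |n| : ℤ) * t))
  have a3 := abs_add_le (kap t 0 n 0) (kap t 0 0 n)
  linarith

theorem isInvertible_fderiv {t : ℝ} (ht : t ∈ Icc (1 : ℝ) 2) {b y : ℝ}
    (h1 : lam t b 1 + y * mu t 1 = 0)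
    (h3 : lam t b (-1) ≠ lam t b 1)
    (h4 : ∀ n : ℕ, 2 ≤ n → lam t b n * lam t b (-n) - mu t n * mu t (-n) ≠ 0)
    (h5 : (Real.sinh t + b) * (Real.sinh t - b) ≠ 0) :
    (fderiv ℝ GG (par (0, t), b • dl 1 + y • dl (-1)) ∘L .inr ℝ Par L1).IsInvertible := by
  have ht0 : 0 < t := by linarith [ht.1]
  obtain ⟨d, hd, hd2⟩ := exists_lower_bound (tendsto_det ht0 b) h5 h4
  set e := 1 - Real.exp (-4 * t) with he
  have he0 : 0 < e := by
    rw [he, sub_pos, Real.exp_lt_one_iff]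
    linarith
  set p : ℤ → ℝ := fun n => if n = 0 then -1 else if n = 1 then -e else lam t b n with hp
  set q : ℤ → ℝ := fun n => if n = 0 then 0 else if n = 1 then e * y else mu t n with hq
  set K := 4 * Real.exp 2 + |Real.sinh t + b| + |Real.sinh t - b| with hK
  have hK0 : 0 ≤ K := by positivity
  have hD1 : p 1 * p (-1) - q 1 * q (-1) = e * (lam t b 1 - lam t b (-1)) := by
    simp only [hp, hq]
    norm_num
    rw [mu_neg]
    linear_combination (-e) * h1
  set d' := min d (min 1 |e * (lam t b 1 - lam t b (-1))|) with hd'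
  have hD1' : d' ≤ |p 1 * p (-1) - q 1 * q (-1)| := by
    rw [hD1]; exact (min_le_right _ _).trans (min_le_right _ _)
  have hpos : ∀ n : ℕ, d' ≤ |p n * p (-n) - q n * q (-n)| := fun n => by
    rcases n with - | - | n
    · exact ((min_le_right _ _).trans (min_le_left _ _)).trans (by simp [hp, hq])
    · simpa using hD1'
    · refine (min_le_left _ _).trans ?_
      have := hd2 (n + 2) (by omega)
      have e1 : ((n + 1 + 1 : ℕ) : ℤ) ≠ 0 := by omega
      have e2 : ((n + 1 + 1 : ℕ) : ℤ) ≠ 1 := by omega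
      have e3 : -((n + 1 + 1 : ℕ) : ℤ) ≠ 0 := by omega
      have e4 : -((n + 1 + 1 : ℕ) : ℤ) ≠ 1 := by omega
      simp only [hp, hq, if_neg e1, if_neg e2, if_neg e3, if_neg e4]
      exact this
  refine isInvertible_of_blocks _ p q (K + 1 + |e| + |e * y| + 2 * Real.exp 2) d' ?_ ?_ ?_ ?_ ?_
  · exact lt_min hd (lt_min one_pos (abs_pos.2 (mul_ne_zero he0.ne' (sub_ne_zero.2 h3.symm))))
  · intro n
    have := abs_lam_le ht b n
    have h6 := abs_nonneg e
    have h7 := abs_nonneg (e * y)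
    have h8 := Real.exp_pos 2
    simp only [hp]
    split_ifs
    · rw [abs_neg, abs_one]; linarith
    · rw [abs_neg]; linarith
    · linarith
  · intro n
    have := abs_kap_le ht n 0 0
    have h6 := abs_nonneg e
    have h7 := abs_nonneg (e * y)
    have h8 := Real.exp_pos 2
    simp only [hq, mu]
    split_ifs
    · rw [abs_zero]; linarith
    · linarith
    · linarith
  · intro n
    rw [par, fderiv_GG_inr, linG_dl ht]
  · intro n
    rcases Int.eq_nat_or_neg n with ⟨k, rfl | rfl⟩
    · exact hpos k
    · rw [neg_neg, mul_comm (p _), mul_comm (q _)]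
      exact hpos k

/-- The branch of solutions of the blown-up equation. -/
theorem exists_branch {t : ℝ} (ht : t ∈ Icc (1 : ℝ) 2) {b y : ℝ}
    (h2 : mu t 1 + y * lam t b (-1) = 0) (h1 : lam t b 1 + y * mu t 1 = 0)
    (h3 : lam t b (-1) ≠ lam t b 1)
    (h4 : ∀ n : ℕ, 2 ≤ n → lam t b n * lam t b (-n) - mu t n * mu t (-n) ≠ 0)
    (h5 : (Real.sinh t + b) * (Real.sinh t - b) ≠ 0) :
    ∃ θ : ℝ × ℝ → L1, θ (0, t) = b • dl 1 + y • dl (-1) ∧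
      ∀ᶠ x in 𝓝 (0, t), ContinuousAt θ x ∧ GG (par x, θ x) = 0 := by
  have hI := isInvertible_fderiv ht h1 h3 h4 h5
  have hc : ContDiffAt ℝ 1 GG (par (0, t), b • dl 1 + y • dl (-1)) := contDiff_GG.contDiffAt
  have hz : GG (par (0, t), b • dl 1 + y • dl (-1)) = 0 := by
    rw [GG_par_zero ht, mu_neg, h1, h2]; simp
  refine ⟨fun x => hc.implicitFunction one_ne_zero hI (par x), ?_, ?_⟩
  · exact hc.implicitFunction_apply_self one_ne_zero hI
  · have hev := hc.eventually_apply_implicitFunction one_ne_zero hI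
    have hcd := (hc.contDiffAt_implicitFunction one_ne_zero hI).eventually (by simp)
    have hpc := continuous_par.continuousAt (x := ((0, t) : ℝ × ℝ))
    filter_upwards [hpc.eventually hev, hpc.eventually hcd] with x hx1 hx2
    exact ⟨ContinuousAt.comp (f := par) hx2.continuousAt continuous_par.continuousAt,
      hx1.trans hz⟩

theorem exp_mul_kap_zero_mid (t : ℝ) (n : ℕ) :
    Real.exp (2 * n * t) * kap t 0 n 0 = 2 * Real.sinh ((2 * n + 1) * t) / (2 * n + 1) ∧
    Real.exp (2 * n * t) * kap t 0 (-n) 0 = 2 * Real.sinh ((2 * n - 1) * t) / (2 * n - 1) := by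
  rw [kap_zero_mid, kap_zero_mid, Real.sinh_eq, Real.sinh_eq]
  have h1 : ((2 * (n : ℤ) + 1 - 2 * |(n : ℤ)| : ℤ) : ℝ) = 1 := by simp
  have h2 : ((-(2 * (n : ℤ) + 1) - 2 * |(n : ℤ)| : ℤ) : ℝ) = -(4 * n + 1) := by simp; ring
  have h3 : ((2 * (-(n : ℤ)) + 1 - 2 * |-(n : ℤ)| : ℤ) : ℝ) = 1 - 4 * n := by simp; ring
  have h4 : ((-(2 * (-(n : ℤ)) + 1) - 2 * |-(n : ℤ)| : ℤ) : ℝ) = -1 := by simp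
  rw [h1, h2, h3, h4]
  constructor
  · push_cast
    rw [mul_div_assoc', mul_sub, ← Real.exp_add, ← Real.exp_add]
    ring_nf
  · have h5 : (2 * (n : ℝ) - 1) ≠ 0 := by
      intro h
      have : (2 * (n : ℤ) - 1 : ℤ) = 0 := by exact_mod_cast h
      omega
    have h6 : (2 * -(n : ℝ) + 1) ≠ 0 := by
      intro h; apply h5; linarith
    push_cast
    rw [mul_div_assoc', mul_sub, ← Real.exp_add, ← Real.exp_add, div_eq_div_iff h6 h5]
    ring_nf

theorem exp_mul_lam (t b : ℝ) (n : ℕ) :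
    Real.exp (2 * n * t) * lam t b n = 4 * (Real.sinh (2 * n * t) * Real.cosh t +
      Real.cosh (2 * n * t) * Real.sinh t) / (2 * n + 1) -
      2 * (Real.sinh t * Real.cosh (2 * n * t) + b * Real.sinh (2 * n * t)) ∧
    Real.exp (2 * n * t) * lam t b (-n) = 4 * (Real.sinh (2 * n * t) * Real.cosh t -
      Real.cosh (2 * n * t) * Real.sinh t) / (2 * n - 1) -
      2 * (Real.sinh t * Real.cosh (2 * n * t) - b * Real.sinh (2 * n * t)) := by
  have h0 : Real.exp (2 * n * t) = Real.cosh (2 * n * t) + Real.sinh (2 * n * t) :=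
    (Real.cosh_add_sinh _).symm
  have h1 : Real.exp (2 * n * t) * Real.exp (-(4 * n) * t) =
      Real.cosh (2 * n * t) - Real.sinh (2 * n * t) := by
    rw [← Real.exp_add, Real.cosh_sub_sinh]; ring_nf
  obtain ⟨h2, h3⟩ := exp_mul_kap_zero_mid t n
  rw [add_mul, one_mul, Real.sinh_add] at h2
  rw [sub_mul, one_mul, Real.sinh_sub] at h3
  rw [lam_natCast, lam_neg_natCast]
  constructor
  · linear_combination 2 * h2 - (Real.sinh t - b) * h1 - (Real.sinh t + b) * h0
  · linear_combination 2 * h3 - (Real.sinh t + b) * h1 - (Real.sinh t - b) * h0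

theorem exp_mul_mu (t : ℝ) (n : ℕ) : Real.exp (2 * n * t) * mu t n = 2 * Real.sinh t := by
  rw [mu_eq, ← mul_assoc, ← Real.exp_add]
  simp

/-- The dispersion determinant. -/
theorem det_formula (t b ρ : ℝ) (hb : b = Real.cosh t - ρ) (n : ℕ) :
    ((2 * n) ^ 2 - 1) * (Real.exp (2 * n * t) ^ 2 *
      (lam t b n * lam t b (-n) - mu t n * mu t (-n))) =
    4 * Real.sinh (2 * n * t) * (Real.sinh (2 * n * t) *
      ((2 * Real.cosh t * ρ - 1 - ρ ^ 2) * (2 * n) ^ 2 + (1 + 2 * Real.cosh t * ρ + ρ ^ 2)) -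
      4 * (2 * n) * Real.sinh t * ρ * Real.cosh (2 * n * t)) := by
  obtain ⟨h1, h2⟩ := exp_mul_lam t b n
  have h3 := exp_mul_mu t n
  have e : Real.exp (2 * n * t) ^ 2 * (lam t b n * lam t b (-n) - mu t n * mu t (-n)) =
      (Real.exp (2 * n * t) * lam t b n) * (Real.exp (2 * n * t) * lam t b (-n)) -
      (Real.exp (2 * n * t) * mu t n) ^ 2 := by rw [mu_neg]; ring
  rw [e, h1, h2, h3]
  have hc := Real.cosh_sq' (2 * n * t)
  have hC := Real.cosh_sq' t
  set N : ℝ := 2 * n with hN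
  have h4 : N + 1 ≠ 0 := by positivity
  have h5 : N - 1 ≠ 0 := by
    intro h
    have : (2 * (n : ℤ) - 1 : ℤ) = 0 := by rw [hN] at h; exact_mod_cast h
    omega
  generalize Real.sinh (N * t) = s at *
  generalize Real.cosh (N * t) = c at *
  generalize Real.sinh t = S at *
  generalize Real.cosh t = C at *
  subst hb
  have e1 : (N + 1) * (4 * (s * C + c * S) / (N + 1)) = 4 * (s * C + c * S) := by field_simp
  have e2 : (N - 1) * (4 * (s * C - c * S) / (N - 1)) = 4 * (s * C - c * S) := by field_simp
  have e3 : (N ^ 2 - 1) * ((4 * (s * C + c * S) / (N + 1) - 2 * (S * c + (C - ρ) * s)) *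
      (4 * (s * C - c * S) / (N - 1) - 2 * (S * c - (C - ρ) * s)) - (2 * S) ^ 2) =
      ((N + 1) * (4 * (s * C + c * S) / (N + 1)) - (N + 1) * (2 * (S * c + (C - ρ) * s))) *
      ((N - 1) * (4 * (s * C - c * S) / (N - 1)) - (N - 1) * (2 * (S * c - (C - ρ) * s))) -
      (N ^ 2 - 1) * (2 * S) ^ 2 := by ring
  rw [e3, e1, e2]
  linear_combination (4 * (N ^ 2 - 1) * S ^ 2) * hc - (4 * (N ^ 2 - 1) * s ^ 2) * hC

/-- The quadratic whose vanishing characterises the first bifurcation mode. -/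
def quadQ (t ρ : ℝ) : ℝ :=
  3 * Real.cosh t * (1 + ρ ^ 2) - (2 * Real.cosh t ^ 2 + 4) * ρ

theorem det_one_eq_zero_iff {t b ρ : ℝ} (ht : 0 < t) (hb : b = Real.cosh t - ρ) :
    lam t b 1 * lam t b (-1) - mu t 1 * mu t (-1) = 0 ↔ quadQ t ρ = 0 := by
  have h := det_formula t b ρ hb 1
  have hS := Real.sinh_pos_iff.2 ht
  have hC := Real.cosh_pos t
  have hE := Real.exp_pos (2 * 1 * t)
  have hQ : 4 * Real.sinh (2 * t) * (Real.sinh (2 * t) *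
      ((2 * Real.cosh t * ρ - 1 - ρ ^ 2) * 4 + (1 + 2 * Real.cosh t * ρ + ρ ^ 2)) -
      8 * Real.sinh t * ρ * Real.cosh (2 * t)) =
      - (16 * Real.sinh t ^ 2 * Real.cosh t) * quadQ t ρ := by
    have hc := Real.cosh_sq' t
    rw [Real.sinh_two_mul, Real.cosh_two_mul, quadQ]
    linear_combination (64 * Real.sinh t ^ 2 * Real.cosh t * ρ) * hc
  norm_num at h
  norm_num at hE
  rw [hQ] at h
  constructor
  · intro h0
    rw [h0] at h
    have : 16 * Real.sinh t ^ 2 * Real.cosh t ≠ 0 := by positivity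
    have h1 : (16 * Real.sinh t ^ 2 * Real.cosh t) * quadQ t ρ = 0 := by linarith
    exact (mul_eq_zero.1 h1).resolve_left this
  · intro h0
    rw [h0, mul_zero] at h
    have : (3 * Real.exp (2 * t) ^ 2) ≠ 0 := by positivity
    refine (mul_eq_zero.1 (?_ : (3 * Real.exp (2 * t) ^ 2) * _ = 0)).resolve_left this
    linarith

theorem sinh_gt_of_four_le {x : ℝ} (hx : 4 ≤ x) : 6 * Real.cosh x < 7 * Real.sinh x := by
  have h1 : 5 ≤ Real.exp x := by linarith [Real.add_one_le_exp x]
  have h2 : Real.exp x * Real.exp (-x) = 1 := by rw [← Real.exp_add]; simp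
  have h3 := Real.exp_pos (-x)
  rw [Real.sinh_eq, Real.cosh_eq]
  nlinarith

theorem one_lt_sinh {t : ℝ} (ht : 1 ≤ t) : 1 < Real.sinh t :=
  lt_of_le_of_lt ht (Real.self_lt_sinh_iff.2 (by linarith))

theorem det_ne_zero {t b ρ : ℝ} (ht : 1 ≤ t) (hb : b = Real.cosh t - ρ) (hρ : 0 < ρ)
    (hQ : quadQ t ρ = 0) (n : ℕ) (hn : 2 ≤ n) :
    lam t b n * lam t b (-n) - mu t n * mu t (-n) ≠ 0 := by
  intro h0
  have h := det_formula t b ρ hb n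
  rw [h0, mul_zero, mul_zero] at h
  have hN : (4 : ℝ) ≤ 2 * n := by
    have : (2 : ℝ) ≤ n := by exact_mod_cast hn
    linarith
  have hx : 4 ≤ 2 * n * t := by nlinarith
  have h1 := sinh_gt_of_four_le hx
  have hs : 0 < Real.sinh (2 * n * t) := Real.sinh_pos_iff.2 (by linarith)
  have hc : 0 < Real.cosh (2 * n * t) := Real.cosh_pos _
  have hS := one_lt_sinh ht
  have hC := Real.cosh_pos t
  have hCC := Real.cosh_sq' t
  generalize (2 * n : ℝ) = N at *
  generalize Real.sinh (N * t) = s at *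
  generalize Real.cosh (N * t) = c at *
  have h2 := (mul_eq_zero.1 h.symm).resolve_left (by positivity)
  rw [quadQ] at hQ
  generalize Real.sinh t = S at *
  generalize Real.cosh t = C at *
  have h3 : 4 * ρ * (s * (S ^ 2 * (N ^ 2 + 2) + 3) - 3 * N * S * C * c) = 0 := by
    linear_combination (3 * C) * h2 + (s * (N ^ 2 - 1)) * hQ - (s * ρ * (4 * N ^ 2 + 8)) * hCC
  have h4 := (mul_eq_zero.1 h3).resolve_left (by positivity)
  have h5 : S * C ≤ S ^ 2 + 1 / 2 := by nlinarith [sq_nonneg (S - C)]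
  have h6 : 3 * N * S * C * c ≤ 3 * N * (S ^ 2 + 1 / 2) * c := by
    have : 0 ≤ 3 * N * c := by positivity
    nlinarith
  have h7 : 0 < S ^ 2 * (N ^ 2 + 2) + 3 := by positivity
  have h8 : 6 * c * (S ^ 2 * (N ^ 2 + 2) + 3) < 7 * s * (S ^ 2 * (N ^ 2 + 2) + 3) :=
    mul_lt_mul_of_pos_right h1 h7
  have h9 : 0 ≤ 6 * (S ^ 2 * (N ^ 2 + 2) + 3) - 21 * N * (S ^ 2 + 1 / 2) := by
    nlinarith [mul_nonneg (by nlinarith : 0 ≤ S ^ 2 - 1)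
      (by nlinarith : 0 ≤ 6 * (N ^ 2 + 2) - 21 * N), mul_nonneg (by linarith : 0 ≤ N - 4)
      (by linarith : 0 ≤ N - 5 / 4)]
  nlinarith [mul_nonneg hc.le h9]

theorem lam_neg_one_ne {t b ρ : ℝ} (ht : 0 < t) (hb : b = Real.cosh t - ρ) (hρ : 1 < ρ)
    (hQ : quadQ t ρ = 0) : lam t b (-1) ≠ lam t b 1 := by
  intro h
  obtain ⟨h1, h2⟩ := exp_mul_lam t b 1
  norm_num at h1 h2
  rw [Real.sinh_two_mul, Real.cosh_two_mul] at h1 h2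
  have hS := Real.sinh_pos_iff.2 ht
  have hC := Real.cosh_pos t
  have hCC := Real.cosh_sq' t
  rw [h] at h2
  rw [quadQ] at hQ
  generalize Real.sinh t = S at *
  generalize Real.cosh t = C at *
  have h3 : S * (3 * C * ρ - C ^ 2 - 2) = 0 := by
    subst hb
    linear_combination (3 / 8) * h2 - (3 / 8) * h1 + (2 * S) * hCC
  have h4 := (mul_eq_zero.1 h3).resolve_left hS.ne'
  have h5 : 3 * C * (1 - ρ ^ 2) = 0 := by linear_combination hQ - 2 * ρ * h4
  have h6 := (mul_eq_zero.1 h5).resolve_left (by positivity)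
  nlinarith

theorem lam_one_add {t b ρ : ℝ} (hb : b = Real.cosh t - ρ) :
    lam t b 1 + (4 * Real.cosh t ^ 2 - 1 - 6 * Real.cosh t * ρ) / 3 * mu t 1 = 0 := by
  obtain ⟨h1, -⟩ := exp_mul_lam t b 1
  have h3 := exp_mul_mu t 1
  norm_num at h1 h3
  rw [Real.sinh_two_mul, Real.cosh_two_mul] at h1
  have hE := Real.exp_pos (2 * t)
  have hCC := Real.cosh_sq' t
  refine (mul_eq_zero.1 (?_ : Real.exp (2 * t) * _ = 0)).resolve_left hE.ne'
  subst hb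
  rw [mul_add, h1]
  linear_combination ((4 * Real.cosh t ^ 2 - 1 - 6 * Real.cosh t * ρ) / 3) * h3 +
    (2 / 3) * Real.sinh t * hCC

theorem mu_pos {t : ℝ} (ht : 0 < t) (n : ℤ) : 0 < mu t n := by
  have hS := Real.sinh_pos_iff.2 ht
  rw [mu_eq]
  positivity

theorem mul_ne_zero_of_quadQ {t b ρ : ℝ} (ht : 0 < t) (hb : b = Real.cosh t - ρ) (hρ : 0 < ρ)
    (hQ : quadQ t ρ = 0) : (Real.sinh t + b) * (Real.sinh t - b) ≠ 0 := by
  have hS := Real.sinh_pos_iff.2 ht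
  have hC := Real.cosh_pos t
  have hCC := Real.cosh_sq' t
  rw [quadQ] at hQ
  intro h
  subst hb
  have : 4 * Real.sinh t ^ 2 * ρ = 0 := by
    linear_combination 3 * Real.cosh t * h + hQ - (4 * ρ - 3 * Real.cosh t) * hCC
  exact (by positivity : 4 * Real.sinh t ^ 2 * ρ ≠ 0) this

theorem sinh_le_mul_cosh {t : ℝ} (ht : 0 ≤ t) : Real.sinh t ≤ t * Real.cosh t := by
  have h : MonotoneOn (fun t => t * Real.cosh t - Real.sinh t) (Ici 0) := by
    refine monotoneOn_of_hasDerivWithinAt_nonneg (f' := fun t => t * Real.sinh t) (convex_Ici 0)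
      (by fun_prop) (fun x _ => ?_) (fun x hx => ?_)
    · exact ((((hasDerivAt_id x).mul (Real.hasDerivAt_cosh x)).sub
        (Real.hasDerivAt_sinh x)).congr_deriv (by simp)).hasDerivWithinAt
    · rw [interior_Ici] at hx
      exact mul_nonneg (le_of_lt hx) (Real.sinh_nonneg_iff.2 (le_of_lt hx))
  have := h self_mem_Ici ht ht
  simp only [zero_mul, Real.sinh_zero, sub_zero] at this
  linarith

theorem mul_cosh_sub_sinh_le {t : ℝ} (ht : 0 ≤ t) :
    t * Real.cosh t - Real.sinh t ≤ Real.sinh t * t ^ 2 / 3 := by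
  have h : MonotoneOn (fun t => Real.sinh t * t ^ 2 / 3 - (t * Real.cosh t - Real.sinh t))
      (Ici 0) := by
    refine monotoneOn_of_hasDerivWithinAt_nonneg
      (f' := fun t => t / 3 * (t * Real.cosh t - Real.sinh t)) (convex_Ici 0)
      (by fun_prop) (fun x _ => ?_) (fun x hx => ?_)
    · exact (((((Real.hasDerivAt_sinh x).mul (hasDerivAt_pow 2 x)).div_const 3).sub
        (((hasDerivAt_id x).mul (Real.hasDerivAt_cosh x)).sub
        (Real.hasDerivAt_sinh x))).congr_deriv (by simp; ring)).hasDerivWithinAt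
    · rw [interior_Ici] at hx
      have := sinh_le_mul_cosh (le_of_lt hx)
      exact mul_nonneg (div_nonneg (le_of_lt hx) (by norm_num)) (by linarith)
  have := h self_mem_Ici ht ht
  simp only [zero_mul, Real.sinh_zero, sub_zero] at this
  norm_num at this
  linarith

/-- `t ^ 2` times `quadQ t (sinh t / t)`. -/
def crit (t : ℝ) : ℝ :=
  3 * Real.cosh t * (t ^ 2 + Real.sinh t ^ 2) - (2 * Real.cosh t ^ 2 + 4) * Real.sinh t * t

theorem strictAntiOn_crit : StrictAntiOn crit (Icc (13 / 10) 2) := by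
  refine strictAntiOn_of_hasDerivWithinAt_neg
    (f' := fun t => Real.sinh t * (3 * t ^ 2 + 7 * Real.sinh t ^ 2 -
      6 * Real.cosh t * t * Real.sinh t)) (convex_Icc _ _)
    (by unfold crit; fun_prop) (fun x _ => ?_) (fun x hx => ?_)
  · refine (((((Real.hasDerivAt_cosh x).const_mul 3).mul ((hasDerivAt_pow 2 x).add
      ((Real.hasDerivAt_sinh x).pow 2))).sub
      ((((((Real.hasDerivAt_cosh x).pow 2).const_mul 2).add_const 4).mul
      (Real.hasDerivAt_sinh x)).mul (hasDerivAt_id x))).congr_deriv ?_).hasDerivWithinAt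
    have := Real.cosh_sq' x
    simp
    generalize Real.cosh x = C at *
    generalize Real.sinh x = S at *
    linear_combination (4 * S - 2 * x * C) * this
  · rw [interior_Icc] at hx
    have hx0 : 0 < x := by linarith [hx.1]
    have hS := Real.sinh_pos_iff.2 hx0
    refine mul_neg_of_pos_of_neg hS ?_
    have h1 := sinh_le_mul_cosh hx0.le
    have h2 := mul_cosh_sub_sinh_le hx0.le
    have h3 := Real.cosh_sq' x
    generalize Real.cosh x = C at *
    generalize Real.sinh x = S at *
    have h4 : (x * C - S) ^ 2 ≤ (S * x ^ 2 / 3) ^ 2 := by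
      apply pow_le_pow_left₀ <;> linarith
    have h5 : 3 * x ^ 2 + 7 * S ^ 2 - 6 * C * x * S = 3 * (x * C - S) ^ 2 + 4 * S ^ 2
        - 3 * S ^ 2 * x ^ 2 := by
      linear_combination (-3 * x ^ 2) * h3
    have h6 : 3 * (S * x ^ 2 / 3) ^ 2 + 4 * S ^ 2 - 3 * S ^ 2 * x ^ 2 =
      S ^ 2 * ((x ^ 2) ^ 2 / 3 + 4 - 3 * x ^ 2) := by ring
    have h7 : (x ^ 2) ^ 2 / 3 + 4 - 3 * x ^ 2 < 0 := by
      nlinarith [mul_pos (by nlinarith [hx.1] : 0 < x ^ 2 - 169 / 100)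
        (by nlinarith [hx.2] : 0 < 4 - x ^ 2)]
    have h8 : S ^ 2 * ((x ^ 2) ^ 2 / 3 + 4 - 3 * x ^ 2) < 0 :=
      mul_neg_of_pos_of_neg (by positivity) h7
    linarith

theorem crit_pos : 0 < crit (13 / 10) := by
  have h0 : Real.exp (13 / 10) ^ 10 = Real.exp 1 ^ 13 := by
    rw [← Real.exp_nat_mul, ← Real.exp_nat_mul]; norm_num
  have h1 := Real.exp_one_gt_d9
  have h2 := Real.exp_one_lt_d9
  have h3 : Real.exp (13 / 10) < 368 / 100 := by
    refine lt_of_pow_lt_pow_left₀ 10 (by norm_num) ?_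
    rw [h0]
    exact (pow_lt_pow_left₀ h2 (Real.exp_pos _).le (by norm_num)).trans (by norm_num)
  have h4 : 366 / 100 < Real.exp (13 / 10) := by
    refine lt_of_pow_lt_pow_left₀ 10 (Real.exp_pos _).le ?_
    rw [h0]
    exact lt_trans (by norm_num) (pow_lt_pow_left₀ h1 (by norm_num) (by norm_num))
  have h5 : Real.exp (13 / 10) * Real.exp (-(13 / 10)) = 1 := by rw [← Real.exp_add]; simp
  have h6 : Real.exp (-(13 / 10)) < 274 / 1000 := by nlinarith
  have h7 : 271 / 1000 < Real.exp (-(13 / 10)) := by nlinarith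
  have hS := Real.sinh_eq (13 / 10)
  have hC := Real.cosh_eq (13 / 10)
  rw [crit]
  generalize Real.cosh (13 / 10) = C at *
  generalize Real.sinh (13 / 10) = S at *
  have hS1 : 1693 / 1000 < S := by linarith
  have hS2 : S < 1705 / 1000 := by linarith
  have hC1 : 1965 / 1000 < C := by linarith
  have hC2 : C < 1977 / 1000 := by linarith
  have e1 : 3 * (1965 / 1000) * ((13 / 10) ^ 2 + (1693 / 1000) ^ 2) ≤
      3 * C * ((13 / 10) ^ 2 + S ^ 2) := by gcongr
  have e2 : (2 * C ^ 2 + 4) * S * (13 / 10) ≤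
      (2 * (1977 / 1000) ^ 2 + 4) * (1705 / 1000) * (13 / 10) := by
    have : 0 < S := by linarith
    have : 0 < C := by linarith
    gcongr
  norm_num at e1 e2 ⊢
  linarith

theorem crit_neg : crit 2 < 0 := by
  have h0 : Real.exp 2 = Real.exp 1 ^ 2 := by
    rw [← Real.exp_nat_mul]; norm_num
  have h1 := Real.exp_one_gt_d9
  have h2 := Real.exp_one_lt_d9
  have h3 : Real.exp 2 < 74 / 10 := by
    rw [h0]
    exact (pow_lt_pow_left₀ h2 (Real.exp_pos _).le (by norm_num)).trans (by norm_num)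
  have h4 : 73 / 10 < Real.exp 2 := by
    rw [h0]
    exact lt_trans (by norm_num) (pow_lt_pow_left₀ h1 (by norm_num) (by norm_num))
  have h5 : Real.exp 2 * Real.exp (-2) = 1 := by rw [← Real.exp_add]; simp
  have h6 : Real.exp (-2) < 138 / 1000 := by nlinarith
  have h7 : 134 / 1000 < Real.exp (-2) := by nlinarith
  have hS := Real.sinh_eq 2
  have hC := Real.cosh_eq 2
  rw [crit]
  generalize Real.cosh 2 = C at *
  generalize Real.sinh 2 = S at *
  have hS1 : 358 / 100 < S := by linarith
  have hS2 : S < 3634 / 1000 := by linarith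
  have hC1 : 3715 / 1000 < C := by linarith
  have hC2 : C < 377 / 100 := by linarith
  have hS0 : 0 < S := by linarith
  have hC0 : 0 < C := by linarith
  have e1 : 3 * C * (2 ^ 2 + S ^ 2) ≤ 3 * (377 / 100) * (2 ^ 2 + (3634 / 1000) ^ 2) := by gcongr
  have e2 : (2 * (3715 / 1000) ^ 2 + 4) * (358 / 100) * 2 ≤ (2 * C ^ 2 + 4) * S * 2 := by
    gcongr
  norm_num at e1 e2 ⊢
  linarith

theorem exists_crit : ∃ t ∈ Ioo (1 : ℝ) 2, crit t = 0 ∧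
    (∀ᶠ x in 𝓝[<] t, 0 < crit x) ∧ ∀ᶠ x in 𝓝[>] t, crit x < 0 := by
  obtain ⟨t, ht, h0⟩ := intermediate_value_Ioo' (by norm_num : (13 / 10 : ℝ) ≤ 2)
    (by unfold crit; fun_prop : ContinuousOn crit (Icc (13 / 10) 2)) ⟨crit_neg, crit_pos⟩
  have ht' := Ioo_subset_Icc_self ht
  refine ⟨t, ⟨by linarith [ht.1], ht.2⟩, h0, ?_, ?_⟩
  · filter_upwards [Ioo_mem_nhdsLT ht.1] with x hx
    rw [← h0]
    exact strictAntiOn_crit ⟨hx.1.le, by linarith [hx.2, ht.2]⟩ ht' hx.2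
  · filter_upwards [Ioo_mem_nhdsGT ht.2] with x hx
    rw [← h0]
    exact strictAntiOn_crit ht' ⟨by linarith [hx.1, ht.1], hx.2.le⟩ hx.1

/-- The sign of `crit` decides on which side of `sinh t / t` the larger root of `quadQ` lies. -/
theorem crit_eq {t ρ : ℝ} (hQ : quadQ t ρ = 0) :
    ρ * crit t = 3 * Real.cosh t * (Real.sinh t - t * ρ) * (Real.sinh t * ρ - t) := by
  rw [quadQ] at hQ
  rw [crit]
  linear_combination Real.sinh t * t * hQ

theorem quadQ_of_crit {t : ℝ} (ht : t ≠ 0) (h : crit t = 0) : quadQ t (Real.sinh t / t) = 0 := by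
  rw [crit] at h
  rw [quadQ]
  field_simp
  linear_combination h

/-- The closed round annulus `|log |ζ|| ≤ ρ`. -/
def An (ρ : ℝ) : Set ℂ := {ζ | Real.exp (-ρ) ≤ ‖ζ‖ ∧ ‖ζ‖ ≤ Real.exp ρ}

theorem An.ne_zero {ρ : ℝ} {ζ : ℂ} (h : ζ ∈ An ρ) : ζ ≠ 0 := by
  rintro rfl
  have := h.1
  rw [norm_zero] at this
  exact absurd (Real.exp_pos (-ρ)) this.not_gt

theorem An.inv_mem {ρ : ℝ} {ζ : ℂ} (h : ζ ∈ An ρ) : ζ⁻¹ ∈ An ρ := by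
  have h0 : 0 < ‖ζ‖ := norm_pos_iff.2 (An.ne_zero h)
  constructor
  · rw [norm_inv, Real.exp_neg]; exact inv_anti₀ h0 h.2
  · rw [norm_inv, ← neg_neg ρ, Real.exp_neg (-ρ)]; exact inv_anti₀ (Real.exp_pos _) h.1

theorem An.exp_mul_mem {ρ : ℝ} {ζ : ℂ} (h : ζ ∈ An ρ) {t r : ℝ} (ht : |t| ≤ r) :
    (Real.exp t : ℂ) * ζ ∈ An (r + ρ) := by
  have h1 := abs_le.1 ht
  simp only [An, mem_ofPred_eq, norm_mul, Complex.norm_real, Real.norm_eq_abs, Real.abs_exp]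
  constructor
  · rw [neg_add, Real.exp_add]
    exact mul_le_mul (Real.exp_le_exp.2 h1.1) h.1 (Real.exp_pos _).le (Real.exp_pos _).le
  · rw [Real.exp_add]
    exact mul_le_mul (Real.exp_le_exp.2 h1.2) h.2 (norm_nonneg _) (Real.exp_pos _).le

theorem An.mono {ρ r : ℝ} (h : ρ ≤ r) : An ρ ⊆ An r := fun _ hζ =>
  ⟨(Real.exp_le_exp.2 (by linarith)).trans hζ.1, hζ.2.trans (Real.exp_le_exp.2 h)⟩

theorem exp_mem_An {x ρ : ℝ} (h : |x| ≤ ρ) : (Real.exp x : ℂ) ∈ An ρ := by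
  have := An.exp_mul_mem (ρ := 0) (ζ := 1) (by simp [An]) h
  simpa using this

theorem exp_zpow (x : ℝ) (k : ℤ) : Real.exp x ^ k = Real.exp (k * x) := by
  rw [← Real.rpow_intCast, ← Real.exp_mul, mul_comm]

theorem norm_zpow_le {ρ : ℝ} {ζ : ℂ} (h : ζ ∈ An ρ) (k : ℤ) :
    ‖ζ ^ k‖ ≤ Real.exp (ρ * |k|) := by
  have key : ∀ (n : ℕ) (ζ : ℂ), ζ ∈ An ρ → ‖ζ ^ n‖ ≤ Real.exp (ρ * n) := fun n ζ h => by
    rw [norm_pow, mul_comm, Real.exp_nat_mul]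
    exact pow_le_pow_left₀ (norm_nonneg _) h.2 n
  obtain ⟨n, rfl | rfl⟩ := k.eq_nat_or_neg
  · simpa using key n ζ h
  · simpa using key n ζ⁻¹ (An.inv_mem h)

theorem norm_zpow_sub_zpow_le {ρ : ℝ} (hρ : 0 ≤ ρ) {ζ ξ : ℂ} (hζ : ζ ∈ An ρ) (hξ : ξ ∈ An ρ)
    (k : ℤ) : ‖ζ ^ k - ξ ^ k‖ ≤ |k| * Real.exp (ρ * (|k| + 2)) * ‖ζ - ξ‖ := by
  have key : ∀ (n : ℕ) (ζ ξ : ℂ), ζ ∈ An ρ → ξ ∈ An ρ →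
      ‖ζ ^ n - ξ ^ n‖ ≤ n * Real.exp (ρ * n) * ‖ζ - ξ‖ := fun n ζ ξ hζ hξ => by
    induction n with
    | zero => simp
    | succ n ih =>
      have e : ζ ^ (n + 1) - ξ ^ (n + 1) = ζ * (ζ ^ n - ξ ^ n) + (ζ - ξ) * ξ ^ n := by ring
      have h1 : ‖ξ ^ n‖ ≤ Real.exp (ρ * n) := by
        simpa using norm_zpow_le hξ n
      have h2 : Real.exp (ρ * n) ≤ Real.exp (ρ * (n + 1)) :=
        Real.exp_le_exp.2 (by nlinarith)
      have h3 : Real.exp (ρ * (n + 1)) = Real.exp ρ * Real.exp (ρ * n) := by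
        rw [← Real.exp_add]; ring_nf
      rw [e]
      refine (norm_add_le _ _).trans ?_
      rw [norm_mul, norm_mul]
      push_cast
      have h4 : ‖ζ‖ * ‖ζ ^ n - ξ ^ n‖ ≤ Real.exp ρ * (n * Real.exp (ρ * n) * ‖ζ - ξ‖) :=
        mul_le_mul hζ.2 ih (norm_nonneg _) (Real.exp_pos _).le
      have h5 : ‖ζ - ξ‖ * ‖ξ ^ n‖ ≤ ‖ζ - ξ‖ * Real.exp (ρ * (n + 1)) :=
        mul_le_mul_of_nonneg_left (h1.trans h2) (norm_nonneg _)
      rw [h3] at h5 ⊢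
      linarith
  have h0 : (1 : ℝ) ≤ Real.exp (ρ * 2) := by
    rw [← Real.exp_zero, Real.exp_le_exp]; positivity
  obtain ⟨n, rfl | rfl⟩ := k.eq_nat_or_neg
  · refine (by simpa using key n ζ ξ hζ hξ : ‖ζ ^ (n : ℤ) - ξ ^ (n : ℤ)‖ ≤ _).trans ?_
    simp only [Nat.abs_cast, Int.cast_natCast]
    gcongr
    linarith
  · have h1 := key n ζ⁻¹ ξ⁻¹ (An.inv_mem hζ) (An.inv_mem hξ)
    have h2 : ‖ζ⁻¹ - ξ⁻¹‖ ≤ Real.exp (ρ * 2) * ‖ζ - ξ‖ := by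
      rw [inv_sub_inv (An.ne_zero hζ) (An.ne_zero hξ), norm_div, norm_sub_rev, div_eq_inv_mul,
        mul_two, Real.exp_add, ← norm_inv, mul_inv, norm_mul]
      exact mul_le_mul_of_nonneg_right (mul_le_mul (An.inv_mem hζ).2 (An.inv_mem hξ).2
        (norm_nonneg _) (Real.exp_pos _).le) (norm_nonneg _)
    have h3 : ‖ζ ^ (-(n : ℤ)) - ξ ^ (-(n : ℤ))‖ = ‖ζ⁻¹ ^ n - ξ⁻¹ ^ n‖ := by simp
    rw [h3]
    refine h1.trans ?_
    simp only [abs_neg, Nat.abs_cast, Int.cast_natCast]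
    rw [mul_add ρ, Real.exp_add]
    calc _ ≤ n * Real.exp (ρ * n) * (Real.exp (ρ * 2) * ‖ζ - ξ‖) := by gcongr
      _ = _ := by ring

/-- The weighted monomials of the square root of the derivative. -/
def wS (ζ : ℂ) (n : ℤ) : ℂ := Real.exp (-8 * |n| : ℤ) * ζ ^ (2 * n)

/-- The weighted monomials of the conformal map. -/
def wF (ζ : ℂ) (j l : ℤ) : ℂ :=
  Real.exp (-8 * (|j| + |l|) : ℤ) * ζ ^ (2 * (j + l) + 1) / (2 * (j + l) + 1 : ℤ)

theorem norm_wS_le {ρ : ℝ} (hρ : ρ ≤ 4) {ζ : ℂ} (h : ζ ∈ An ρ) (n : ℤ) :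
    ‖wS ζ n‖ ≤ 1 := by
  rw [wS, norm_mul, Complex.norm_real, Real.norm_eq_abs, Real.abs_exp]
  calc _ ≤ Real.exp (-8 * |n| : ℤ) * Real.exp (4 * |2 * n| : ℤ) := by
        gcongr
        simpa using norm_zpow_le (An.mono hρ h) (2 * n)
    _ = 1 := by
        rw [← Real.exp_add, ← Int.cast_add, abs_mul]; simp; ring

theorem norm_div_odd_le (z : ℂ) (m : ℤ) : ‖z / (2 * m + 1 : ℤ)‖ ≤ ‖z‖ := by
  rw [norm_div, Complex.norm_intCast]
  exact div_le_self (norm_nonneg _) (one_le_abs_odd m)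

theorem abs_odd_le (j l : ℤ) : |2 * (j + l) + 1| ≤ 2 * (|j| + |l|) + 1 := by grind

theorem norm_wF_le {ρ : ℝ} (hρ : ρ ≤ 4) {ζ : ℂ} (h : ζ ∈ An ρ) (j l : ℤ) :
    ‖wF ζ j l‖ ≤ Real.exp 4 := by
  refine (norm_div_odd_le _ _).trans ?_
  rw [norm_mul, Complex.norm_real, Real.norm_eq_abs, Real.abs_exp]
  have h1 := norm_zpow_le (An.mono hρ h) (2 * (j + l) + 1)
  calc _ ≤ Real.exp (-8 * (|j| + |l|) : ℤ) * Real.exp (4 * |2 * (j + l) + 1|) := by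
        gcongr
    _ ≤ _ := by
        rw [← Real.exp_add, Real.exp_le_exp]
        have := abs_odd_le j l
        have : -8 * (|j| + |l|) + 4 * |2 * (j + l) + 1| ≤ 4 := by linarith
        exact_mod_cast this

theorem norm_wS_sub_le {ζ ξ : ℂ} (hζ : ζ ∈ An (7 / 2)) (hξ : ξ ∈ An (7 / 2)) (n : ℤ) :
    ‖wS ζ n - wS ξ n‖ ≤ Real.exp 11 * ‖ζ - ξ‖ := by
  rw [wS, wS, ← mul_sub, norm_mul, Complex.norm_real, Real.norm_eq_abs, Real.abs_exp]
  have h1 := norm_zpow_sub_zpow_le (by norm_num) hζ hξ (2 * n)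
  have h2 : (|(2 * n : ℤ)| : ℝ) ≤ Real.exp (1 + |(n : ℝ)|) := by
    push_cast
    rw [abs_mul, abs_two, Real.exp_add]
    have h3 := Real.add_one_le_exp (1 : ℝ)
    have h4 := Real.add_one_le_exp |(n : ℝ)|
    exact mul_le_mul (by linarith) (by linarith) (abs_nonneg _) (Real.exp_pos _).le
  calc _ ≤ Real.exp (-8 * |n| : ℤ) *
        (Real.exp (1 + |(n : ℝ)|) * Real.exp (7 / 2 * (|(2 * n : ℤ)| + 2)) * ‖ζ - ξ‖) := by
        refine mul_le_mul_of_nonneg_left (h1.trans ?_) (Real.exp_pos _).le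
        push_cast at h2 ⊢
        gcongr
    _ = Real.exp 8 * ‖ζ - ξ‖ := by
        rw [← mul_assoc, ← Real.exp_add, ← Real.exp_add]
        congr 2
        push_cast
        rw [abs_mul, abs_two]
        ring
    _ ≤ _ := by gcongr; norm_num

theorem norm_wF_sub_le {ζ ξ : ℂ} (hζ : ζ ∈ An (7 / 2)) (hξ : ξ ∈ An (7 / 2)) (j l : ℤ) :
    ‖wF ζ j l - wF ξ j l‖ ≤ Real.exp 11 * ‖ζ - ξ‖ := by
  rw [wF, wF, ← sub_div, ← mul_sub, norm_div, norm_mul, Complex.norm_real, Real.norm_eq_abs,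
    Real.abs_exp, Complex.norm_intCast]
  have h1 := norm_zpow_sub_zpow_le (by norm_num) hζ hξ (2 * (j + l) + 1)
  have h2 := one_le_abs_odd (j + l)
  have h3 : (|(2 * (j + l) + 1 : ℤ)| : ℝ) ≤ 2 * (|(j : ℝ)| + |(l : ℝ)|) + 1 := by
    exact_mod_cast abs_odd_le j l
  rw [div_le_iff₀ (by linarith)]
  have h4 : Real.exp (-8 * (|j| + |l|) : ℤ) * Real.exp (7 / 2 * (|(2 * (j + l) + 1 : ℤ)| + 2)) ≤
      Real.exp 11 := by
    rw [← Real.exp_add, Real.exp_le_exp]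
    have := abs_nonneg (j : ℝ)
    have := abs_nonneg (l : ℝ)
    push_cast at h3 ⊢
    linarith
  calc _ ≤ Real.exp (-8 * (|j| + |l|) : ℤ) * (|(2 * (j + l) + 1 : ℤ)| *
        Real.exp (7 / 2 * (|(2 * (j + l) + 1 : ℤ)| + 2)) * ‖ζ - ξ‖) := by
        refine mul_le_mul_of_nonneg_left ?_ (Real.exp_pos _).le
        exact_mod_cast h1
    _ = (Real.exp (-8 * (|j| + |l|) : ℤ) *
        Real.exp (7 / 2 * (|(2 * (j + l) + 1 : ℤ)| + 2))) * ‖ζ - ξ‖ *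
        |(2 * (j + l) + 1 : ℤ)| := by push_cast; ring
    _ ≤ _ := by
        push_cast at h4 ⊢
        gcongr

theorem exists_SS (ζ : ℂ) : ∃ A : L1 →L[ℝ] ℂ, ζ ∈ An 4 → ∀ n, A (dl n) = wS ζ n := by
  by_cases h : ζ ∈ An 4
  · exact (exists_clm (wS ζ) 1 (norm_wS_le le_rfl h)).imp fun _ hA _ => hA
  · exact ⟨0, fun h' => absurd h' h⟩

theorem exists_FF (ζ : ℂ) :
    ∃ A : L1 →L[ℝ] L1 →L[ℝ] ℂ, ζ ∈ An 4 → ∀ j l, A (dl j) (dl l) = wF ζ j l := by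
  by_cases h : ζ ∈ An 4
  · obtain ⟨A, hA, -⟩ := exists_bilin_family (C := Real.exp 4) (K := 0) (Real.exp_pos _).le le_rfl
      (fun _ => wF ζ) (fun _ => norm_wF_le le_rfl h) (by simp)
    exact ⟨A 0, fun _ => hA 0⟩
  · exact ⟨0, fun h' => absurd h' h⟩

/-- Evaluation at `ζ` of the square root of the derivative of the conformal map. -/
def SS (ζ : ℂ) : L1 →L[ℝ] ℂ := (exists_SS ζ).choose

/-- Evaluation at `ζ` of the conformal map, as a bilinear form in the coefficients of the square
root of its derivative. -/
def FF (ζ : ℂ) : L1 →L[ℝ] L1 →L[ℝ] ℂ := (exists_FF ζ).choose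

theorem SS_dl {ζ : ℂ} (h : ζ ∈ An 4) (n : ℤ) : SS ζ (dl n) = wS ζ n :=
  (exists_SS ζ).choose_spec h n

theorem FF_dl {ζ : ℂ} (h : ζ ∈ An 4) (j l : ℤ) : FF ζ (dl j) (dl l) = wF ζ j l :=
  (exists_FF ζ).choose_spec h j l

theorem An_subset : An (7 / 2) ⊆ An 4 := An.mono (by norm_num)

theorem norm_SS_le {ζ : ℂ} (h : ζ ∈ An 4) : ‖SS ζ‖ ≤ 1 :=
  norm_clm_le zero_le_one fun n => by rw [SS_dl h]; exact norm_wS_le le_rfl h n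

theorem norm_SS_sub_le {ζ ξ : ℂ} (hζ : ζ ∈ An (7 / 2)) (hξ : ξ ∈ An (7 / 2)) :
    ‖SS ζ - SS ξ‖ ≤ Real.exp 11 * ‖ζ - ξ‖ :=
  norm_clm_le (by positivity) fun n => by
    rw [_root_.sub_apply, SS_dl (An_subset hζ), SS_dl (An_subset hξ)]
    exact norm_wS_sub_le hζ hξ n

theorem norm_FF_sub_le {ζ ξ : ℂ} (hζ : ζ ∈ An (7 / 2)) (hξ : ξ ∈ An (7 / 2)) :
    ‖FF ζ - FF ξ‖ ≤ Real.exp 11 * ‖ζ - ξ‖ :=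
  norm_clm_le (by positivity) fun n => norm_clm_le (by positivity) fun m => by
    rw [_root_.sub_apply, _root_.sub_apply, FF_dl (An_subset hζ), FF_dl (An_subset hξ)]
    exact norm_wF_sub_le hζ hξ n m

theorem continuousOn_of_norm_sub_le {F : Type} [NormedAddCommGroup F] {A : ℂ → F} {s : Set ℂ}
    {C : ℝ} (hC : 0 ≤ C) (h : ∀ ζ ∈ s, ∀ ξ ∈ s, ‖A ζ - A ξ‖ ≤ C * ‖ζ - ξ‖) :
    ContinuousOn A s :=
  (LipschitzOnWith.of_dist_le_mul (K := ⟨C, hC⟩) fun x hx y hy => by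
    rw [dist_eq_norm, dist_eq_norm]; exact h x hx y hy).continuousOn

theorem continuousOn_SS : ContinuousOn SS (An (7 / 2)) :=
  continuousOn_of_norm_sub_le (Real.exp_pos 11).le fun _ h _ h' => norm_SS_sub_le h h'

theorem continuousOn_FF : ContinuousOn FF (An (7 / 2)) :=
  continuousOn_of_norm_sub_le (Real.exp_pos 11).le fun _ h _ h' => norm_FF_sub_le h h'

/-- The free boundary equation in function form. -/
theorem SS_mul_FF_sub {t c c' : ℝ} (ht : t ∈ Icc (1 : ℝ) 2) {σ : L1}
    (h : TT t σ σ σ = c • DP t σ + c' • DM t σ) {ω : ℂ} (hω : ω ∈ An (3 / 2)) :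
    SS ω⁻¹ σ * (FF (Real.exp t * ω) σ σ - FF (Real.exp (-t) * ω) σ σ) =
      ω * (c * SS (Real.exp t * ω) σ + c' * SS (Real.exp (-t) * ω) σ) := by
  have hω0 := An.ne_zero hω
  have m1 : ω⁻¹ ∈ An 4 := An.mono (by norm_num) (An.inv_mem hω)
  have m2 : (Real.exp t * ω : ℂ) ∈ An 4 :=
    An.mono (by norm_num) (An.exp_mul_mem hω (r := 2) (abs_le.2 ⟨by linarith [ht.1], ht.2⟩))
  have m3 : (Real.exp (-t) * ω : ℂ) ∈ An 4 :=
    An.mono (by norm_num) (An.exp_mul_mem hω (r := 2)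
      (abs_le.2 ⟨by linarith [ht.2], by linarith [ht.1]⟩))
  obtain ⟨L, hL⟩ := exists_clm (fun n => wS ω n * Real.exp ((2 * |n| : ℤ) * t)) 1 fun n => by
    rw [wS, norm_mul, norm_mul, Complex.norm_real, Complex.norm_real, Real.norm_eq_abs,
      Real.norm_eq_abs, Real.abs_exp, Real.abs_exp]
    refine (mul_le_mul_of_nonneg_right (mul_le_mul_of_nonneg_left (norm_zpow_le hω (2 * n))
      (Real.exp_pos _).le) (Real.exp_pos _).le).trans ?_
    rw [← Real.exp_add, ← Real.exp_add, Real.exp_le_one_iff]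
    push_cast
    rw [abs_mul, abs_two]
    nlinarith [abs_nonneg (n : ℝ), ht.1, ht.2]
  set D := FF (Real.exp t * ω) - FF (Real.exp (-t) * ω) with hD
  have k0 : ∀ i j l, ω * L (TT t (dl i) (dl j) (dl l)) = SS ω⁻¹ (dl i) * D (dl j) (dl l) := by
    intro i j l
    have hodd : ((2 * (j + l) + 1 : ℤ) : ℂ) ≠ 0 := by
      exact_mod_cast (by omega : 2 * (j + l) + 1 ≠ 0)
    rw [TT_dl ht, map_smul, hL, hD, _root_.sub_apply, _root_.sub_apply, FF_dl m2, FF_dl m3,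
      SS_dl m1, kap, wS, wS, wF, wF, mul_zpow, mul_zpow, inv_zpow', ← Complex.ofReal_zpow,
      ← Complex.ofReal_zpow, exp_zpow, exp_zpow, Complex.real_smul]
    have e1 : Real.exp ((2 * (j + l) + 1 - 2 * |j + l - i| : ℤ) * t) =
        Real.exp ((2 * (j + l) + 1 : ℤ) * t) * Real.exp (-((2 * |j + l - i| : ℤ) * t)) := by
      rw [← Real.exp_add]; push_cast; ring_nf
    have e2 : Real.exp ((-(2 * (j + l) + 1) - 2 * |j + l - i| : ℤ) * t) =
        Real.exp ((2 * (j + l) + 1 : ℤ) * -t) * Real.exp (-((2 * |j + l - i| : ℤ) * t)) := by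
      rw [← Real.exp_add]; push_cast; ring_nf
    have e3 : Real.exp (-8 * exc i j l) = Real.exp (-8 * |i| : ℤ) *
        Real.exp (-8 * (|j| + |l|) : ℤ) * (Real.exp (-8 * |j + l - i| : ℤ))⁻¹ := by
      rw [← Real.exp_neg, ← Real.exp_add, ← Real.exp_add, exc]; push_cast; ring_nf
    have e4 : ω ^ (-(2 * i)) * ω ^ (2 * (j + l) + 1) = ω * ω ^ (2 * (j + l - i)) := by
      rw [← zpow_add₀ hω0, ← zpow_one_add₀ hω0]; ring_nf
    rw [e1, e2, e3, Real.exp_neg]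
    have n1 := Real.exp_ne_zero ((2 * |j + l - i| : ℤ) * t)
    have n2 := Real.exp_ne_zero (-8 * |j + l - i| : ℤ)
    generalize Real.exp ((2 * |j + l - i| : ℤ) * t) = x1 at *
    generalize Real.exp (-8 * |j + l - i| : ℤ) = x2 at *
    generalize Real.exp (-8 * |i| : ℤ) = x3 at *
    generalize Real.exp (-8 * (|j| + |l|) : ℤ) = x4 at *
    generalize Real.exp ((2 * (j + l) + 1 : ℤ) * t) = x5 at *
    generalize Real.exp ((2 * (j + l) + 1 : ℤ) * -t) = x6 at *
    have n1' : (x1 : ℂ) ≠ 0 := by exact_mod_cast n1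
    have n2' : (x2 : ℂ) ≠ 0 := by exact_mod_cast n2
    push_cast at hodd ⊢
    field_simp
    linear_combination (-(x3 : ℂ) * x4 * (x5 - x6)) * e4
  have k1 : ∀ i j c, ω * L (TT t (dl i) (dl j) c) = SS ω⁻¹ (dl i) * D (dl j) c := fun i j c => by
    have := clm_ext (A := ω • L ∘L TT t (dl i) (dl j)) (B := SS ω⁻¹ (dl i) • D (dl j))
      fun l => by simpa using k0 i j l
    simpa using congrArg (fun A => A c) this
  have k2 : ∀ i b c, ω * L (TT t (dl i) b c) = SS ω⁻¹ (dl i) * D b c := fun i b c => by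
    have := clm_ext (A := ω • L ∘L (TT t (dl i)).flip c) (B := SS ω⁻¹ (dl i) • D.flip c)
      fun l => by simpa using k1 i l c
    simpa using congrArg (fun A => A b) this
  have k3 : ω * L (TT t σ σ σ) = SS ω⁻¹ σ * D σ σ := by
    have := clm_ext (A := ω • L ∘L ((TT t).flip σ).flip σ) (B := D σ σ • SS ω⁻¹)
      fun i => by simpa [mul_comm] using k2 i σ σ
    simpa [mul_comm] using congrArg (fun A => A σ) this
  have k4 : L ∘L DP t = SS (Real.exp t * ω) := clm_ext fun n => by
    simp only [ContinuousLinearMap.comp_apply]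
    rw [DP_dl ht, map_smul, hL, SS_dl m2, wS, wS, mul_zpow, ← Complex.ofReal_zpow,
      exp_zpow, Complex.real_smul]
    have : Real.exp ((2 * n : ℤ) * t) =
        Real.exp ((2 * n - 2 * |n| : ℤ) * t) * Real.exp ((2 * |n| : ℤ) * t) := by
      rw [← Real.exp_add]; push_cast; ring_nf
    rw [this]; push_cast; ring
  have k5 : L ∘L DM t = SS (Real.exp (-t) * ω) := clm_ext fun n => by
    simp only [ContinuousLinearMap.comp_apply]
    rw [DM_dl ht, map_smul, hL, SS_dl m3, wS, wS, mul_zpow, ← Complex.ofReal_zpow,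
      exp_zpow, Complex.real_smul]
    have : Real.exp ((2 * n : ℤ) * -t) =
        Real.exp ((-2 * n - 2 * |n| : ℤ) * t) * Real.exp ((2 * |n| : ℤ) * t) := by
      rw [← Real.exp_add]; push_cast; ring_nf
    rw [this]; push_cast; ring
  have k6 : SS ω⁻¹ σ * D σ σ = ω * (c * (L ∘L DP t) σ + c' * (L ∘L DM t) σ) := by
    rw [← k3, h, map_add, map_smul, map_smul]
    simp
  rw [k4, k5] at k6
  exact k6

/-- The analytic function whose primitive is the holomorphic part of the solution. -/
def hol (t c : ℝ) (σ : L1) (ζ : ℂ) : ℂ :=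
  FF (Real.exp t * ζ⁻¹) σ σ * SS ζ σ ^ 2 - c * SS (Real.exp t * ζ⁻¹) σ * SS ζ σ * ζ⁻¹

/-- The complex gradient of the solution in the coordinate of the annulus. -/
def wir (t c : ℝ) (σ : L1) (ζ : ℂ) : ℂ :=
  hol t c σ ζ - (starRingEnd ℂ) (FF ζ σ σ) * SS ζ σ ^ 2

/-- The difference of the values of the solution on the two boundary circles. -/
def gap (t c : ℝ) (σ : L1) : ℝ :=
  ∫ v in (-1 : ℝ)..1, (wir t c σ (Real.exp (t * v / 2)) * (t / 2 * Real.exp (t * v / 2) : ℝ)).re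

theorem continuous_gap : Continuous fun p : ℝ × ℝ × L1 => gap (cl p.1) p.2.1 p.2.2 := by
  have key : Continuous (Function.uncurry fun (p : ℝ × ℝ × L1) (v : ℝ) =>
      (wir (cl p.1) p.2.1 p.2.2 (Real.exp (cl p.1 * max (-1) (min 1 v) / 2)) *
        (cl p.1 / 2 * Real.exp (cl p.1 * max (-1) (min 1 v) / 2) : ℝ)).re) := by
    have hcl : Continuous cl := by unfold cl; fun_prop
    have g1 : Continuous fun x : (ℝ × ℝ × L1) × ℝ =>
        ((Real.exp (cl x.1.1 * max (-1) (min 1 x.2) / 2) : ℝ) : ℂ) := by fun_prop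
    have g2 : Continuous fun x : (ℝ × ℝ × L1) × ℝ =>
        (Real.exp (cl x.1.1) : ℂ) * ((Real.exp (cl x.1.1 * max (-1) (min 1 x.2) / 2) : ℝ) : ℂ)⁻¹ :=
      (by fun_prop : Continuous fun x : (ℝ × ℝ × L1) × ℝ => (Real.exp (cl x.1.1) : ℂ)).mul
        (g1.inv₀ fun x => by exact_mod_cast Real.exp_ne_zero _)
    have m1 : ∀ x : (ℝ × ℝ × L1) × ℝ,
        ((Real.exp (cl x.1.1 * max (-1) (min 1 x.2) / 2) : ℝ) : ℂ) ∈ An 1 := fun x => by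
      refine exp_mem_An ?_
      have h1 := cl_mem x.1.1
      have h2 : |max (-1) (min 1 x.2)| ≤ 1 :=
        abs_le.2 ⟨le_max_left _ _, max_le (by norm_num) (min_le_left _ _)⟩
      rw [abs_div, abs_mul, abs_of_nonneg (by linarith [h1.1] : (0 : ℝ) ≤ cl x.1.1), abs_two]
      nlinarith [h1.1, h1.2, abs_nonneg (max (-1) (min 1 x.2))]
    have n1 := fun x => An.mono (by norm_num : (1 : ℝ) ≤ 7 / 2) (m1 x)
    have n2 := fun x : (ℝ × ℝ × L1) × ℝ => An.mono (by norm_num : (2 + 1 : ℝ) ≤ 7 / 2)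
      (An.exp_mul_mem (An.inv_mem (m1 x)) (r := 2) (t := cl x.1.1)
        (abs_le.2 ⟨by linarith [(cl_mem x.1.1).1], (cl_mem x.1.1).2⟩))
    have s1 := continuousOn_SS.comp_continuous g1 n1
    have s2 := continuousOn_SS.comp_continuous g2 n2
    have f1 := continuousOn_FF.comp_continuous g1 n1
    have f2 := continuousOn_FF.comp_continuous g2 n2
    have hσ : Continuous fun x : (ℝ × ℝ × L1) × ℝ => x.1.2.2 := by fun_prop
    have s1' := s1.clm_apply hσ
    have s2' := s2.clm_apply hσ
    have f1' := (f1.clm_apply hσ).clm_apply hσ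
    have f2' := (f2.clm_apply hσ).clm_apply hσ
    have g3 := g1.inv₀ fun x => by exact_mod_cast Real.exp_ne_zero _
    have c1 : Continuous fun x : (ℝ × ℝ × L1) × ℝ => (x.1.2.1 : ℂ) := by fun_prop
    refine Complex.continuous_re.comp (Continuous.mul ?_ (by fun_prop))
    exact ((f2'.mul (s1'.pow 2)).sub (((c1.mul s2').mul s1').mul g3)).sub
      ((Complex.continuous_conj.comp f1').mul (s1'.pow 2))
  refine (intervalIntegral.continuous_parametric_intervalIntegral_of_continuous' key
    (-1) 1 (μ := volume)).congr fun p => intervalIntegral.integral_congr fun v hv => ?_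
  rw [uIcc_of_le (by norm_num)] at hv
  simp only [min_eq_right hv.2, max_eq_right hv.1]

theorem SS_dl_zero {ζ : ℂ} (h : ζ ∈ An 4) : SS ζ (dl 0) = 1 := by
  rw [SS_dl h, wS]; simp

theorem FF_dl_zero {ζ : ℂ} (h : ζ ∈ An 4) : FF ζ (dl 0) (dl 0) = ζ := by
  rw [FF_dl h, wF]; simp

theorem gap_dl_zero {t : ℝ} (ht : t ∈ Icc (1 : ℝ) 2) (c : ℝ) :
    gap t c (dl 0) = t * (Real.exp t - c) - Real.sinh t := by
  have h1 : ∀ v ∈ uIcc (-1 : ℝ) 1, (wir t c (dl 0) (Real.exp (t * v / 2)) *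
      (t / 2 * Real.exp (t * v / 2) : ℝ)).re = t / 2 * (Real.exp t - c) -
        t / 2 * Real.exp (t * v) := fun v hv => by
    rw [uIcc_of_le (by norm_num)] at hv
    have hv' : |v| ≤ 1 := abs_le.2 hv
    have m1 : (Real.exp (t * v / 2) : ℂ) ∈ An 1 := exp_mem_An (by
      rw [abs_div, abs_mul, abs_of_nonneg (by linarith [ht.1] : (0 : ℝ) ≤ t), abs_two]
      nlinarith [ht.1, ht.2, abs_nonneg v])
    have n1 := An.mono (by norm_num : (1 : ℝ) ≤ 4) m1
    have n2 := An.mono (by norm_num : (2 + 1 : ℝ) ≤ 4)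
      (An.exp_mul_mem (An.inv_mem m1) (r := 2) (t := t)
        (abs_le.2 ⟨by linarith [ht.1], ht.2⟩))
    rw [wir, hol, SS_dl_zero n1, SS_dl_zero n2, FF_dl_zero n1, FF_dl_zero n2, Complex.conj_ofReal]
    have e : Real.exp (t * v) = Real.exp (t * v / 2) * Real.exp (t * v / 2) := by
      rw [← Real.exp_add]; ring_nf
    rw [e]
    have hx := Real.exp_ne_zero (t * v / 2)
    generalize Real.exp (t * v / 2) = x at *
    rw [← Complex.ofReal_re (t / 2 * (Real.exp t - c) - t / 2 * (x * x))]
    congr 1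
    have hx' : (x : ℂ) ≠ 0 := by exact_mod_cast hx
    push_cast
    field_simp
  have ht0 : t ≠ 0 := by linarith [ht.1]
  rw [gap, intervalIntegral.integral_congr h1, intervalIntegral.integral_sub (by simp)
    (Continuous.intervalIntegrable (by fun_prop) _ _), intervalIntegral.integral_const_mul,
    intervalIntegral.integral_const_mul, intervalIntegral.integral_comp_mul_left _ ht0, integral_exp, Real.sinh_eq]
  simp
  field_simp
  ring

theorem TT_eq_of_GG_eq_zero {t ε : ℝ} (ht : t ∈ Icc (1 : ℝ) 2) {v : L1}
    (h : GG (par (ε, t), v) = 0) :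
    TT t (dl 0 + ε • eta v) (dl 0 + ε • eta v) (dl 0 + ε • eta v) =
      (Real.sinh t + co 1 v) • DP t (dl 0 + ε • eta v) +
      (Real.sinh t - co 1 v + ε * co 0 v) • DM t (dl 0 + ε • eta v) := by
  have h1 : TT t (dl 0) (dl 0) (dl 0) = (2 * Real.sinh t) • dl 0 := by
    rw [TT_dl ht]
    congr 1
    have := mu_eq t 0
    simpa [mu] using this
  have h2 : DP t (dl 0) = dl 0 := by rw [DP_dl ht]; simp
  have h3 : DM t (dl 0) = dl 0 := by rw [DM_dl ht]; simp
  have h4 := congrArg (fun x => ε • x) h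
  simp only [GG, par, smul_zero] at h4
  simp only [map_add, map_smul, _root_.add_apply, _root_.smul_apply, h1, h2, h3]
  rw [← sub_eq_zero] at h4 ⊢
  rw [← h4]
  module

/-- The quadratic form measuring the failure of the symmetry under quarter turns. -/
def asym (t : ℝ) : L1 →L[ℝ] L1 →L[ℝ] ℂ :=
  FF (Real.exp (t / 2)) + Complex.I • FF (Real.exp (t / 2) * Complex.I)

theorem mul_I_mem_An {ρ : ℝ} {ζ : ℂ} (h : ζ ∈ An ρ) : ζ * Complex.I ∈ An ρ := by
  simpa [An] using h

theorem continuousAt_asym {t : ℝ} (ht : t ∈ Ioo (1 : ℝ) 2) : ContinuousAt asym t := by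
  have key : ContinuousOn asym (Icc 1 2) := by
    have m1 : ∀ t ∈ Icc (1 : ℝ) 2, (Real.exp (t / 2) : ℂ) ∈ An (7 / 2) := fun t ht =>
      exp_mem_An (by rw [abs_of_nonneg] <;> linarith [ht.1, ht.2])
    have h1 : ContinuousOn (fun t : ℝ => FF (Real.exp (t / 2))) (Icc 1 2) :=
      continuousOn_FF.comp (by fun_prop) m1
    have h2 : ContinuousOn (fun t : ℝ => FF (Real.exp (t / 2) * Complex.I)) (Icc 1 2) :=
      continuousOn_FF.comp (by fun_prop) fun t ht => mul_I_mem_An (m1 t ht)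
    exact h1.add (h2.const_smul Complex.I)
  exact key.continuousAt (Icc_mem_nhds ht.1 ht.2)

theorem asym_dl {t : ℝ} (ht : t ∈ Icc (1 : ℝ) 2) :
    asym t (dl 0) (dl 0) = 0 ∧
    asym t (dl 0) (dl 1) = (Real.exp (-8) * (2 / 3 * Real.exp (t / 2) ^ 3) : ℝ) ∧
    asym t (dl 1) (dl 0) = (Real.exp (-8) * (2 / 3 * Real.exp (t / 2) ^ 3) : ℝ) ∧
    asym t (dl 0) (dl (-1)) = -(Real.exp (-8) * (2 * (Real.exp (t / 2))⁻¹) : ℝ) ∧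
    asym t (dl (-1)) (dl 0) = -(Real.exp (-8) * (2 * (Real.exp (t / 2))⁻¹) : ℝ) := by
  have m1 : (Real.exp (t / 2) : ℂ) ∈ An 4 :=
    exp_mem_An (by rw [abs_of_nonneg] <;> linarith [ht.1, ht.2])
  have I3 : Complex.I ^ 3 = -Complex.I := Complex.I_pow_three
  have Im : Complex.I⁻¹ = -Complex.I := Complex.inv_I
  have II := Complex.I_mul_I
  simp only [asym, _root_.add_apply, _root_.smul_apply, FF_dl m1, FF_dl (mul_I_mem_An m1), wF]
  generalize Real.exp (t / 2) = r
  refine ⟨?_, ?_, ?_, ?_, ?_⟩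
  · norm_num
    linear_combination (r : ℂ) * II
  · norm_num [zpow_ofNat, mul_pow, I3]
    linear_combination (-1 / 3 * Complex.exp (-8) * (r : ℂ) ^ 3) * II
  · norm_num [zpow_ofNat, mul_pow, I3]
    linear_combination (-1 / 3 * Complex.exp (-8) * (r : ℂ) ^ 3) * II
  · norm_num
    linear_combination (Complex.exp (-8) * (r : ℂ)⁻¹) * II
  · norm_num
    linear_combination (Complex.exp (-8) * (r : ℂ)⁻¹) * II

theorem asym_ne_zero {t ρ : ℝ} (ht : t ∈ Icc (1 : ℝ) 2) (hρ : 1 < ρ) :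
    asym t (dl 0) (dl 1 + ((4 * Real.cosh t ^ 2 - 1 - 6 * Real.cosh t * ρ) / 3) • dl (-1)) +
      asym t (dl 1 + ((4 * Real.cosh t ^ 2 - 1 - 6 * Real.cosh t * ρ) / 3) • dl (-1)) (dl 0) ≠
        0 := by
  obtain ⟨-, h1, h2, h3, h4⟩ := asym_dl ht
  simp only [map_add, map_smul, _root_.add_apply, _root_.smul_apply, h1, h2, h3, h4]
  set y := (4 * Real.cosh t ^ 2 - 1 - 6 * Real.cosh t * ρ) / 3 with hy
  have hr := Real.exp_pos (t / 2)
  have hE := Real.exp_pos (-8)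
  have hr4 : Real.exp (t / 2) ^ 4 = (Real.cosh t + Real.sinh t) ^ 2 := by
    rw [Real.cosh_add_sinh, ← Real.exp_nat_mul, ← Real.exp_nat_mul]; ring_nf
  have hC := Real.cosh_pos t
  have hd : Real.cosh t - Real.sinh t < 1 := by
    rw [Real.cosh_sub_sinh, Real.exp_lt_one_iff]; linarith [ht.1]
  have hlt : 3 * y < Real.exp (t / 2) ^ 4 := by
    rw [hr4, hy]
    nlinarith [Real.cosh_sq' t, mul_pos hC (by linarith : 0 < 3 * ρ + Real.sinh t - Real.cosh t)]
  have e : (Real.exp (-8) * (4 / 3) * (Real.exp (t / 2))⁻¹ * (Real.exp (t / 2) ^ 4 - 3 * y)) ≠ 0 :=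
    (by have := sub_pos.2 hlt; positivity)
  generalize Real.exp (t / 2) = r at *
  generalize Real.exp (-8) = x at *
  intro h0
  refine e ?_
  have h0' : x * (2 / 3 * r ^ 3) + y * -(x * (2 * r⁻¹)) +
      (x * (2 / 3 * r ^ 3) + y * -(x * (2 * r⁻¹))) = 0 := by
    simp only [Complex.real_smul] at h0
    exact_mod_cast h0
  rw [← h0']
  field_simp
  ring

/-- Arbitrarily small nontrivial solutions of the free boundary equations. -/
theorem exists_small_solution {η : ℝ} (hη : 0 < η) :
    ∃ t ∈ Ioo (1 : ℝ) 2, ∃ (c c' : ℝ) (σ : L1), ‖σ - dl 0‖ < η ∧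
      TT t σ σ σ = c • DP t σ + c' • DM t σ ∧ gap t c σ = 0 ∧ asym t σ σ ≠ 0 := by
  obtain ⟨t, ht, hcr, hl, hr⟩ := exists_crit
  have ht' := Ioo_subset_Icc_self ht
  have ht0 : 0 < t := by linarith [ht.1]
  set ρ := Real.sinh t / t with hρd
  have hρ : 1 < ρ := by rw [hρd, lt_div_iff₀ ht0, one_mul]; exact Real.self_lt_sinh_iff.2 ht0
  have hQ : quadQ t ρ = 0 := quadQ_of_crit ht0.ne' hcr
  set b := Real.cosh t - ρ with hb
  set y := (4 * Real.cosh t ^ 2 - 1 - 6 * Real.cosh t * ρ) / 3 with hy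
  have h1 : lam t b 1 + y * mu t 1 = 0 := lam_one_add hb
  have hmu := (mu_pos ht0 1).ne'
  have h2 : mu t 1 + y * lam t b (-1) = 0 := by
    have hd := (det_one_eq_zero_iff ht0 hb).2 hQ
    rw [mu_neg, (by linarith : lam t b 1 = -(y * mu t 1))] at hd
    have : mu t 1 * (mu t 1 + y * lam t b (-1)) = 0 := by linear_combination -hd
    exact (mul_eq_zero.1 this).resolve_left hmu
  obtain ⟨θ, hθ0, hθ⟩ := exists_branch ht' h2 h1 (lam_neg_one_ne ht0 hb hρ hQ)
    (det_ne_zero ht.1.le hb (by linarith) hQ) (mul_ne_zero_of_quadQ ht0 hb (by linarith) hQ)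
  have heta : eta (θ (0, t)) = dl 1 + y • dl (-1) := by
    rw [hθ0, eta, map_add, map_smul, map_smul, Pr_dl_one, Pr_dl (by norm_num) (by norm_num),
      smul_zero, zero_add]
  have hco : co 1 (θ (0, t)) = b := by simp [hθ0, co_dl]
  have hce : ContinuousAt (fun x => eta (θ x)) (0, t) :=
    ContinuousAt.comp (g := eta) contDiff_eta.continuous.continuousAt hθ.self_of_nhds.1
  have hsm : ∀ᶠ x : ℝ × ℝ in 𝓝 (0, t), ‖x.1 • eta (θ x)‖ < η :=
    ContinuousAt.eventually_lt (continuousAt_fst.smul hce).norm continuousAt_const (by simpa)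
  have hrho : ∀ᶠ x : ℝ × ℝ in 𝓝 (0, t), co 1 (θ x) < Real.cosh x.2 - 1 := by
    refine ContinuousAt.eventually_lt
      (ContinuousAt.comp (g := co 1) (co 1).continuous.continuousAt hθ.self_of_nhds.1)
      (by fun_prop) ?_
    change co 1 (θ (0, t)) < _
    rw [hco]; simpa [hb] using hρ
  have hmem : ∀ᶠ x : ℝ × ℝ in 𝓝 (0, t), x.2 ∈ Ioo (1 : ℝ) 2 :=
    continuousAt_snd.eventually (Ioo_mem_nhds ht.1 ht.2)
  have has : ∀ᶠ x : ℝ × ℝ in 𝓝 (0, t), asym x.2 (dl 0) (eta (θ x)) + asym x.2 (eta (θ x)) (dl 0) +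
      x.1 • asym x.2 (eta (θ x)) (eta (θ x)) ≠ 0 := by
    have ha : ContinuousAt (fun x : ℝ × ℝ => asym x.2) (0, t) :=
      ContinuousAt.comp (g := asym) (continuousAt_asym ht) continuousAt_snd
    have h0 : ContinuousAt (fun _ : ℝ × ℝ => dl 0) (0, t) := continuousAt_const
    refine ContinuousAt.eventually_ne (((((ha.clm_apply h0).clm_apply hce)).add
      ((ha.clm_apply hce).clm_apply h0)).add
      (continuousAt_fst.smul ((ha.clm_apply hce).clm_apply hce))) ?_
    change asym t (dl 0) (eta (θ (0, t))) + asym t (eta (θ (0, t))) (dl 0) +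
      (0 : ℝ) • asym t (eta (θ (0, t))) (eta (θ (0, t))) ≠ 0
    rw [heta, zero_smul, add_zero]
    exact asym_ne_zero ht' hρ
  obtain ⟨δ, hδ, hball⟩ := Metric.eventually_nhds_iff_ball.1
    (hθ.and (hsm.and (hrho.and (hmem.and has))))
  have hin : ∀ ε s : ℝ, |ε| < δ → |s - t| < δ → ((ε, s) : ℝ × ℝ) ∈ Metric.ball ((0 : ℝ), t) δ :=
    fun ε s h1 h2 => by
      rw [Metric.mem_ball, Prod.dist_eq, Real.dist_eq, Real.dist_eq, sub_zero]
      exact max_lt h1 h2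
  obtain ⟨t₁, hc₁, ht₁⟩ := (hl.and (Ioo_mem_nhdsLT (by linarith : t - δ < t))).exists
  obtain ⟨t₂, hc₂, ht₂⟩ := (hr.and (Ioo_mem_nhdsGT (by linarith : t < t + δ))).exists
  obtain ⟨J, hJ⟩ : ∃ J : ℝ × ℝ → ℝ, ∀ x, J x =
      gap (cl x.2) (Real.sinh x.2 + co 1 (θ x)) (dl 0 + x.1 • eta (θ x)) := ⟨_, fun _ => rfl⟩
  have hJc : ∀ x ∈ Metric.ball ((0 : ℝ), t) δ, ContinuousAt J x := fun x hx => by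
    have hc := (hball x hx).1.1
    have hc1 : ContinuousAt (fun x => co 1 (θ x)) x :=
      ContinuousAt.comp (g := co 1) (co 1).continuous.continuousAt hc
    have hc2 : ContinuousAt (fun x => eta (θ x)) x :=
      ContinuousAt.comp (g := eta) contDiff_eta.continuous.continuousAt hc
    have hs : ContinuousAt (fun x : ℝ × ℝ => Real.sinh x.2) x := by fun_prop
    have hp : ContinuousAt (fun x : ℝ × ℝ =>
        (x.2, Real.sinh x.2 + co 1 (θ x), dl 0 + x.1 • eta (θ x))) x :=
      continuousAt_snd.prodMk ((hs.add hc1).prodMk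
        (continuousAt_const.add (continuousAt_fst.smul hc2)))
    exact (continuous_gap.continuousAt.comp hp).congr (.of_forall fun x => (hJ x).symm)
  have hJ0 : ∀ s, |s - t| < δ → ∃ ρ' : ℝ, 1 < ρ' ∧
      ρ' * crit s = -(3 * Real.cosh s * J (0, s) * (Real.sinh s * ρ' - s)) ∧
      0 < Real.sinh s * ρ' - s := fun s hs => by
    obtain ⟨hG, -, h3, h4, -⟩ := hball _ (hin 0 s (by simpa using hδ) hs)
    have hs' := Ioo_subset_Icc_self h4
    have hs0 : 0 < s := by linarith [h4.1]
    set ρ' := Real.cosh s - co 1 (θ (0, s)) with hρ'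
    have hρ1 : 1 < ρ' := by simp only at h3; linarith
    have hQ' : quadQ s ρ' = 0 := by
      refine (det_one_eq_zero_iff hs0 (b := co 1 (θ (0, s))) (by rw [hρ']; ring)).1 ?_
      obtain ⟨e1, e2⟩ := co_GG_par_zero hs' (θ (0, s))
      rw [hG.2, map_zero] at e1 e2
      linear_combination lam s (co 1 (θ (0, s))) (-1) * (-e1) + mu s (-1) * e2
    refine ⟨ρ', hρ1, ?_, ?_⟩
    · rw [crit_eq hQ', hJ, zero_smul, add_zero]
      rw [cl_of_mem hs', gap_dl_zero hs', ← Real.cosh_add_sinh, hρ']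
      ring
    · nlinarith [Real.self_lt_sinh_iff.2 hs0]
  have a₁ : |t₁ - t| < δ := abs_lt.2 ⟨by linarith [ht₁.1], by linarith [ht₁.2]⟩
  have a₂ : |t₂ - t| < δ := abs_lt.2 ⟨by linarith [ht₂.1], by linarith [ht₂.2]⟩
  have n₁ : J (0, t₁) < 0 := by
    obtain ⟨ρ', k1, k2, k3⟩ := hJ0 t₁ a₁
    by_contra! hneg
    have := mul_nonneg (mul_nonneg (mul_nonneg (by norm_num : (0 : ℝ) ≤ 3)
      (Real.cosh_pos t₁).le) hneg) k3.le
    nlinarith [mul_pos (by linarith : 0 < ρ') hc₁]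
  have n₂ : 0 < J (0, t₂) := by
    obtain ⟨ρ', k1, k2, k3⟩ := hJ0 t₂ a₂
    by_contra! hneg
    have := mul_nonneg (mul_nonneg (mul_nonneg (by norm_num : (0 : ℝ) ≤ 3)
      (Real.cosh_pos t₂).le) (neg_nonneg.2 hneg)) k3.le
    nlinarith [mul_pos (by linarith : 0 < ρ') (neg_pos.2 hc₂)]
  have cts : ∀ s, |s - t| < δ → ContinuousAt (fun ε : ℝ => J (ε, s)) 0 := fun s hs =>
    ContinuousAt.comp (g := J) (f := fun ε : ℝ => (ε, s)) (hJc _ (hin 0 s (by simpa using hδ) hs))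
      (by fun_prop)
  obtain ⟨ε, ⟨e₁, e₂⟩, hε⟩ := (((cts t₁ a₁).eventually_lt continuousAt_const n₁).and
    (continuousAt_const.eventually_lt (cts t₂ a₂) n₂)).filter_mono nhdsWithin_le_nhds |>.and
    (Ioo_mem_nhdsGT hδ) |>.exists
  have hε' : |ε| < δ := by rw [abs_of_pos hε.1]; exact hε.2
  have hbox : ∀ s ∈ Icc t₁ t₂, |s - t| < δ := fun s hs =>
    abs_lt.2 ⟨by linarith [ht₁.1, hs.1], by linarith [ht₂.2, hs.2]⟩
  obtain ⟨s, hs, hJs⟩ := intermediate_value_Icc (by linarith [ht₁.2, ht₂.1] : t₁ ≤ t₂)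
    (f := fun s => J (ε, s)) (fun s hs => (ContinuousAt.comp (g := J) (f := fun s : ℝ => (ε, s))
      (hJc _ (hin ε s hε' (hbox s hs))) (by fun_prop)).continuousWithinAt) ⟨e₁.le, e₂.le⟩
  obtain ⟨hG, h2, -, h4, h5⟩ := hball _ (hin ε s hε' (hbox s hs))
  have hs' := Ioo_subset_Icc_self h4
  refine ⟨s, h4, _, _, dl 0 + ε • eta (θ (ε, s)), by simpa using h2,
    TT_eq_of_GG_eq_zero hs' hG.2, ?_, ?_⟩
  · simp only [hJ] at hJs
    rwa [cl_of_mem hs'] at hJs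
  · have e : asym s (dl 0 + ε • eta (θ (ε, s))) (dl 0 + ε • eta (θ (ε, s))) =
        ε • (asym s (dl 0) (eta (θ (ε, s))) + asym s (eta (θ (ε, s))) (dl 0) +
          ε • asym s (eta (θ (ε, s))) (eta (θ (ε, s)))) := by
      simp only [map_add, map_smul, _root_.add_apply, _root_.smul_apply, (asym_dl hs').1]
      module
    rw [e]
    exact smul_ne_zero hε.1.ne' h5

theorem HasSum.of_eq {I : Type} {f g : I → ℂ} {a : ℂ} (h : HasSum f a) (e : ∀ i, g i = f i) :
    HasSum g a :=
  (funext e : g = f) ▸ h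

theorem HasSum.prod_of_eq {I J : Type} {a : I → ℂ} {b : J → ℂ} {F : I × J → ℂ} {x y : ℂ}
    (ha : HasSum a x) (hb : HasSum b y) (ha' : Summable fun i => ‖a i‖)
    (hb' : Summable fun j => ‖b j‖) (e : ∀ i j, F (i, j) = a i * b j) : HasSum F (x * y) :=
  (ha.mul hb (summable_mul_of_summable_norm ha' hb')).of_eq fun p => e p.1 p.2

theorem HasSum.sum_of_eq {I J : Type} {a : I → ℂ} {b : J → ℂ} {F : I ⊕ J → ℂ} {x y : ℂ}
    (ha : HasSum a x) (hb : HasSum b y) (hl : ∀ i, F (.inl i) = a i) (hr : ∀ j, F (.inr j) = b j) :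
    HasSum F (x + y) :=
  .sum (ha.of_eq hl) (hb.of_eq hr)

theorem Summable.sum_of_eq {I J : Type} {a : I → ℝ} {b : J → ℝ} {F : I ⊕ J → ℝ}
    (ha : Summable a) (hb : Summable b) (hl : ∀ i, F (.inl i) = a i)
    (hr : ∀ j, F (.inr j) = b j) : Summable F :=
  .sum F (ha.congr fun i => (hl i).symm) (hb.congr fun j => (hr j).symm)

/-- The open round annulus `|log |ζ|| < ρ`. -/
def Ao (ρ : ℝ) : Set ℂ := {ζ | Real.exp (-ρ) < ‖ζ‖ ∧ ‖ζ‖ < Real.exp ρ}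

theorem isOpen_Ao (ρ : ℝ) : IsOpen (Ao ρ) :=
  (isOpen_lt continuous_const continuous_norm).inter (isOpen_lt continuous_norm continuous_const)

theorem Ao_subset_An (ρ : ℝ) : Ao ρ ⊆ An ρ := fun _ h => ⟨h.1.le, h.2.le⟩

theorem An_subset_Ao {r ρ : ℝ} (h : r < ρ) : An r ⊆ Ao ρ := fun _ hζ =>
  ⟨(Real.exp_lt_exp.2 (by linarith)).trans_le hζ.1, hζ.2.trans_lt (Real.exp_lt_exp.2 h)⟩

theorem hasDerivAt_of_hasSum_zpow {I : Type} {c : I → ℝ} {k : I → ℤ} {ρ : ℝ} {g : ℂ → ℂ}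
    (hs : Summable fun i => |c i| * Real.exp (ρ * |k i|))
    (hg : ∀ ζ ∈ An ρ, HasSum (fun i => c i * ζ ^ k i) (g ζ)) {ζ : ℂ} (hζ : ζ ∈ Ao ρ) {d : ℂ}
    (hd : HasSum (fun i => c i * (k i * ζ ^ (k i - 1))) d) : HasDerivAt g d ζ := by
  have hdiff : ∀ i, ∀ w ∈ Ao ρ, HasDerivAt (fun w : ℂ => c i * w ^ k i)
      (c i * (k i * w ^ (k i - 1))) w := fun i w hw =>
    (hasDerivAt_zpow _ _ (.inl (An.ne_zero (Ao_subset_An _ hw)))).const_mul _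
  have hdo : ∀ i, DifferentiableOn ℂ (fun w : ℂ => c i * w ^ k i) (Ao ρ) := fun i w hw =>
    (hdiff i w hw).differentiableAt.differentiableWithinAt
  have hle : ∀ i, ∀ w ∈ Ao ρ, ‖(c i : ℂ) * w ^ k i‖ ≤ |c i| * Real.exp (ρ * |k i|) :=
    fun i w hw => by
      rw [norm_mul, Complex.norm_real, Real.norm_eq_abs]
      exact mul_le_mul_of_nonneg_left (norm_zpow_le (Ao_subset_An _ hw) _) (abs_nonneg _)
  have h1 := Complex.hasSum_deriv_of_summable_norm hs hdo (isOpen_Ao ρ) hle hζ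
  simp only [fun i => (hdiff i ζ hζ).deriv] at h1
  have h2 := ((Complex.differentiableOn_tsum_of_summable_norm hs hdo (isOpen_Ao ρ) hle).differentiableAt
    ((isOpen_Ao ρ).mem_nhds hζ)).hasDerivAt
  rw [h1.unique hd] at h2
  refine h2.congr_of_eventuallyEq ?_
  filter_upwards [(isOpen_Ao ρ).mem_nhds hζ] with w hw
  exact (hg w (Ao_subset_An _ hw)).tsum_eq.symm

/-- `g` is the sum of a Laurent series with real coefficients, converging absolutely on the
closed annulus `An ρ`. -/
def IsLaur (ρ : ℝ) (g : ℂ → ℂ) : Prop :=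
  ∃ (I : Type) (c : I → ℝ) (k : I → ℤ), (Summable fun i => |c i| * Real.exp (ρ * |k i|)) ∧
    ∀ ζ ∈ An ρ, HasSum (fun i => c i * ζ ^ k i) (g ζ)

theorem IsLaur.mono {ρ r : ℝ} (h : r ≤ ρ) {g : ℂ → ℂ} (hg : IsLaur ρ g) : IsLaur r g := by
  obtain ⟨I, c, k, h1, h2⟩ := hg
  exact ⟨I, c, k, h1.of_nonneg_of_le (fun i => by positivity) fun i => by gcongr,
    fun ζ hζ => h2 ζ (An.mono h hζ)⟩

theorem summable_norm_laur {I : Type} {c : I → ℝ} {k : I → ℤ} {ρ : ℝ}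
    (hs : Summable fun i => |c i| * Real.exp (ρ * |k i|)) {ζ : ℂ} (hζ : ζ ∈ An ρ) :
    Summable fun i => ‖(c i : ℂ) * ζ ^ k i‖ :=
  hs.of_nonneg_of_le (fun _ => norm_nonneg _) fun i => by
    rw [norm_mul, Complex.norm_real, Real.norm_eq_abs]
    exact mul_le_mul_of_nonneg_left (norm_zpow_le hζ _) (abs_nonneg _)

theorem IsLaur.mul {ρ : ℝ} (hρ : 0 ≤ ρ) {g h : ℂ → ℂ} (hg : IsLaur ρ g) (hh : IsLaur ρ h) :
    IsLaur ρ fun ζ => g ζ * h ζ := by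
  obtain ⟨I, c, k, h1, h2⟩ := hg
  obtain ⟨J, d, l, h3, h4⟩ := hh
  refine ⟨I × J, fun p => c p.1 * d p.2, fun p => k p.1 + l p.2, ?_, fun ζ hζ => ?_⟩
  · refine (h1.mul_of_nonneg h3 (fun i => by positivity) fun i => by positivity).of_nonneg_of_le
      (fun i => by positivity) fun p => ?_
    have : Real.exp (ρ * |(k p.1 + l p.2 : ℤ)|) ≤
        Real.exp (ρ * |(k p.1 : ℤ)|) * Real.exp (ρ * |(l p.2 : ℤ)|) := by
      rw [← Real.exp_add, ← mul_add]
      gcongr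
      exact_mod_cast abs_add_le _ _
    calc _ ≤ |c p.1| * |d p.2| *
          (Real.exp (ρ * |(k p.1 : ℤ)|) * Real.exp (ρ * |(l p.2 : ℤ)|)) := by
          rw [abs_mul]; gcongr
      _ = _ := by ring
  · refine (h2 ζ hζ).prod_of_eq (h4 ζ hζ) (summable_norm_laur h1 hζ) (summable_norm_laur h3 hζ)
      fun i j => ?_
    rw [zpow_add₀ (An.ne_zero hζ), Complex.ofReal_mul, mul_mul_mul_comm]

theorem IsLaur.const_mul {ρ : ℝ} {g : ℂ → ℂ} (hg : IsLaur ρ g) (a : ℝ) :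
    IsLaur ρ fun ζ => a * g ζ := by
  obtain ⟨I, c, k, h1, h2⟩ := hg
  refine ⟨I, fun i => a * c i, k, (h1.mul_left |a|).congr fun i => ?_, fun ζ hζ =>
    ((h2 ζ hζ).mul_left (a : ℂ)).of_eq fun i => ?_⟩
  · rw [abs_mul, mul_assoc]
  · push_cast; ring

theorem IsLaur.add {ρ : ℝ} {g h : ℂ → ℂ} (hg : IsLaur ρ g) (hh : IsLaur ρ h) :
    IsLaur ρ fun ζ => g ζ + h ζ := by
  obtain ⟨I, c, k, h1, h2⟩ := hg
  obtain ⟨J, d, l, h3, h4⟩ := hh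
  exact ⟨I ⊕ J, Sum.elim c d, Sum.elim k l, h1.sum_of_eq h3 (fun _ => rfl) fun _ => rfl,
    fun ζ hζ => (h2 ζ hζ).sum_of_eq (h4 ζ hζ) (fun _ => rfl) fun _ => rfl⟩

theorem isLaur_inv (ρ : ℝ) : IsLaur ρ fun ζ => ζ⁻¹ :=
  ⟨Unit, fun _ => 1, fun _ => -1, (hasSum_fintype _).summable, fun ζ _ => by
    simp [hasSum_unique]⟩

theorem IsLaur.comp_exp_mul_inv {ρ r t : ℝ} (h : |t| + r ≤ ρ) {g : ℂ → ℂ} (hg : IsLaur ρ g) :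
    IsLaur r fun ζ => g (Real.exp t * ζ⁻¹) := by
  obtain ⟨I, c, k, h1, h2⟩ := hg
  refine ⟨I, fun i => c i * Real.exp t ^ k i, fun i => -k i,
    h1.of_nonneg_of_le (fun i => by positivity) fun i => ?_, fun ζ hζ =>
    (h2 _ (An.mono h (An.exp_mul_mem (An.inv_mem hζ) le_rfl))).of_eq fun i => ?_⟩
  · rw [abs_mul, mul_assoc]
    refine mul_le_mul_of_nonneg_left ?_ (abs_nonneg _)
    rw [exp_zpow, Real.abs_exp, ← Real.exp_add, Real.exp_le_exp]
    push_cast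
    rw [abs_neg]
    calc (k i * t + r * |(k i : ℝ)| : ℝ) ≤ |(k i : ℝ)| * |t| + r * |(k i : ℝ)| := by
          rw [← abs_mul]; gcongr; exact le_abs_self _
      _ = (|t| + r) * |(k i : ℝ)| := by ring
      _ ≤ _ := by gcongr
  · rw [mul_zpow, inv_zpow, zpow_neg]
    push_cast
    ring

theorem isLaur_SS (σ : L1) : IsLaur 4 fun ζ => SS ζ σ := by
  refine ⟨ℤ, fun n => σ n * Real.exp (-8 * |n| : ℤ), fun n => 2 * n,
    σ.hasSum_norm.summable.congr fun n => ?_, fun ζ hζ => ?_⟩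
  · rw [abs_mul, Real.abs_exp, mul_assoc, ← Real.exp_add, abs_mul]
    push_cast
    rw [abs_two, show (-8 * |(n : ℝ)| + 4 * (2 * |(n : ℝ)|) : ℝ) = 0 by ring, Real.exp_zero,
      mul_one]
  · refine (hasSum_clm (SS ζ) σ).of_eq fun n => ?_
    rw [SS_dl hζ, wS, Complex.real_smul]
    push_cast
    ring

theorem isLaur_FF_aux (σ : L1) :
    Summable fun p : ℤ × ℤ => |σ p.1 * σ p.2 * Real.exp (-8 * (|p.1| + |p.2|) : ℤ) /
      (2 * (p.1 + p.2) + 1 : ℤ)| * Real.exp (4 * |(2 * (p.1 + p.2) + 1 : ℤ)|) := by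
  have hσ := σ.hasSum_norm.summable
  refine ((hσ.mul_of_nonneg hσ (fun _ => abs_nonneg _) fun _ => abs_nonneg _).mul_left
    (Real.exp 4)).of_nonneg_of_le (fun p => by positivity) fun p => ?_
  have h1 : (1 : ℝ) ≤ |((2 * (p.1 + p.2) + 1 : ℤ) : ℝ)| := one_le_abs_odd _
  have h2 : |((2 * (p.1 + p.2) + 1 : ℤ) : ℝ)| ≤ 2 * (|p.1| + |p.2| : ℤ) + 1 := by
    exact_mod_cast abs_odd_le p.1 p.2
  rw [abs_div, abs_mul, abs_mul, Real.abs_exp]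
  calc _ ≤ |σ p.1| * |σ p.2| * Real.exp (-8 * (|p.1| + |p.2|) : ℤ) *
        Real.exp (4 * (2 * (|p.1| + |p.2| : ℤ) + 1)) := by
        gcongr
        · exact div_le_self (by positivity) h1
        · exact_mod_cast h2
    _ = _ := by
        rw [mul_assoc, ← Real.exp_add]
        push_cast
        rw [show (-8 * (|(p.1 : ℝ)| + |(p.2 : ℝ)|) + 4 * (2 * (|(p.1 : ℝ)| + |(p.2 : ℝ)|) + 1) : ℝ)
          = 4 by ring]
        ring

theorem hasSum_FF (σ : L1) {ζ : ℂ} (hζ : ζ ∈ An 4) : HasSum (fun p : ℤ × ℤ =>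
    ((σ p.1 * σ p.2 * Real.exp (-8 * (|p.1| + |p.2|) : ℤ) / (2 * (p.1 + p.2) + 1 : ℤ) : ℝ) : ℂ) *
      ζ ^ (2 * (p.1 + p.2) + 1)) (FF ζ σ σ) := by
  have hs := (summable_norm_laur (k := fun p : ℤ × ℤ => 2 * (p.1 + p.2) + 1)
    (isLaur_FF_aux σ) hζ).of_norm
  have h2 : HasSum (fun j => σ j • FF ζ (dl j) σ) (FF ζ σ σ) := by
    simpa using hasSum_clm ((FF ζ).flip σ) σ
  have h3 := hs.hasSum.prod_fiberwise (g := fun j => σ j • FF ζ (dl j) σ) fun j => by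
    refine ((hasSum_clm (FF ζ (dl j)) σ).const_smul (σ j)).of_eq fun l => ?_
    rw [FF_dl hζ, wF, Complex.real_smul, Complex.real_smul]
    push_cast
    ring
  rw [← h3.unique h2]
  exact hs.hasSum

theorem hasDerivAt_FF (σ : L1) {ζ : ℂ} (hζ : ζ ∈ Ao 4) :
    HasDerivAt (fun ζ => FF ζ σ σ) (SS ζ σ ^ 2) ζ := by
  have hζ' := Ao_subset_An _ hζ
  refine hasDerivAt_of_hasSum_zpow (k := fun p : ℤ × ℤ => 2 * (p.1 + p.2) + 1)
    (isLaur_FF_aux σ) (fun ζ hζ => hasSum_FF σ hζ) hζ ?_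
  have h1 := hasSum_clm (SS ζ) σ
  have h2 : Summable fun n => ‖σ n • SS ζ (dl n)‖ := by
    refine σ.hasSum_norm.summable.of_nonneg_of_le (fun _ => norm_nonneg _) fun n => ?_
    rw [SS_dl hζ', norm_smul, Real.norm_eq_abs]
    exact mul_le_of_le_one_right (abs_nonneg _) (norm_wS_le le_rfl hζ' n)
  rw [sq]
  refine h1.prod_of_eq h1 h2 h2 fun i j => ?_
  have h0 : ((2 * (i + j) + 1 : ℤ) : ℂ) ≠ 0 := by
    exact_mod_cast (by omega : (2 * (i + j) + 1 : ℤ) ≠ 0)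
  have hz : ζ ^ (2 * (i + j)) = ζ ^ (2 * i) * ζ ^ (2 * j) := by
    rw [mul_add, zpow_add₀ (An.ne_zero hζ')]
  have hexp : Real.exp (-8 * (|i| + |j|) : ℤ) = Real.exp (-8 * |i| : ℤ) *
      Real.exp (-8 * |j| : ℤ) := by
    rw [← Real.exp_add, mul_add, Int.cast_add]
  rw [SS_dl hζ', SS_dl hζ', wS, wS, Complex.real_smul, Complex.real_smul, add_sub_cancel_right,
    hexp, hz]
  simp only [Complex.ofReal_mul, Complex.ofReal_div, Complex.ofReal_intCast]
  field_simp

theorem isLaur_FF (σ : L1) : IsLaur 4 fun ζ => FF ζ σ σ :=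
  ⟨ℤ × ℤ, _, _, isLaur_FF_aux σ, fun _ hζ => hasSum_FF σ hζ⟩

theorem isLaur_hol {t : ℝ} (ht : t ∈ Icc (1 : ℝ) 2) (c : ℝ) (σ : L1) :
    IsLaur 2 (hol t c σ) := by
  have ha : |t| + 2 ≤ 4 := by rw [abs_of_nonneg (by linarith [ht.1])]; linarith [ht.2]
  have hs : IsLaur 2 fun ζ => SS ζ σ := (isLaur_SS σ).mono (by norm_num)
  have h := ((((isLaur_FF σ).comp_exp_mul_inv ha).mul two_pos.le hs).mul two_pos.le hs).add
    (((((isLaur_SS σ).comp_exp_mul_inv ha).mul two_pos.le hs).mul two_pos.le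
      (isLaur_inv 2)).const_mul (-c))
  convert h using 2
  rw [hol]
  push_cast
  ring

/-- A convergent Laurent series has a primitive, up to a logarithm. -/
theorem IsLaur.exists_primitive {ρ : ℝ} (hρ : 0 ≤ ρ) {g : ℂ → ℂ} (hg : IsLaur ρ g) :
    ∃ (κ : ℝ) (P : ℂ → ℂ), ∀ ζ ∈ Ao ρ, HasDerivAt P (g ζ - κ * ζ⁻¹) ζ := by
  obtain ⟨I, c, k, h1, h2⟩ := hg
  classical
  let e : I → ℝ := fun i => if k i = -1 then c i else 0
  let d : I → ℝ := fun i => if k i = -1 then 0 else c i / (k i + 1)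
  have hc : Summable fun i => |c i| :=
    h1.of_nonneg_of_le (fun _ => abs_nonneg _) fun i =>
      le_mul_of_one_le_right (abs_nonneg _) (Real.one_le_exp (by positivity))
  have he : Summable e := .of_norm_bounded hc fun i => by
    simp only [e]; split_ifs <;> simp
  have hd : Summable fun i => |d i| * Real.exp (ρ * |(k i + 1 : ℤ)|) := by
    refine (h1.mul_right (Real.exp ρ)).of_nonneg_of_le (fun _ => by positivity) fun i => ?_
    have hdc : |d i| ≤ |c i| := by
      simp only [d]
      split_ifs with h
      · simp
      · rw [abs_div]
        refine div_le_self (abs_nonneg _) ?_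
        exact_mod_cast Int.one_le_abs (by omega : k i + 1 ≠ 0)
    rw [mul_assoc, ← Real.exp_add]
    gcongr
    have : ((|k i + 1| : ℤ) : ℝ) ≤ (|k i| : ℤ) + 1 := by
      exact_mod_cast (abs_add_le (k i) 1)
    nlinarith
  refine ⟨∑' i, e i, fun ζ => ∑' i, (d i : ℂ) * ζ ^ (k i + 1), fun ζ hζ => ?_⟩
  refine hasDerivAt_of_hasSum_zpow hd (fun ζ hζ => (summable_norm_laur hd hζ).of_norm.hasSum) hζ ?_
  refine ((h2 ζ (Ao_subset_An _ hζ)).sub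
    ((Complex.hasSum_ofReal.2 he.hasSum).mul_right ζ⁻¹)).of_eq fun i => ?_
  simp only [e, d]
  split_ifs with h
  · simp [h]
  · have : (k i : ℂ) + 1 ≠ 0 := by exact_mod_cast fun h' => h (by omega)
    push_cast
    field_simp
    simp

open scoped ComplexConjugate

/-- The Lipschitz bound on the displacement of the conformal maps used below. -/
def lipc : NNReal := min (1 / 2) (2 * lipschitzExtensionConstant ℂ)⁻¹

/-- The holomorphic data of a ring-shaped solution: `f` maps the annulus `Ao r` to the domain,
`s` is a square root of its derivative, and the harmonic part of the solution is
`Re P + κ log |ζ|` in the coordinate of the annulus. -/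
structure Seed where
  (r c c' κ : ℝ)
  (f s h P : ℂ → ℂ)
  r_mem : r ∈ Ioo 0 (3 / 2)
  deriv_f : ∀ ζ ∈ Ao (3 / 2), HasDerivAt f (s ζ ^ 2) ζ
  s_ne : ∀ ζ ∈ Ao (3 / 2), s ζ ≠ 0
  deriv_P : ∀ ζ ∈ Ao (3 / 2), HasDerivAt P (h ζ - κ * ζ⁻¹) ζ
  outer : ∀ ζ, ‖ζ‖ = Real.exp r → h ζ - conj (f ζ) * s ζ ^ 2 = -c * (s ζ * conj (s ζ)) * ζ⁻¹
  inner : ∀ ζ, ‖ζ‖ = Real.exp (-r) → h ζ - conj (f ζ) * s ζ ^ 2 = c' * (s ζ * conj (s ζ)) * ζ⁻¹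
  gap : ∫ v in (-1 : ℝ)..1, ((h (Real.exp (r * v)) -
    conj (f (Real.exp (r * v))) * s (Real.exp (r * v)) ^ 2) *
      (r * Real.exp (r * v) : ℝ)).re = 0
  map_conj : ∀ ζ ∈ Ao (3 / 2), f (conj ζ) = conj (f ζ)
  map_neg : ∀ ζ ∈ Ao (3 / 2), f (-ζ) = -f ζ
  lip : ∀ ζ ∈ Ao (3 / 2), ∀ ξ ∈ Ao (3 / 2), ‖f ζ - f ξ - (ζ - ξ)‖ ≤ lipc * ‖ζ - ξ‖
  asymm : f (Real.exp r) + Complex.I * f (Real.exp r * Complex.I) ≠ 0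

theorem conj_mem_An {ρ : ℝ} {ζ : ℂ} (h : ζ ∈ An ρ) : conj ζ ∈ An ρ := by simpa [An] using h

theorem neg_mem_An {ρ : ℝ} {ζ : ℂ} (h : ζ ∈ An ρ) : -ζ ∈ An ρ := by simpa [An] using h

theorem SS_conj {ζ : ℂ} (h : ζ ∈ An 4) (σ : L1) : SS (conj ζ) σ = conj (SS ζ σ) := by
  have e : SS (conj ζ) = (Complex.conjCLE : ℂ →L[ℝ] ℂ).comp (SS ζ) := clm_ext fun n => by
    simp only [ContinuousLinearMap.comp_apply, SS_dl h, SS_dl (conj_mem_An h), wS]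
    simp only [ContinuousLinearEquiv.coe_coe, Complex.conjCLE_apply, map_mul, map_zpow₀,
      Complex.conj_ofReal]
  rw [e]
  simp

theorem FF_conj {ζ : ℂ} (h : ζ ∈ An 4) (σ τ : L1) : FF (conj ζ) σ τ = conj (FF ζ σ τ) := by
  have e : FF (conj ζ) = (ContinuousLinearMap.compL ℝ L1 ℂ ℂ
      (Complex.conjCLE : ℂ →L[ℝ] ℂ)).comp (FF ζ) := clm_ext fun n => clm_ext fun m => by
    simp only [ContinuousLinearMap.comp_apply, ContinuousLinearMap.compL_apply, FF_dl h,
      FF_dl (conj_mem_An h), wF]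
    simp only [ContinuousLinearEquiv.coe_coe, Complex.conjCLE_apply, map_mul, map_zpow₀, map_div₀,
      Complex.conj_ofReal, map_intCast]
  rw [e]
  simp

theorem FF_neg {ζ : ℂ} (h : ζ ∈ An 4) : FF (-ζ) = -FF ζ :=
  clm_ext fun n => clm_ext fun m => by
    simp only [_root_.neg_apply, FF_dl h, FF_dl (neg_mem_An h), wF]
    rw [Odd.neg_zpow ⟨n + m, rfl⟩]
    ring

theorem exp_mul_inv_of_norm {ζ : ℂ} {r : ℝ} (h : ‖ζ‖ = Real.exp r) :
    (Real.exp (2 * r) : ℂ) * ζ⁻¹ = conj ζ := by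
  have h0 : ζ ≠ 0 := norm_pos_iff.1 (h ▸ Real.exp_pos r)
  rw [← div_eq_mul_inv, div_eq_iff h0, mul_comm (conj ζ), Complex.mul_conj, Complex.normSq_eq_norm_sq, h,
    ← Real.exp_nat_mul]
  norm_num

theorem exists_seed {η : ℝ} (hη : 0 < η) : ∃ S : Seed, ∀ ζ ∈ Ao (3 / 2), ∀ ξ ∈ Ao (3 / 2),
    ‖S.f ζ - S.f ξ - (ζ - ξ)‖ ≤ η * ‖ζ - ξ‖ := by
  set δ := min (1 / 2) (min η lipc / (3 * Real.exp 11)) with hδ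
  have hl : (0 : ℝ) < lipc := by
    have := lipschitzExtensionConstant_pos ℂ
    exact NNReal.coe_pos.2 (lt_min (by positivity) (by positivity))
  have hδ0 : 0 < δ := by positivity
  obtain ⟨t, ht, c, c', σ, hσ, hT, hg, ha⟩ := exists_small_solution hδ0
  have ht' := Ioo_subset_Icc_self ht
  have hm : Ao (3 / 2) ⊆ An (7 / 2) := (Ao_subset_An _).trans (An.mono (by norm_num))
  have hm4 : Ao (3 / 2) ⊆ An 4 := (Ao_subset_An _).trans (An.mono (by norm_num))
  have hmo : Ao (3 / 2) ⊆ Ao 4 := (Ao_subset_An _).trans (An_subset_Ao (by norm_num))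
  have hmo2 : Ao (3 / 2) ⊆ Ao 2 := (Ao_subset_An _).trans (An_subset_Ao (by norm_num))
  have hσ1 : ‖σ‖ ≤ 2 := by
    calc ‖σ‖ = ‖(σ - dl 0) + dl 0‖ := by rw [sub_add_cancel]
      _ ≤ ‖σ - dl 0‖ + ‖dl 0‖ := norm_add_le _ _
      _ ≤ 1 / 2 + 1 := by rw [norm_dl]; gcongr; exact hσ.le.trans (min_le_left _ _)
      _ ≤ 2 := by norm_num
  have hlip : ∀ ζ ∈ Ao (3 / 2), ∀ ξ ∈ Ao (3 / 2),
      ‖FF ζ σ σ - FF ξ σ σ - (ζ - ξ)‖ ≤ min η lipc * ‖ζ - ξ‖ := fun ζ hζ ξ hξ => by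
    have e : FF ζ σ σ - FF ξ σ σ - (ζ - ξ) =
        (FF ζ - FF ξ) (σ - dl 0) σ + (FF ζ - FF ξ) (dl 0) (σ - dl 0) := by
      simp only [map_sub, _root_.sub_apply, FF_dl_zero (hm4 hζ), FF_dl_zero (hm4 hξ)]
      ring
    have h1 := norm_FF_sub_le (hm hζ) (hm hξ)
    have h2 : δ ≤ min η lipc / (3 * Real.exp 11) := min_le_right _ _
    have h3 : ‖σ - dl 0‖ * (3 * Real.exp 11) ≤ min η lipc :=
      (le_div_iff₀ (by positivity)).1 (hσ.le.trans h2)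
    rw [e]
    calc _ ≤ ‖FF ζ - FF ξ‖ * ‖σ - dl 0‖ * ‖σ‖ + ‖FF ζ - FF ξ‖ * ‖(dl 0 : L1)‖ * ‖σ - dl 0‖ :=
          (norm_add_le _ _).trans (add_le_add (ContinuousLinearMap.le_opNorm₂ _ _ _)
            (ContinuousLinearMap.le_opNorm₂ _ _ _))
      _ ≤ (Real.exp 11 * ‖ζ - ξ‖) * ‖σ - dl 0‖ * 2 +
          (Real.exp 11 * ‖ζ - ξ‖) * 1 * ‖σ - dl 0‖ := by
          rw [norm_dl]; gcongr
      _ = ‖σ - dl 0‖ * (3 * Real.exp 11) * ‖ζ - ξ‖ := by ring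
      _ ≤ _ := by gcongr
  obtain ⟨κ, P, hP⟩ := (isLaur_hol ht' c σ).exists_primitive two_pos.le
  have hnorm : ∀ {ζ : ℂ} {x : ℝ}, |x| ≤ 1 → ‖ζ‖ = Real.exp x → ζ ∈ An (3 / 2) :=
    fun {ζ x} hx hζ => by
      have := abs_le.1 hx
      rw [An, mem_ofPred_eq, hζ, Real.exp_le_exp, Real.exp_le_exp]
      constructor <;> linarith
  have habs : |t / 2| ≤ 1 := by rw [abs_of_nonneg] <;> linarith [ht.1, ht.2]
  refine ⟨⟨t / 2, c, c', κ, fun ζ => FF ζ σ σ, fun ζ => SS ζ σ, hol t c σ, P,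
    ⟨by linarith [ht.1], by linarith [ht.2]⟩, fun ζ hζ => hasDerivAt_FF σ (hmo hζ),
    fun ζ hζ h0 => ?_, fun ζ hζ => hP ζ (hmo2 hζ), fun ζ hζ => ?_, fun ζ hζ => ?_, ?_,
    fun ζ hζ => FF_conj (hm4 hζ) σ σ, fun ζ hζ => ?_, fun ζ hζ ξ hξ => (hlip ζ hζ ξ hξ).trans ?_,
    ?_⟩, fun ζ hζ ξ hξ => (hlip ζ hζ ξ hξ).trans ?_⟩
  · have h1 : ‖SS ζ (σ - dl 0)‖ ≤ 1 * ‖σ - dl 0‖ :=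
      (SS ζ).le_of_opNorm_le (norm_SS_le (hm4 hζ)) _
    rw [map_sub, h0, SS_dl_zero (hm4 hζ), zero_sub, norm_neg, norm_one] at h1
    linarith [hσ, min_le_left (1 / 2 : ℝ) (min η lipc / (3 * Real.exp 11))]
  · have m4 : ζ ∈ An 4 := An.mono (by norm_num) (hnorm habs hζ)
    have e := exp_mul_inv_of_norm hζ
    rw [mul_div_cancel₀ t two_ne_zero] at e
    simp only [hol, e, FF_conj m4, SS_conj m4]
    ring
  · have m := hnorm (by rwa [abs_neg]) hζ
    have m4 : ζ ∈ An 4 := An.mono (by norm_num) m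
    have e := exp_mul_inv_of_norm hζ
    rw [mul_neg, mul_div_cancel₀ t two_ne_zero] at e
    have h1 := SS_mul_FF_sub ht' hT (An.inv_mem m)
    rw [e, FF_conj m4, SS_conj m4, inv_inv] at h1
    simp only [hol]
    linear_combination SS ζ σ * h1
  · rw [gap] at hg
    rw [← hg]
    refine intervalIntegral.integral_congr fun v _ => ?_
    simp only [wir, mul_div_right_comm]
  · simp only [FF_neg (hm4 hζ), _root_.neg_apply]
  · gcongr; exact min_le_right _ _
  · simpa [asym] using ha
  · gcongr; exact min_le_left _ _

namespace Seed

variable (S : Seed)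

theorem exists_psi : ∃ Ψ : ℂ ≃ₜ ℂ, EqOn S.f Ψ (Ao (3 / 2)) := by
  have h : ApproximatesLinearOn S.f ((ContinuousLinearEquiv.refl ℝ ℂ : ℂ ≃L[ℝ] ℂ) : ℂ →L[ℝ] ℂ)
      (Ao (3 / 2)) lipc := S.lip
  refine h.exists_homeomorph_extension (.inr ?_)
  have hp := lipschitzExtensionConstant_pos ℂ
  have e : ‖((ContinuousLinearEquiv.refl ℝ ℂ).symm : ℂ →L[ℝ] ℂ)‖₊ = 1 :=
    ContinuousLinearMap.nnnorm_id
  rw [e, inv_one]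
  calc lipschitzExtensionConstant ℂ * lipc
      ≤ lipschitzExtensionConstant ℂ * (2 * lipschitzExtensionConstant ℂ)⁻¹ := by
        gcongr; exact min_le_right _ _
    _ = 1 / 2 := by field_simp
    _ < 1 := by norm_num

/-- The conformal map, extended to a homeomorphism of the plane. -/
def psi : ℂ ≃ₜ ℂ := S.exists_psi.choose

theorem psi_eq {ζ : ℂ} (h : ζ ∈ Ao (3 / 2)) : S.psi ζ = S.f ζ := (S.exists_psi.choose_spec h).symm

theorem eventually_mem {z : ℂ} (h : S.psi.symm z ∈ Ao (3 / 2)) :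
    ∀ᶠ w in 𝓝 z, S.psi.symm w ∈ Ao (3 / 2) :=
  S.psi.symm.continuous.continuousAt.eventually_mem ((isOpen_Ao _).mem_nhds h)

theorem hasDerivAt_symm {z : ℂ} (h : S.psi.symm z ∈ Ao (3 / 2)) :
    HasDerivAt S.psi.symm (S.s (S.psi.symm z) ^ 2)⁻¹ z := by
  refine HasDerivAt.of_local_left_inverse S.psi.symm.continuous.continuousAt (S.deriv_f _ h)
    (pow_ne_zero 2 (S.s_ne _ h)) ?_
  filter_upwards [S.eventually_mem h] with w hw
  rw [← S.psi_eq hw, S.psi.apply_symm_apply]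

theorem analyticAt_symm {z : ℂ} (h : S.psi.symm z ∈ Ao (3 / 2)) : AnalyticAt ℂ S.psi.symm z :=
  Complex.analyticAt_iff_eventually_differentiableAt.2
    ((S.eventually_mem h).mono fun _ hw => (S.hasDerivAt_symm hw).differentiableAt)

theorem analyticAt_P {ζ : ℂ} (h : ζ ∈ Ao (3 / 2)) : AnalyticAt ℂ S.P ζ :=
  Complex.analyticAt_iff_eventually_differentiableAt.2
    (((isOpen_Ao _).eventually_mem h).mono fun _ hw => (S.deriv_P _ hw).differentiableAt)

/-- The logarithm of the modulus of the annular coordinate. -/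
def lg (z : ℂ) : ℝ := Real.log ‖S.psi.symm z‖

/-- The solution on the complex plane, up to an additive constant. -/
def pot (z : ℂ) : ℝ := (S.P (S.psi.symm z)).re + S.κ * S.lg z - ‖z‖ ^ 2 / 2

theorem symm_ne_zero {z : ℂ} (h : S.psi.symm z ∈ Ao (3 / 2)) : S.psi.symm z ≠ 0 :=
  An.ne_zero (Ao_subset_An _ h)

theorem contDiffAt_lg {z : ℂ} (h : S.psi.symm z ∈ Ao (3 / 2)) : ContDiffAt ℝ (⊤ : ℕ∞) S.lg z :=
  (((S.analyticAt_symm h).contDiffAt.restrict_scalars ℝ).norm ℝ (S.symm_ne_zero h)).log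
    (norm_ne_zero_iff.2 (S.symm_ne_zero h))

theorem contDiffAt_pot {z : ℂ} (h : S.psi.symm z ∈ Ao (3 / 2)) :
    ContDiffAt ℝ (⊤ : ℕ∞) S.pot z := by
  have h1 : ContDiffAt ℝ (⊤ : ℕ∞) (fun z => S.P (S.psi.symm z)) z :=
    ((S.analyticAt_P h).comp (S.analyticAt_symm h)).contDiffAt.restrict_scalars ℝ
  exact ((Complex.reCLM.contDiff.contDiffAt.comp z h1).add
    (contDiffAt_const.mul (S.contDiffAt_lg h))).sub ((contDiffAt_id.norm_sq ℝ).div_const 2)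

theorem laplacian_norm_sq (z : ℂ) : Laplacian.laplacian (fun z : ℂ => ‖z‖ ^ 2) z = 4 := by
  rw [InnerProductSpace.laplacian_eq_iteratedFDeriv_complexPlane]
  have e : fderiv ℝ (2 • ⇑(innerSL ℝ (E := ℂ))) z = 2 • innerSL ℝ :=
    (2 • innerSL ℝ (E := ℂ)).hasFDerivAt.fderiv
  simp only [iteratedFDeriv_two_apply, fderiv_norm_sq, FunLike.coe_smul, e]
  change (2 • innerSL ℝ (1 : ℂ)) (1 : ℂ) + (2 • innerSL ℝ Complex.I) Complex.I = 4
  simp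
  norm_num

theorem laplacian_pot {z : ℂ} (h : S.psi.symm z ∈ Ao (3 / 2)) :
    Laplacian.laplacian S.pot z = -2 := by
  have h1 : InnerProductSpace.HarmonicAt
      ((fun z => (S.P (S.psi.symm z)).re) + S.κ • S.lg) z :=
    (AnalyticAt.harmonicAt_re ((S.analyticAt_P h).comp (S.analyticAt_symm h))).add
      ((AnalyticAt.harmonicAt_log_norm (S.analyticAt_symm h) (S.symm_ne_zero h)).const_smul)
  have h2 : ContDiffAt ℝ 2 (fun z : ℂ => ‖z‖ ^ 2) z := contDiffAt_id.norm_sq ℝ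
  have e : S.pot = ((fun z => (S.P (S.psi.symm z)).re) + S.κ • S.lg) -
      (1 / 2 : ℝ) • fun z : ℂ => ‖z‖ ^ 2 := by
    ext w; simp [pot]; ring
  have h3 : ContDiffAt ℝ 2 ((1 / 2 : ℝ) • fun z : ℂ => ‖z‖ ^ 2) z := contDiffAt_const.smul h2
  rw [e, ContDiffAt.laplacian_sub h1.1 h3, h1.2.self_of_nhds,
    InnerProductSpace.laplacian_smul _ h2, laplacian_norm_sq]
  norm_num

theorem hasFDerivAt_lg {z : ℂ} (h : S.psi.symm z ∈ Ao (3 / 2)) : HasFDerivAt S.lg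
    (innerSL ℝ (conj ((S.psi.symm z)⁻¹ * (S.s (S.psi.symm z) ^ 2)⁻¹))) z := by
  have h0 := S.symm_ne_zero h
  have h1 : HasFDerivAt S.psi.symm _ z := (S.hasDerivAt_symm h).hasFDerivAt.restrictScalars ℝ
  have h2 : HasFDerivAt (fun w => Real.log (‖S.psi.symm w‖ ^ 2)) _ z :=
    h1.norm_sq.log (pow_ne_zero 2 (norm_ne_zero_iff.2 h0))
  have h3 := h2.const_mul (1 / 2)
  refine (h3.congr_of_eventuallyEq (.of_forall fun w => ?_)).congr_fderiv ?_
  · simp only [lg, Real.log_pow]; push_cast; ring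
  · generalize (S.s (S.psi.symm z) ^ 2)⁻¹ = a
    have hn : Complex.normSq (S.psi.symm z) ≠ 0 := by simpa using h0
    ext w
    simp only [← Complex.normSq_eq_norm_sq]
    generalize S.psi.symm z = ζ at hn
    simp [Complex.inner]
    field_simp
    ring

/-- The complex conjugate of the gradient of the solution. -/
def grd (ζ : ℂ) : ℂ := (S.h ζ - conj (S.f ζ) * S.s ζ ^ 2) * (S.s ζ ^ 2)⁻¹

theorem hasFDerivAt_pot {z : ℂ} (h : S.psi.symm z ∈ Ao (3 / 2)) : HasFDerivAt S.pot
    (innerSL ℝ (conj (S.grd (S.psi.symm z)))) z := by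
  have h0 := S.symm_ne_zero h
  have h1 : HasFDerivAt (fun z => S.P (S.psi.symm z)) _ z :=
    ((S.deriv_P _ h).comp z (S.hasDerivAt_symm h)).hasFDerivAt.restrictScalars ℝ
  have h2 : HasFDerivAt (fun z => (S.P (S.psi.symm z)).re) _ z :=
    Complex.reCLM.hasFDerivAt.comp z h1
  have h3 := (h2.add ((S.hasFDerivAt_lg h).const_mul S.κ)).sub
    ((hasStrictFDerivAt_norm_sq z).hasFDerivAt.mul_const (1 / 2))
  refine (h3.congr_of_eventuallyEq (.of_forall fun w => ?_)).congr_fderiv ?_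
  · simp [pot]; ring
  · have hz : S.f (S.psi.symm z) = z := by rw [← S.psi_eq h, S.psi.apply_symm_apply]
    have hs := S.s_ne _ h
    have e : S.grd (S.psi.symm z) = S.h (S.psi.symm z) * (S.s (S.psi.symm z) ^ 2)⁻¹ - conj z := by
      rw [grd, hz]
      field_simp
    rw [e]
    generalize (S.s (S.psi.symm z) ^ 2)⁻¹ = a
    ext w
    generalize (S.psi.symm z)⁻¹ = ξ
    simp [Complex.inner]
    ring

theorem mem_of_norm {ζ : ℂ} {x : ℝ} (hx : |x| < 3 / 2) (h : ‖ζ‖ = Real.exp x) :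
    ζ ∈ Ao (3 / 2) := by
  have := abs_lt.1 hx
  rw [Ao, mem_ofPred_eq, h, Real.exp_lt_exp, Real.exp_lt_exp]
  exact this

theorem abs_r : |S.r| < 3 / 2 := by rw [abs_of_pos S.r_mem.1]; exact S.r_mem.2

theorem norm_grd_outer {ζ : ℂ} (h : ‖ζ‖ = Real.exp S.r) :
    ‖S.grd ζ‖ = |S.c| * Real.exp (-S.r) := by
  have hs := norm_ne_zero_iff.2 (S.s_ne ζ (mem_of_norm S.abs_r h))
  rw [grd, S.outer ζ h]
  simp only [norm_mul, norm_neg, Complex.norm_real, Real.norm_eq_abs, RCLike.norm_conj, norm_inv,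
    norm_pow, h, Real.exp_neg]
  field_simp

theorem norm_grd_inner {ζ : ℂ} (h : ‖ζ‖ = Real.exp (-S.r)) :
    ‖S.grd ζ‖ = |S.c'| * Real.exp S.r := by
  have hs := norm_ne_zero_iff.2 (S.s_ne ζ (mem_of_norm (by rw [abs_neg]; exact S.abs_r) h))
  rw [grd, S.inner ζ h]
  simp only [norm_mul, Complex.norm_real, Real.norm_eq_abs, RCLike.norm_conj, norm_inv,
    norm_pow, h, Real.exp_neg, inv_inv]
  field_simp

theorem hasDerivAt_psi {ζ : ℂ} (h : ζ ∈ Ao (3 / 2)) : HasDerivAt S.psi (S.s ζ ^ 2) ζ :=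
  (S.deriv_f ζ h).congr_of_eventuallyEq (((isOpen_Ao _).eventually_mem h).mono fun _ => S.psi_eq)

theorem hasDerivAt_pot_comp {γ : ℝ → ℂ} {γ' : ℂ} {x : ℝ} (hγ : HasDerivAt γ γ' x)
    (h : γ x ∈ Ao (3 / 2)) : HasDerivAt (fun x => S.pot (S.psi (γ x)))
      ((S.h (γ x) - conj (S.f (γ x)) * S.s (γ x) ^ 2) * γ').re x := by
  have h1 := (S.hasDerivAt_psi h).comp x hγ
  have h2 : S.psi.symm (S.psi (γ x)) = γ x := S.psi.symm_apply_apply _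
  have h3 : HasFDerivAt S.pot (innerSL ℝ (conj (S.grd (γ x)))) (S.psi (γ x)) := by
    have := S.hasFDerivAt_pot (z := S.psi (γ x)) (by rwa [h2])
    rwa [h2] at this
  have hs := S.s_ne _ h
  refine (h3.comp_hasDerivAt x h1).congr_deriv ?_
  have e : (S.h (γ x) - conj (S.f (γ x)) * S.s (γ x) ^ 2) * γ' =
      S.grd (γ x) * (S.s (γ x) ^ 2 * γ') := by
    rw [grd]; field_simp
  rw [e, innerSL_apply_apply, Complex.inner, Complex.conj_conj, mul_comm]

theorem pot_eq_of_norm {x a : ℝ} (hx : |x| < 3 / 2) (ha : ∀ ζ : ℂ, ‖ζ‖ = Real.exp x →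
    S.h ζ - conj (S.f ζ) * S.s ζ ^ 2 = a * (S.s ζ * conj (S.s ζ)) * ζ⁻¹) {ζ : ℂ}
    (h : ‖ζ‖ = Real.exp x) : S.pot (S.psi ζ) = S.pot (S.psi (Real.exp x)) := by
  set γ : ℝ → ℂ := fun θ => Complex.exp (x + θ * Complex.I) with hγ
  have hn : ∀ θ, ‖γ θ‖ = Real.exp x := fun θ => by simp [hγ, Complex.norm_exp]
  have hd : ∀ θ, HasDerivAt γ (γ θ * Complex.I) θ := fun θ => by
    have h1 : HasDerivAt (fun θ : ℝ => (x : ℂ) + θ * Complex.I) Complex.I θ := by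
      simpa using ((Complex.ofRealCLM.hasDerivAt (x := θ)).mul_const Complex.I).const_add (x : ℂ)
    exact h1.cexp
  have hd2 : ∀ θ, HasDerivAt (fun θ => S.pot (S.psi (γ θ))) 0 θ := fun θ => by
    refine (S.hasDerivAt_pot_comp (hd θ) (mem_of_norm hx (hn θ))).congr_deriv ?_
    have h0 : γ θ ≠ 0 := Complex.exp_ne_zero _
    rw [ha _ (hn θ), Complex.mul_conj]
    have e : (a : ℂ) * (Complex.normSq (S.s (γ θ)) : ℂ) * (γ θ)⁻¹ * (γ θ * Complex.I) =
        ((a * Complex.normSq (S.s (γ θ)) : ℝ) : ℂ) * Complex.I := by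
      push_cast; field_simp
    rw [e]
    simp
  have hc := is_const_of_deriv_eq_zero (fun θ => (hd2 θ).differentiableAt)
    (fun θ => (hd2 θ).deriv) ζ.arg 0
  have e1 : γ ζ.arg = ζ := by
    rw [hγ]
    simp only [Complex.exp_add, ← Complex.ofReal_exp, ← h, Complex.norm_mul_exp_arg_mul_I]
  have e2 : γ 0 = Real.exp x := by simp [hγ]
  simpa only [e1, e2] using hc

theorem pot_eq_pot : S.pot (S.psi (Real.exp S.r)) = S.pot (S.psi (Real.exp (-S.r))) := by
  have hd : ∀ v : ℝ, HasDerivAt (fun v : ℝ => ((Real.exp (S.r * v) : ℝ) : ℂ))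
      (S.r * Real.exp (S.r * v) : ℝ) v := fun v => by
    have h1 : HasDerivAt (fun v : ℝ => Real.exp (S.r * v)) (S.r * Real.exp (S.r * v)) v := by
      simpa [mul_comm] using ((hasDerivAt_id v).const_mul S.r).exp
    exact h1.ofReal_comp
  have hm : ∀ v ∈ uIcc (-1 : ℝ) 1, ((Real.exp (S.r * v) : ℝ) : ℂ) ∈ Ao (3 / 2) := fun v hv => by
    rw [uIcc_of_le (by norm_num)] at hv
    refine mem_of_norm (x := S.r * v) ?_
      (by rw [Complex.norm_real, Real.norm_eq_abs, Real.abs_exp])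
    rw [abs_mul]
    exact (mul_le_of_le_one_right (abs_nonneg _) (abs_le.2 hv)).trans_lt S.abs_r
  have hf : ContinuousOn S.f (Ao (3 / 2)) := fun ζ hζ =>
    (S.deriv_f ζ hζ).continuousAt.continuousWithinAt
  have hs : ContinuousOn (fun ζ => S.s ζ ^ 2) (Ao (3 / 2)) := by
    have h1 : DifferentiableOn ℂ S.f (Ao (3 / 2)) := fun ζ hζ =>
      (S.deriv_f ζ hζ).differentiableAt.differentiableWithinAt
    exact (h1.deriv (isOpen_Ao _)).continuousOn.congr fun ζ hζ => (S.deriv_f ζ hζ).deriv.symm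
  have hh : ContinuousOn S.h (Ao (3 / 2)) := by
    have h1 : DifferentiableOn ℂ S.P (Ao (3 / 2)) := fun ζ hζ =>
      (S.deriv_P ζ hζ).differentiableAt.differentiableWithinAt
    have h2 : ContinuousOn (fun ζ : ℂ => (S.κ : ℂ) * ζ⁻¹) (Ao (3 / 2)) :=
      continuousOn_const.mul (continuousOn_id.inv₀ fun ζ hζ => An.ne_zero (Ao_subset_An _ hζ))
    refine ((h1.deriv (isOpen_Ao _)).continuousOn.add h2).congr fun ζ hζ => ?_
    simp [(S.deriv_P ζ hζ).deriv]
  have hw : ContinuousOn (fun ζ => S.h ζ - conj (S.f ζ) * S.s ζ ^ 2) (Ao (3 / 2)) :=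
    hh.sub ((Complex.continuous_conj.comp_continuousOn hf).mul hs)
  have hI := intervalIntegral.integral_eq_sub_of_hasDerivAt
    (fun v hv => S.hasDerivAt_pot_comp (hd v) (hm v hv)) (ContinuousOn.intervalIntegrable
      (Complex.continuous_re.comp_continuousOn ((hw.comp (by fun_prop) hm).mul (by fun_prop))))
  rw [S.gap] at hI
  simpa using sub_eq_zero.1 hI.symm

theorem pot_of_norm {ζ : ℂ} (h : ‖ζ‖ = Real.exp S.r ∨ ‖ζ‖ = Real.exp (-S.r)) :
    S.pot (S.psi ζ) = S.pot (S.psi (Real.exp S.r)) := by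
  rcases h with h | h
  · exact S.pot_eq_of_norm (a := -S.c) S.abs_r (by simpa using S.outer) h
  · rw [S.pot_eq_pot]
    exact S.pot_eq_of_norm (by rw [abs_neg]; exact S.abs_r) S.inner h

end Seed

theorem image_exp_re_preimage {t : Set ℝ} :
    Complex.exp '' (Complex.re ⁻¹' t) = {ζ | ζ ≠ 0 ∧ Real.log ‖ζ‖ ∈ t} := by
  ext ζ
  constructor
  · rintro ⟨z, hz, rfl⟩
    exact ⟨Complex.exp_ne_zero z, by simpa [Complex.norm_exp] using hz⟩
  · rintro ⟨h0, h⟩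
    exact ⟨Complex.log ζ, by simpa [Complex.log_re] using h, Complex.exp_log h0⟩

theorem Ao_eq_image (ρ : ℝ) : Ao ρ = Complex.exp '' (Complex.re ⁻¹' Ioo (-ρ) ρ) := by
  rw [image_exp_re_preimage]
  ext ζ
  by_cases h0 : ζ = 0
  · simp [h0, Ao, (Real.exp_pos _).not_gt]
  · simp [h0, Ao, Real.lt_log_iff_exp_lt (norm_pos_iff.2 h0),
      Real.log_lt_iff_lt_exp (norm_pos_iff.2 h0)]

theorem An_eq_image (ρ : ℝ) : An ρ = Complex.exp '' (Complex.re ⁻¹' Icc (-ρ) ρ) := by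
  rw [image_exp_re_preimage]
  ext ζ
  by_cases h0 : ζ = 0
  · simp [h0, An, (Real.exp_pos _).not_ge]
  · simp [h0, An, Real.le_log_iff_exp_le (norm_pos_iff.2 h0),
      Real.log_le_iff_le_exp (norm_pos_iff.2 h0)]

theorem isConnected_image_exp {t : Set ℝ} (ht : Convex ℝ t) (hn : t.Nonempty) :
    IsConnected (Complex.exp '' (Complex.re ⁻¹' t)) := by
  obtain ⟨x, hx⟩ := hn
  have h : Convex ℝ (Complex.re ⁻¹' t) := ht.linear_preimage Complex.reLm
  have hc : IsConnected (Complex.re ⁻¹' t) := ⟨⟨x, by simpa using hx⟩, h.isPreconnected⟩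
  exact hc.image _ Complex.continuous_exp.continuousOn

theorem isConnected_Ao {ρ : ℝ} (h : 0 < ρ) : IsConnected (Ao ρ) := by
  rw [Ao_eq_image]
  exact isConnected_image_exp (convex_Ioo _ _) ⟨0, by simpa using h⟩

theorem isClosed_An (ρ : ℝ) : IsClosed (An ρ) :=
  (isClosed_le continuous_const continuous_norm).inter (isClosed_le continuous_norm continuous_const)

theorem isCompact_An (ρ : ℝ) : IsCompact (An ρ) :=
  (isCompact_closedBall (0 : ℂ) (Real.exp ρ)).of_isClosed_subset (isClosed_An ρ)
    fun ζ h => by simpa using h.2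

theorem closure_Ao {ρ : ℝ} (h : 0 < ρ) : closure (Ao ρ) = An ρ := by
  refine (closure_minimal (Ao_subset_An ρ) (isClosed_An ρ)).antisymm ?_
  rw [Ao_eq_image, An_eq_image, ← closure_Ioo (by linarith : -ρ ≠ ρ), ← Complex.closure_preimage_re]
  exact image_closure_subset_closure_image Complex.continuous_exp

theorem frontier_Ao {ρ : ℝ} (h : 0 < ρ) :
    frontier (Ao ρ) = {ζ | ‖ζ‖ = Real.exp ρ} ∪ {ζ | ‖ζ‖ = Real.exp (-ρ)} := by
  rw [(isOpen_Ao ρ).frontier_eq, closure_Ao h]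
  have hlt : Real.exp (-ρ) < Real.exp ρ := Real.exp_lt_exp.2 (by linarith)
  ext ζ
  simp only [An, Ao, Set.mem_sdiff, mem_ofPred_eq, mem_union]
  grind

theorem compl_An (ρ : ℝ) :
    (An ρ)ᶜ = {ζ | Real.exp ρ < ‖ζ‖} ∪ {ζ | ‖ζ‖ < Real.exp (-ρ)} := by
  ext ζ
  simp only [An, mem_compl_iff, mem_ofPred_eq, mem_union, not_and_or, not_le]
  exact or_comm

theorem isPreconnected_exterior (ρ : ℝ) : IsPreconnected {ζ : ℂ | Real.exp ρ < ‖ζ‖} := by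
  have : {ζ : ℂ | Real.exp ρ < ‖ζ‖} = Complex.exp '' (Complex.re ⁻¹' Ioi ρ) := by
    rw [image_exp_re_preimage]
    ext ζ
    by_cases h0 : ζ = 0
    · simp [h0, (Real.exp_pos _).not_gt]
    · simp [h0, Real.lt_log_iff_exp_lt (norm_pos_iff.2 h0)]
  rw [this]
  exact (isConnected_image_exp (convex_Ioi ρ) ⟨ρ + 1, by simp⟩).isPreconnected

theorem isPreconnected_interior (ρ : ℝ) : IsPreconnected {ζ : ℂ | ‖ζ‖ < Real.exp ρ} := by
  simpa [Metric.ball] using (convex_ball (0 : ℂ) (Real.exp ρ)).isPreconnected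

/-- In a disjoint union of two open preconnected sets, the component of a point of the first one
is the first one. -/
theorem connectedComponentIn_union_left {X : Type*} [TopologicalSpace X] {A B : Set X} {p : X}
    (hA : IsOpen A) (hB : IsOpen B) (hAB : Disjoint A B) (hc : IsPreconnected A) (hp : p ∈ A) :
    connectedComponentIn (A ∪ B) p = A := by
  refine Subset.antisymm ?_ (hc.subset_connectedComponentIn hp subset_union_left)
  exact isPreconnected_connectedComponentIn.subset_left_of_subset_union hA hB hAB
    (connectedComponentIn_subset _ _) ⟨p, mem_connectedComponentIn (.inl hp), hp⟩

theorem ringShapedWith_of_compl {Ω A B : Set E2} (h : (closure Ω)ᶜ = A ∪ B) (hA : IsOpen A)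
    (hB : IsOpen B) (hAB : Disjoint A B) (hAc : IsPreconnected A) (hBc : IsPreconnected B)
    (hBn : B.Nonempty) (hBb : Bornology.IsBounded B) (hΩ : Bornology.IsBounded Ω) :
    RingShapedWith Ω A B := by
  have hAu : ¬ Bornology.IsBounded A := fun hAb => by
    refine NormedSpace.unbounded_univ ℝ E2 (((hΩ.closure.union hAb).union hBb).subset fun x _ => ?_)
    by_cases hx : x ∈ closure Ω
    · exact .inl (.inl hx)
    · rcases h.subset hx with h | h
      · exact .inl (.inr h)
      · exact .inr h
  have hAn : A.Nonempty := by
    by_contra hn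
    exact hAu (by simp [not_nonempty_iff_eq_empty.1 hn])
  have cA : ∀ p ∈ A, connectedComponentIn (closure Ω)ᶜ p = A := fun p hp => by
    rw [h]; exact connectedComponentIn_union_left hA hB hAB hAc hp
  have cB : ∀ p ∈ B, connectedComponentIn (closure Ω)ᶜ p = B := fun p hp => by
    rw [h, union_comm]; exact connectedComponentIn_union_left hB hA hAB.symm hBc hp
  refine ⟨fun e => hAu (e ▸ hBb), hAu, fun C => ⟨?_, ?_⟩⟩
  · rintro ⟨p, hp, rfl⟩
    exact (h.subset hp).imp (cA p) (cB p)
  · rintro (rfl | rfl)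
    · obtain ⟨p, hp⟩ := hAn
      exact ⟨p, h.superset (.inl hp), (cA p hp).symm⟩
    · obtain ⟨p, hp⟩ := hBn
      exact ⟨p, h.superset (.inr hp), (cB p hp).symm⟩

theorem IsPreconnected.subset_left_or_right_of_closed {X : Type*} [TopologicalSpace X]
    {A B C : Set X} (hA : IsClosed A) (hB : IsClosed B) (hAB : Disjoint A B)
    (hC : IsPreconnected C) (h : C ⊆ A ∪ B) : C ⊆ A ∨ C ⊆ B := by
  by_contra! hn
  obtain ⟨x, hx, hxA⟩ := not_subset.1 hn.1
  obtain ⟨y, hy, hyB⟩ := not_subset.1 hn.2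
  obtain ⟨z, -, hzA, hzB⟩ := isPreconnected_closed_iff.1 hC A B hA hB h
    ⟨y, hy, (h hy).resolve_right hyB⟩ ⟨x, hx, (h hx).resolve_left hxA⟩
  exact hAB.notMem_of_mem_left hzA hzB

/-- A smooth germ is the germ of a globally smooth function. -/
theorem ContDiffOn.exists_contDiff {E : Type*} [NormedAddCommGroup E] [NormedSpace ℝ E]
    [HasContDiffBump E] {g : E → ℝ} {W : Set E} {x : E} (hg : ContDiffOn ℝ (⊤ : ℕ∞) g W)
    (hW : IsOpen W) (hx : x ∈ W) : ∃ (f : E → ℝ) (U : Set E), IsOpen U ∧ x ∈ U ∧ U ⊆ W ∧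
      ContDiff ℝ (⊤ : ℕ∞) f ∧ EqOn f g U := by
  obtain ⟨ε, hε, hb⟩ := Metric.isOpen_iff.1 hW x hx
  let φ : ContDiffBump x := ⟨ε / 4, ε / 2, by linarith, by linarith⟩
  refine ⟨fun y => φ y * g y, Metric.ball x (ε / 4), Metric.isOpen_ball,
    Metric.mem_ball_self (by linarith), (Metric.ball_subset_ball (by linarith)).trans hb, ?_, ?_⟩
  · refine contDiff_iff_contDiffAt.2 fun y => ?_
    by_cases hy : y ∈ tsupport φ
    · rw [φ.tsupport_eq] at hy
      exact φ.contDiff.contDiffAt.mul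
        (hg.contDiffAt (hW.mem_nhds (hb (Metric.closedBall_subset_ball (half_lt_self hε) hy))))
    · refine (contDiffAt_const (c := (0 : ℝ))).congr_of_eventuallyEq ?_
      filter_upwards [(isClosed_tsupport φ).isOpen_compl.mem_nhds hy] with w hw
      rw [image_eq_zero_of_notMem_tsupport hw, zero_mul]
  · intro y hy
    simp [φ.one_of_mem_closedBall (Metric.ball_subset_closedBall hy)]

/-- The standard isometric identification of the complex plane with the Euclidean plane. -/
def toE2 : ℂ ≃ₗᵢ[ℝ] E2 := Complex.orthonormalBasisOneI.repr

theorem toE2_symm_apply (x : E2) : toE2.symm x = x 0 + x 1 * Complex.I :=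
  Complex.orthonormalBasisOneI_repr_symm_apply x

theorem lap_comp_toE2_symm {f : ℂ → ℝ} {x : E2} :
    lap (fun y => f (toE2.symm y)) x = Laplacian.laplacian f (toE2.symm x) := by
  have h := toE2.symm.toContinuousLinearEquiv.iteratedFDerivWithin_comp_right f
    uniqueDiffOn_univ (x := x) (mem_univ _) 2
  simp only [preimage_univ, iteratedFDerivWithin_univ] at h
  have h' : iteratedFDeriv ℝ 2 (fun y => f (toE2.symm y)) x = _ := h
  rw [lap, h', InnerProductSpace.laplacian_eq_iteratedFDeriv_complexPlane, Fin.sum_univ_two]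
  simp only [ContinuousMultilinearMap.compContinuousLinearMap_apply]
  congr 2 <;> ext i <;> fin_cases i <;> simp [toE2_symm_apply]

namespace Seed

variable (S : Seed)

/-- The conformal map, extended to a homeomorphism onto the Euclidean plane. -/
def phi : ℂ ≃ₜ E2 := S.psi.trans toE2.toHomeomorph

/-- The ring-shaped domain. -/
def dom : Set E2 := S.phi '' Ao S.r

/-- The solution on the ring-shaped domain. -/
def sol (x : E2) : ℝ := S.pot (toE2.symm x) - S.pot (S.psi (Real.exp S.r))

theorem phi_apply (ζ : ℂ) : S.phi ζ = toE2 (S.psi ζ) := rfl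

theorem phi_symm_apply (x : E2) : S.phi.symm x = S.psi.symm (toE2.symm x) := rfl

theorem closure_dom : closure S.dom = S.phi '' An S.r := by
  rw [dom, ← S.phi.image_closure, closure_Ao S.r_mem.1]

theorem frontier_dom : frontier S.dom =
    S.phi '' {ζ | ‖ζ‖ = Real.exp S.r} ∪ S.phi '' {ζ | ‖ζ‖ = Real.exp (-S.r)} := by
  rw [dom, ← S.phi.image_frontier, frontier_Ao S.r_mem.1, image_union]

theorem isOpen_dom : IsOpen S.dom := S.phi.isOpenMap _ (isOpen_Ao _)

theorem isBounded_dom : Bornology.IsBounded S.dom :=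
  (((isCompact_An S.r).image S.phi.continuous).isBounded).subset
    (image_mono (Ao_subset_An _))

theorem symm_mem {x : E2} (hx : x ∈ closure S.dom) :
    S.psi.symm (toE2.symm x) ∈ Ao (3 / 2) := by
  rw [closure_dom] at hx
  obtain ⟨ζ, hζ, rfl⟩ := hx
  rw [← phi_symm_apply, S.phi.symm_apply_apply]
  exact An_subset_Ao S.r_mem.2 hζ

theorem contDiffAt_sol {x : E2} (hx : x ∈ closure S.dom) : ContDiffAt ℝ (⊤ : ℕ∞) S.sol x :=
  ((S.contDiffAt_pot (S.symm_mem hx)).comp x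
    toE2.symm.toContinuousLinearEquiv.contDiff.contDiffAt).sub contDiffAt_const

theorem lap_sol {x : E2} (hx : x ∈ closure S.dom) : lap S.sol x = -2 := by
  have h := S.symm_mem hx
  have e : lap S.sol x =
      (Laplacian.laplacian (S.pot - fun _ => S.pot (S.psi (Real.exp S.r))) : ℂ → ℝ) (toE2.symm x) := by
    rw [← lap_comp_toE2_symm]; rfl
  have hp : ContDiffAt ℝ 2 S.pot (toE2.symm x) := (S.contDiffAt_pot h).of_le (by norm_cast)
  rw [e, hp.laplacian_sub contDiffAt_const, S.laplacian_pot h]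
  simp

theorem sol_eq_zero {x : E2} (hx : x ∈ frontier S.dom) : S.sol x = 0 := by
  rw [frontier_dom, ← image_union] at hx
  obtain ⟨ζ, hζ, rfl⟩ := hx
  rw [sol, phi_apply, toE2.symm_apply_apply, S.pot_of_norm hζ, sub_self]

theorem norm_gradient_sol {x : E2} (hx : x ∈ closure S.dom) :
    ‖gradient S.sol x‖ = ‖S.grd (S.phi.symm x)‖ := by
  have h1 : HasFDerivAt S.sol _ x := ((S.hasFDerivAt_pot (S.symm_mem hx)).comp x
    (toE2.symm.toContinuousLinearEquiv.hasFDerivAt)).sub_const _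
  rw [gradient, h1.fderiv, LinearIsometryEquiv.norm_map]
  have := ContinuousLinearMap.opNorm_comp_linearIsometryEquiv
    (innerSL ℝ (conj (S.grd (S.psi.symm (toE2.symm x))))) toE2.symm
  refine this.trans ?_
  rw [innerSL_apply_norm, RCLike.norm_conj, phi_symm_apply]

theorem norm_gradient_sol_of_mem {x y : E2} (hx : x ∈ frontier S.dom)
    (hy : y ∈ connectedComponentIn (frontier S.dom) x) :
    ‖gradient S.sol y‖ = ‖gradient S.sol x‖ := by
  have hcl : ∀ a : ℝ, IsClosed (S.phi '' {ζ | ‖ζ‖ = a}) := fun a =>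
    S.phi.isClosedMap _ (isClosed_eq continuous_norm continuous_const)
  have hne : Real.exp S.r ≠ Real.exp (-S.r) := fun h => by
    have := Real.exp_injective h
    linarith [S.r_mem.1]
  have hd : Disjoint (S.phi '' {ζ | ‖ζ‖ = Real.exp S.r}) (S.phi '' {ζ | ‖ζ‖ = Real.exp (-S.r)}) :=
    (disjoint_image_iff S.phi.injective).2 (disjoint_left.2 fun ζ h h' => hne (h.symm.trans h'))
  have hg : ∀ a b : ℝ, (∀ ζ : ℂ, ‖ζ‖ = a → ‖S.grd ζ‖ = b) →
      ∀ z ∈ frontier S.dom, z ∈ S.phi '' {ζ | ‖ζ‖ = a} → ‖gradient S.sol z‖ = b := by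
    rintro a b h _ hz ⟨ζ, hζ, rfl⟩
    rw [S.norm_gradient_sol (frontier_subset_closure hz), S.phi.symm_apply_apply]
    exact h ζ hζ
  have hxm := mem_connectedComponentIn hx
  have hyf := connectedComponentIn_subset _ _ hy
  have hsub : connectedComponentIn (frontier S.dom) x ⊆ _ :=
    (connectedComponentIn_subset _ x).trans S.frontier_dom.subset
  rcases isPreconnected_connectedComponentIn.subset_left_or_right_of_closed (hcl _) (hcl _) hd
    hsub with h | h
  · have := hg _ _ fun _ => S.norm_grd_outer
    rw [this y hyf (h hy), this x hx (h hxm)]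
  · have := hg _ _ fun _ => S.norm_grd_inner
    rw [this y hyf (h hy), this x hx (h hxm)]

theorem ringShaped : ∃ A B, RingShapedWith S.dom A B := by
  refine ⟨S.phi '' {ζ | Real.exp S.r < ‖ζ‖}, S.phi '' {ζ | ‖ζ‖ < Real.exp (-S.r)},
    ringShapedWith_of_compl ?_ (S.phi.isOpenMap _ (isOpen_lt continuous_const continuous_norm))
      (S.phi.isOpenMap _ (isOpen_lt continuous_norm continuous_const)) ?_
      ((isPreconnected_exterior _).image _ S.phi.continuous.continuousOn)
      ((isPreconnected_interior _).image _ S.phi.continuous.continuousOn)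
      ⟨S.phi 0, 0, by simpa using Real.exp_pos _, rfl⟩ ?_ S.isBounded_dom⟩
  · rw [closure_dom, ← image_union, ← compl_An, image_compl_eq S.phi.bijective]
  · refine (disjoint_image_iff S.phi.injective).2 (disjoint_left.2 fun ζ h h' => ?_)
    have := Real.exp_lt_exp.1 (lt_trans (show Real.exp S.r < ‖ζ‖ from h) h')
    linarith [S.r_mem.1]
  · refine ((isCompact_closedBall (0 : ℂ) (Real.exp (-S.r))).image S.phi.continuous).isBounded.subset
      (image_mono fun ζ h => ?_)
    simpa using le_of_lt (show ‖ζ‖ < Real.exp (-S.r) from h)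

theorem hasFDerivAt_lg_sq {x : E2} (h : S.psi.symm (toE2.symm x) ∈ Ao (3 / 2))
    (h0 : S.lg (toE2.symm x) ≠ 0) :
    ∃ L : E2 →L[ℝ] ℝ, HasFDerivAt (fun y => S.lg (toE2.symm y) ^ 2 - S.r ^ 2) L x ∧ L ≠ 0 := by
  have hs := S.s_ne _ h
  have hζ := S.symm_ne_zero h
  have h1 := (S.hasFDerivAt_lg h).comp x toE2.symm.toContinuousLinearEquiv.hasFDerivAt
  generalize hv : conj ((S.psi.symm (toE2.symm x))⁻¹ * (S.s (S.psi.symm (toE2.symm x)) ^ 2)⁻¹) = v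
    at h1
  have hv0 : v ≠ 0 := by
    rw [← hv, Ne, map_eq_zero]
    exact mul_ne_zero (inv_ne_zero hζ) (inv_ne_zero (pow_ne_zero 2 hs))
  refine ⟨_, (h1.pow 2).sub_const _, fun hL => ?_⟩
  have := congrArg (fun L : E2 →L[ℝ] ℝ => L (toE2 v)) hL
  simp at this
  tauto

theorem smoothBoundary : SmoothBoundary S.dom := by
  intro x hx
  set g : E2 → ℝ := fun y => S.lg (toE2.symm y) ^ 2 - S.r ^ 2 with hg
  set W : Set E2 := S.phi '' (Ao (3 / 2) ∩ {ζ | ‖ζ‖ ≠ 1}) with hW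
  have hr := S.r_mem.1
  have hWo : IsOpen W :=
    S.phi.isOpenMap _ ((isOpen_Ao _).inter (isOpen_ne_fun continuous_norm continuous_const))
  have hWs : ∀ y ∈ W, S.phi.symm y ∈ Ao (3 / 2) ∧ S.lg (toE2.symm y) ≠ 0 := by
    rintro _ ⟨ζ, hζ, rfl⟩
    rw [S.phi.symm_apply_apply, phi_apply, toE2.symm_apply_apply, lg, S.psi.symm_apply_apply]
    have h0 := norm_pos_iff.2 (An.ne_zero (Ao_subset_An _ hζ.1))
    exact ⟨hζ.1, Real.log_ne_zero_of_pos_of_ne_one h0 hζ.2⟩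
  have hxW : x ∈ W := by
    rw [frontier_dom, ← image_union] at hx
    refine image_mono (fun ζ hζ => ?_) hx
    rcases hζ with h | h
    · refine ⟨mem_of_norm S.abs_r h, ?_⟩
      rw [mem_ofPred_eq, mem_ofPred_eq.mp h, Ne, Real.exp_eq_one_iff]
      exact hr.ne'
    · refine ⟨mem_of_norm (by rw [abs_neg]; exact S.abs_r) h, ?_⟩
      rw [mem_ofPred_eq, mem_ofPred_eq.mp h, Ne, Real.exp_eq_one_iff, neg_eq_zero]
      exact hr.ne'
  have hgs : ContDiffOn ℝ (⊤ : ℕ∞) g W := fun y hy =>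
    ((((S.contDiffAt_lg (hWs y hy).1).comp y
      toE2.symm.toContinuousLinearEquiv.contDiff.contDiffAt).pow 2).sub
        contDiffAt_const).contDiffWithinAt
  obtain ⟨f, U, hU, hxU, hUW, hf, hfg⟩ := hgs.exists_contDiff hWo hxW
  have hlog : ∀ y ∈ U, ∃ ζ : ℂ, y = S.phi ζ ∧ 0 < ‖ζ‖ ∧ f y = Real.log ‖ζ‖ ^ 2 - S.r ^ 2 := by
    intro y hy
    obtain ⟨h1, -⟩ := hWs y (hUW hy)
    exact ⟨S.phi.symm y, (S.phi.apply_symm_apply y).symm,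
      norm_pos_iff.2 (An.ne_zero (Ao_subset_An _ h1)), hfg hy⟩
  refine ⟨U, f, hU, hxU, hf, fun y hy => ?_, ?_, ?_⟩
  · obtain ⟨L, hL, hL0⟩ := S.hasFDerivAt_lg_sq (hWs y (hUW hy)).1 (hWs y (hUW hy)).2
    rwa [(hL.congr_of_eventuallyEq (hfg.eventuallyEq_of_mem (hU.mem_nhds hy))).fderiv]
  · ext y
    rw [mem_inter_iff, and_comm, mem_ofPred_eq]
    refine and_congr_right fun hy => ?_
    obtain ⟨ζ, rfl, h0, hζ⟩ := hlog y hy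
    rw [hζ, dom, S.phi.injective.mem_set_image, sub_neg, sq_lt_sq, abs_of_pos hr, abs_lt, Ao,
      mem_ofPred_eq, Real.lt_log_iff_exp_lt h0, Real.log_lt_iff_lt_exp h0]
  · ext y
    rw [mem_inter_iff, and_comm, mem_ofPred_eq]
    refine and_congr_right fun hy => ?_
    obtain ⟨ζ, rfl, h0, hζ⟩ := hlog y hy
    rw [hζ, frontier_dom, ← image_union, S.phi.injective.mem_set_image, sub_eq_zero,
      sq_eq_sq_iff_eq_or_eq_neg]
    have he : ∀ a : ℝ, Real.log ‖ζ‖ = a ↔ ‖ζ‖ = Real.exp a := fun a =>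
      ⟨fun h => by rw [← h, Real.exp_log h0], fun h => by rw [h, Real.log_exp]⟩
    rw [he, he]
    rfl

theorem isSerrinSolution : IsSerrinSolution S.dom S.sol where
  isOpen := S.isOpen_dom
  bounded := S.isBounded_dom
  connected := (isConnected_Ao S.r_mem.1).image _ S.phi.continuous.continuousOn
  smoothBoundary := S.smoothBoundary
  smooth _ hx := (S.contDiffAt_sol hx).contDiffWithinAt
  pde _ hx := S.lap_sol (subset_closure hx)
  bdry _ hx := S.sol_eq_zero hx

end Seed

open scoped Pointwise

/-- The extent of a planar set in the direction of a complex number. -/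
def width (ω : ℂ) (Ω : Set E2) : ℝ := sSup {t : ℝ | toE2 (t * ω) ∈ Ω}

theorem width_smul {a : ℝ} (ha : 0 < a) (ω : ℂ) (Ω : Set E2) :
    width ω ((fun x => a • x) '' Ω) = a * width ω Ω := by
  rw [width, width, ← smul_eq_mul, ← Real.sSup_smul_of_nonneg ha.le]
  congr 1
  ext t
  constructor
  · rintro ⟨x, hx, h⟩
    refine ⟨a⁻¹ * t, ?_, by simp [ha.ne']⟩
    have e : toE2 ((a⁻¹ * t : ℝ) * ω) = a⁻¹ • toE2 (t * ω) := by
      rw [← map_smul, Complex.real_smul]; push_cast; ring_nf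
    have h' : a • x = toE2 (t * ω) := h
    rw [mem_ofPred_eq, e, ← h', inv_smul_smul₀ ha.ne']
    exact hx
  · rintro ⟨t, ht, rfl⟩
    refine ⟨_, ht, ?_⟩
    simp only [← map_smul, Complex.real_smul, smul_eq_mul]
    push_cast
    ring_nf

theorem width_modelDomain (R : ℝ) : width 1 (modelDomain R) = width Complex.I (modelDomain R) := by
  simp [width, modelDomain]

/-- A bounded centrally symmetric set is not a nontrivial translate of a dilate of another
centrally symmetric set. -/
theorem EquivPair.exists_eq_smul {Ω Ω' : Set E2} {u u' : E2 → ℝ} (h : EquivPair Ω u Ω' u')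
    (hΩ : ∀ x ∈ Ω, -x ∈ Ω) (hΩ' : ∀ x ∈ Ω', -x ∈ Ω') (hn : Ω'.Nonempty)
    (hb : Bornology.IsBounded Ω') : ∃ a : ℝ, 0 < a ∧ Ω' = (fun x => a • x) '' Ω := by
  obtain ⟨a, x₀, ha, he, -⟩ := h
  suffices x₀ = 0 from ⟨a, ha, by simpa [this] using he⟩
  have hstep : ∀ x ∈ Ω', x - (2 : ℝ) • x₀ ∈ Ω' := by
    intro x hx
    obtain ⟨y, hy, rfl⟩ := he.subset hx
    have := hΩ' _ (he.superset ⟨-y, hΩ y hy, rfl⟩)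
    convert this using 1
    simp only [smul_neg, two_smul]
    abel
  obtain ⟨x, hx⟩ := hn
  have hit : ∀ n : ℕ, x - (n : ℝ) • (2 : ℝ) • x₀ ∈ Ω' := by
    intro n
    induction n with
    | zero => simpa using hx
    | succ n ih =>
      convert hstep _ ih using 1
      push_cast
      rw [add_smul, one_smul]
      abel
  obtain ⟨M, hM⟩ := hb.exists_norm_le
  by_contra h0
  have hp : 0 < ‖(2 : ℝ) • x₀‖ := norm_pos_iff.2 (smul_ne_zero two_ne_zero h0)
  obtain ⟨n, hn⟩ := exists_nat_gt ((M + M) / ‖(2 : ℝ) • x₀‖)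
  rw [div_lt_iff₀ hp] at hn
  have h1 : ‖(n : ℝ) • (2 : ℝ) • x₀‖ ≤ M + M := by
    have := norm_sub_le x (x - (n : ℝ) • (2 : ℝ) • x₀)
    rw [sub_sub_cancel] at this
    exact this.trans (add_le_add (hM _ hx) (hM _ (hit n)))
  rw [norm_smul, Real.norm_eq_abs, Nat.abs_cast] at h1
  exact hn.not_ge h1

theorem EquivPair.width_eq {Ω Ω' : Set E2} {u u' : E2 → ℝ} (h : EquivPair Ω u Ω' u')
    (hΩ : ∀ x ∈ Ω, -x ∈ Ω) (hΩ' : ∀ x ∈ Ω', -x ∈ Ω') (hn : Ω'.Nonempty)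
    (hb : Bornology.IsBounded Ω') :
    width 1 Ω' / width Complex.I Ω' = width 1 Ω / width Complex.I Ω := by
  obtain ⟨a, ha, rfl⟩ := h.exists_eq_smul hΩ hΩ' hn hb
  rw [width_smul ha, width_smul ha, mul_div_mul_left _ _ ha.ne']

theorem exists_ofReal_mul_iff {ω z : ℂ} (hω : ω = 1 ∨ ω = Complex.I) :
    (∃ t : ℝ, z = t * ω) ↔ ω ^ 2 * conj z = z := by
  rcases hω with rfl | rfl
  · simp only [mul_one, one_pow, one_mul, Complex.conj_eq_iff_real]
  · constructor
    · rintro ⟨t, rfl⟩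
      simp
    · intro h
      refine ⟨z.im, ?_⟩
      have := congrArg Complex.re h
      simp at this
      apply Complex.ext
      · simp; linarith
      · simp

namespace Seed

variable (S : Seed)

theorem exists_map_iff {ω ζ : ℂ} (hω : ω = 1 ∨ ω = Complex.I) (hζ : ζ ∈ Ao (3 / 2)) :
    (∃ t : ℝ, S.f ζ = t * ω) ↔ ∃ t : ℝ, ζ = t * ω := by
  have hc : conj ζ ∈ Ao (3 / 2) := by simpa [Ao] using hζ
  have hn : -conj ζ ∈ Ao (3 / 2) := by simpa [Ao] using hζ
  have hm : ω ^ 2 * conj ζ ∈ Ao (3 / 2) := by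
    rcases hω with rfl | rfl
    · simpa using hc
    · simpa using hn
  have hf : S.f (ω ^ 2 * conj ζ) = ω ^ 2 * conj (S.f ζ) := by
    rcases hω with rfl | rfl
    · simpa using S.map_conj ζ hζ
    · simp [S.map_neg _ hc, S.map_conj ζ hζ]
  rw [exists_ofReal_mul_iff hω, exists_ofReal_mul_iff hω, ← hf, ← S.psi_eq hm, ← S.psi_eq hζ,
    S.psi.injective.eq_iff]

theorem abs_sub_le {ω : ℂ} (hω : ‖ω‖ = 1) {t t' τ τ' η : ℝ}
    (hη : ‖S.f (τ * ω) - S.f (τ' * ω) - (τ * ω - τ' * ω)‖ ≤ η * ‖τ * ω - τ' * ω‖)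
    (ht : S.f (τ * ω) = t * ω) (ht' : S.f (τ' * ω) = t' * ω) :
    |t - t' - (τ - τ')| ≤ η * |τ - τ'| := by
  have e1 : (t * ω - t' * ω - (τ * ω - τ' * ω) : ℂ) = ((t - t' - (τ - τ') : ℝ) : ℂ) * ω := by
    push_cast; ring
  have e2 : (τ * ω - τ' * ω : ℂ) = ((τ - τ' : ℝ) : ℂ) * ω := by push_cast; ring
  rwa [ht, ht', e1, e2, norm_mul, norm_mul, hω, mul_one, mul_one, Complex.norm_real,
    Complex.norm_real] at hη

theorem norm_eq_one {ω : ℂ} (hω : ω = 1 ∨ ω = Complex.I) : ‖ω‖ = 1 := by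
  rcases hω with rfl | rfl <;> simp

theorem mem_Ao_of_mem_Ioo {ω : ℂ} (hω : ‖ω‖ = 1) {ρ τ : ℝ}
    (h : τ ∈ Ioo (Real.exp (-ρ)) (Real.exp ρ)) : (τ * ω : ℂ) ∈ Ao ρ := by
  rw [Ao, mem_ofPred_eq, norm_mul, hω, mul_one, Complex.norm_real, Real.norm_eq_abs,
    abs_of_pos ((Real.exp_pos _).trans h.1)]
  exact h

theorem exp_mem {ω : ℂ} (hω : ‖ω‖ = 1) : (Real.exp S.r * ω : ℂ) ∈ Ao (3 / 2) :=
  mem_of_norm S.abs_r (by rw [norm_mul, hω, mul_one, Complex.norm_real, Real.norm_eq_abs,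
    Real.abs_exp])

theorem toE2_mem_dom {z : ℂ} : toE2 z ∈ S.dom ↔ ∃ ζ ∈ Ao S.r, S.f ζ = z := by
  have hA := (Ao_subset_An S.r).trans (An_subset_Ao S.r_mem.2)
  constructor
  · rintro ⟨ζ, hζ, h⟩
    exact ⟨ζ, hζ, (S.psi_eq (hA hζ)).symm.trans (toE2.injective h)⟩
  · rintro ⟨ζ, hζ, rfl⟩
    exact ⟨ζ, hζ, by rw [phi_apply, S.psi_eq (hA hζ)]⟩

theorem lip_half : ∀ ζ ∈ Ao (3 / 2), ∀ ξ ∈ Ao (3 / 2),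
    ‖S.f ζ - S.f ξ - (ζ - ξ)‖ ≤ 1 / 2 * ‖ζ - ξ‖ := fun ζ hζ ξ hξ =>
  (S.lip ζ hζ ξ hξ).trans (mul_le_mul_of_nonneg_right
    (by exact_mod_cast (min_le_left _ _ : lipc ≤ _)) (norm_nonneg _))

theorem width_dom {ω : ℂ} (hω : ω = 1 ∨ ω = Complex.I) :
    S.f (Real.exp S.r * ω) = width ω S.dom * ω := by
  have h1 := norm_eq_one hω
  have hA := (Ao_subset_An S.r).trans (An_subset_Ao S.r_mem.2)
  have hE := S.exp_mem h1
  obtain ⟨g, hg⟩ := (S.exists_map_iff hω hE).2 ⟨_, rfl⟩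
  suffices IsLUB {t : ℝ | toE2 (t * ω) ∈ S.dom} g by
    rw [width, this.csSup_eq this.nonempty, hg]
  have key : ∀ {τ t : ℝ}, (τ * ω : ℂ) ∈ Ao S.r → S.f (τ * ω) = t * ω →
      |g - t - (Real.exp S.r - τ)| ≤ 1 / 2 * (Real.exp S.r - τ) := by
    intro τ t hm ht
    have hτ : τ ≤ Real.exp S.r := by
      have := hm.2.le
      rw [norm_mul, h1, mul_one, Complex.norm_real] at this
      exact (le_abs_self τ).trans this
    have := abs_sub_le S h1 (S.lip_half _ hE _ (hA hm)) hg ht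
    rwa [abs_of_nonneg (sub_nonneg.2 hτ)] at this
  constructor
  · intro t ht
    obtain ⟨ζ, hζ, h⟩ := S.toE2_mem_dom.1 ht
    obtain ⟨τ, rfl⟩ := (S.exists_map_iff hω (hA hζ)).1 ⟨t, h⟩
    have := abs_le.1 (key hζ h)
    have hτ : τ ≤ Real.exp S.r := by
      have := hζ.2.le
      rw [norm_mul, h1, mul_one, Complex.norm_real] at this
      exact (le_abs_self τ).trans this
    linarith
  · intro b hb
    have hlt : Real.exp (-S.r) < Real.exp S.r := Real.exp_lt_exp.2 (by linarith [S.r_mem.1])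
    have hmem : ∀ τ ∈ Ioo (Real.exp (-S.r)) (Real.exp S.r), g ≤ b + 3 / 2 * (Real.exp S.r - τ) := by
      intro τ hτ
      have hm := mem_Ao_of_mem_Ioo h1 hτ
      obtain ⟨t, ht⟩ := (S.exists_map_iff hω (hA hm)).2 ⟨τ, rfl⟩
      have h2 : t ≤ b := hb (S.toE2_mem_dom.2 ⟨_, hm, ht⟩)
      have := abs_le.1 (key hm ht)
      linarith
    have hcont : Tendsto (fun τ : ℝ => b + 3 / 2 * (Real.exp S.r - τ)) (𝓝[<] Real.exp S.r) (𝓝 b) := by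
      have : ContinuousAt (fun τ : ℝ => b + 3 / 2 * (Real.exp S.r - τ)) (Real.exp S.r) := by
        fun_prop
      simpa [ContinuousAt] using this.tendsto.mono_left nhdsWithin_le_nhds
    exact ge_of_tendsto hcont (mem_of_superset (Ioo_mem_nhdsLT hlt) hmem)

theorem width_ne : width 1 S.dom ≠ width Complex.I S.dom := by
  intro h
  apply S.asymm
  have h1 := S.width_dom (.inl rfl)
  have h2 := S.width_dom (.inr rfl)
  rw [mul_one] at h1
  rw [h1, h2, h, mul_one, mul_comm, mul_assoc, Complex.I_mul_I]
  ring

theorem abs_width_sub_le {η : ℝ} (hS : ∀ ζ ∈ Ao (3 / 2), ∀ ξ ∈ Ao (3 / 2),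
    ‖S.f ζ - S.f ξ - (ζ - ξ)‖ ≤ η * ‖ζ - ξ‖) {ω : ℂ} (hω : ω = 1 ∨ ω = Complex.I) :
    |width ω S.dom - Real.exp S.r| ≤ η * Real.exp S.r := by
  have h1 := norm_eq_one hω
  have hE := S.exp_mem h1
  have hn : ((-Real.exp S.r : ℝ) * ω : ℂ) ∈ Ao (3 / 2) := by
    simpa [Ao] using hE
  have hf : S.f ((-Real.exp S.r : ℝ) * ω) = (-width ω S.dom : ℝ) * ω := by
    rw [Complex.ofReal_neg, Complex.ofReal_neg, neg_mul, neg_mul, ← S.width_dom hω, S.map_neg _ hE]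
  have := abs_sub_le S h1 (hS _ hE _ hn) (S.width_dom hω) hf
  have e : width ω S.dom - -width ω S.dom - (Real.exp S.r - -Real.exp S.r) =
    2 * (width ω S.dom - Real.exp S.r) := by ring
  rw [e, sub_neg_eq_add, abs_mul, abs_two, ← two_mul, abs_mul, abs_two, Real.abs_exp] at this
  linarith

/-- The ratio of the extents of the domain along the coordinate axes. -/
def ratio : ℝ := width 1 S.dom / width Complex.I S.dom

theorem neg_mem_dom : ∀ x ∈ S.dom, -x ∈ S.dom := by
  have hA := (Ao_subset_An S.r).trans (An_subset_Ao S.r_mem.2)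
  intro x hx
  obtain ⟨z, rfl⟩ := toE2.surjective x
  obtain ⟨ζ, hζ, rfl⟩ := S.toE2_mem_dom.1 hx
  rw [← _root_.map_neg, S.toE2_mem_dom]
  exact ⟨-ζ, by simpa [Ao] using hζ, S.map_neg _ (hA hζ)⟩

theorem nonempty_dom : S.dom.Nonempty := (isConnected_Ao S.r_mem.1).nonempty.image _

theorem ratio_eq {S T : Seed} (h : EquivPair S.dom S.sol T.dom T.sol) : T.ratio = S.ratio :=
  h.width_eq S.neg_mem_dom T.neg_mem_dom T.nonempty_dom T.isBounded_dom

theorem width_pos {η : ℝ} (hη : η < 1) (hS : ∀ ζ ∈ Ao (3 / 2), ∀ ξ ∈ Ao (3 / 2),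
    ‖S.f ζ - S.f ξ - (ζ - ξ)‖ ≤ η * ‖ζ - ξ‖) {ω : ℂ} (hω : ω = 1 ∨ ω = Complex.I) :
    0 < width ω S.dom := by
  have h := (abs_le.1 (S.abs_width_sub_le hS hω)).1
  nlinarith [Real.exp_pos S.r]

theorem ratio_ne_one : S.ratio ≠ 1 := fun h =>
  S.width_ne ((div_eq_one_iff_eq (S.width_pos (by norm_num) S.lip_half (.inr rfl)).ne').1 h)

theorem abs_ratio_sub_one_le {η : ℝ} (hη : η ≤ 1 / 2) (hS : ∀ ζ ∈ Ao (3 / 2), ∀ ξ ∈ Ao (3 / 2),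
    ‖S.f ζ - S.f ξ - (ζ - ξ)‖ ≤ η * ‖ζ - ξ‖) : |S.ratio - 1| ≤ 4 * η := by
  have h1 := abs_le.1 (S.abs_width_sub_le hS (.inl rfl))
  have h2 := abs_le.1 (S.abs_width_sub_le hS (.inr rfl))
  have hp := S.width_pos (by linarith) hS (.inr rfl)
  have he := Real.exp_pos S.r
  have h0 : 0 ≤ η * Real.exp S.r := by linarith
  have h3 : 0 ≤ η := nonneg_of_mul_nonneg_left h0 he
  rw [ratio, div_sub_one hp.ne', abs_div, abs_of_pos hp, div_le_iff₀ hp, abs_le]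
  constructor <;> nlinarith

theorem not_equivPair_model (R : ℝ) :
    ¬ EquivPair (modelDomain R) (modelU R) S.dom S.sol := fun h => by
  obtain ⟨a, ha, hd⟩ := h.exists_eq_smul (fun x hx => by simpa [modelDomain] using hx)
    S.neg_mem_dom S.nonempty_dom S.isBounded_dom
  apply S.width_ne
  rw [hd, width_smul ha, width_smul ha, width_modelDomain]

theorem infinite_range_ratio : (range fun S : Seed => |S.ratio - 1|).Infinite := by
  intro hfin
  obtain ⟨S₀, -⟩ := exists_seed one_pos
  obtain ⟨_, ⟨S, rfl⟩, hmin⟩ := exists_min_image _ id hfin ⟨_, S₀, rfl⟩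
  have hpos : 0 < |S.ratio - 1| := abs_pos.2 (sub_ne_zero.2 S.ratio_ne_one)
  obtain ⟨T, hT⟩ := exists_seed (η := min (1 / 2) (|S.ratio - 1| / 8)) (by positivity)
  have h1 := T.abs_ratio_sub_one_le (min_le_left _ _) hT
  have h2 : |S.ratio - 1| ≤ |T.ratio - 1| := hmin _ ⟨T, rfl⟩
  have h3 := min_le_right (1 / 2) (|S.ratio - 1| / 8)
  linarith

end Seed

theorem exists_seq : ∃ F : ℕ → Seed, Function.Injective fun n => (F n).ratio := by
  choose F hF using fun n => (Seed.infinite_range_ratio.natEmbedding _ n).2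
  refine ⟨F, fun m n h => (Seed.infinite_range_ratio.natEmbedding _).injective (Subtype.ext ?_)⟩
  rw [← hF, ← hF]
  exact congrArg (fun x => |x - 1|) h

end

/-- there exist infinitely many pairwise non-equivalent ring-shaped solutions
`(Ω, u)` of the Serrin problem with `|∇u|` locally constant on `∂Ω` (constant on each of the
two boundary components) that are not equivalent to any ring-shaped model solution. -/
theorem bifurcation_multiplicity :
    ∃ F : ℕ → Set E2 × (E2 → ℝ),
      (∀ n : ℕ,
        IsSerrinSolution (F n).1 (F n).2 ∧
        (∃ A B : Set E2, RingShapedWith (F n).1 A B) ∧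
        (∀ x ∈ frontier (F n).1, ∀ y ∈ connectedComponentIn (frontier (F n).1) x,
          ‖gradient (F n).2 y‖ = ‖gradient (F n).2 x‖) ∧
        (∀ R ∈ Ioo (0:ℝ) 1, ¬ EquivPair (modelDomain R) (modelU R) (F n).1 (F n).2)) ∧
      (∀ m n : ℕ, m ≠ n → ¬ EquivPair (F m).1 (F m).2 (F n).1 (F n).2) := by
  obtain ⟨F, hF⟩ := exists_seq
  refine ⟨fun n => ((F n).dom, (F n).sol), fun n => ⟨(F n).isSerrinSolution, (F n).ringShaped,
    fun x hx y hy => (F n).norm_gradient_sol_of_mem hx hy,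
    fun R _ => (F n).not_equivPair_model R⟩, fun m n hmn h => hmn (hF (Seed.ratio_eq h).symm)⟩
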